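/- Let l > 0, λ₊, λ₋ ≥ 0 and α ∈ (0, min(1, 2π/l)). There exists a constant C > 0 depending only on l, α, λ₊, λ₋ such that every minimizer u of J(C_1, λ₊, λ₋) on the cone of length l with ∫_{C_1} |Du|² ≤ 1 satisfies |u(x) − u(y)| ≤ C · d(x, y)^{α/4} for all x, y ∈ C_{1/10}, where d is the cone distance. In particular the Hölder constant on C_{1/10} does not depend on the Lipschitz constant of u. -/

import Mathlib

open MeasureTheory Set

noncomputable section

/-- The cone distance on the cone of length `l`, in polar coordinates:
`d((r,θ),(s,φ)) = sqrt(r² + s² − 2 r s cos(min(δ, π)))` with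
`δ = min_{k ∈ ℤ} |θ − φ + k l|`. -/
def coneDist (l : ℝ) (p q : ℝ × ℝ) : ℝ :=
  Real.sqrt (p.1 ^ 2 + q.1 ^ 2 -
    2 * p.1 * q.1 * Real.cos (min (⨅ k : ℤ, |p.2 - q.2 + (k : ℝ) * l|) Real.pi))

/-- A Lipschitz function on the cone ball `C_R` of the cone of length `l`, given in
polar coordinates: `l`-periodic in `θ` and Lipschitz for the cone distance (this forces
a well-defined vertex value `u 0 _` and continuity at the vertex). -/
structure ConeLip (l R : ℝ) (u : ℝ → ℝ → ℝ) : Prop where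
  periodic : ∀ r θ : ℝ, u r (θ + l) = u r θ
  lipschitz : ∃ K : ℝ, ∀ p q : ℝ × ℝ, p.1 ∈ Set.Icc 0 R → q.1 ∈ Set.Icc 0 R →
    |u p.1 p.2 - u q.1 q.2| ≤ K * coneDist l p q

/-- The squared cone gradient `|Du|² = (∂_r u)² + (∂_θ u)²/r²` at a polar point,
computed from Lean's a.e.-defined derivatives. -/
def gradSq (u : ℝ → ℝ → ℝ) (p : ℝ × ℝ) : ℝ :=
  (deriv (fun s => u s p.2) p.1) ^ 2 + (deriv (fun φ => u p.1 φ) p.2) ^ 2 / p.1 ^ 2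

/-- The two-phase functional
`J(u, C_R) = ∫_{C_R} |Du|² + λ₊ area({u > 0} ∩ C_R) + λ₋ area({u < 0} ∩ C_R)`,
computed in polar coordinates with area measure `r dr dθ`, `θ` ranging over `(0, l)`. -/
def Jfun (l lp lm : ℝ) (u : ℝ → ℝ → ℝ) (R : ℝ) : ℝ :=
  ∫ p in Set.Ioo (0:ℝ) R ×ˢ Set.Ioo (0:ℝ) l,
    (gradSq u p + (if 0 < u p.1 p.2 then lp else 0)
      + (if u p.1 p.2 < 0 then lm else 0)) * p.1

/-- The Dirichlet energy `∫_{C_R} |Du|²` with respect to the area measure `r dr dθ`. -/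
def Dir (l : ℝ) (u : ℝ → ℝ → ℝ) (R : ℝ) : ℝ :=
  ∫ p in Set.Ioo (0:ℝ) R ×ˢ Set.Ioo (0:ℝ) l, gradSq u p * p.1

/-- `u` is a minimizer of `J(C_R, λ₊, λ₋)` on the cone of length `l`: a cone Lipschitz
function beating every cone Lipschitz competitor with the same boundary values on
`{r = R}`. -/
def IsMinimizerJ (l lp lm R : ℝ) (u : ℝ → ℝ → ℝ) : Prop :=
  ConeLip l R u ∧ ∀ w : ℝ → ℝ → ℝ, ConeLip l R w → (∀ θ : ℝ, w R θ = u R θ) →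
    Jfun l lp lm u R ≤ Jfun l lp lm w R

lemma abs_deriv_le_aux {f : ℝ → ℝ} {K x : ℝ} (hK : 0 ≤ K)
    (h : ∀ᶠ y in nhds x, |f y - f x| ≤ K * |y - x|) : |deriv f x| ≤ K := by
  have := norm_deriv_le_of_lip' (f := f) (x₀ := x) hK (by simpa [Real.norm_eq_abs] using h)
  simpa [Real.norm_eq_abs] using this

lemma deriv_sq_le_aux {f : ℝ → ℝ} {K a b : ℝ} (hK : 0 ≤ K)
    (hf : ∀ x ∈ Icc a b, ∀ y ∈ Icc a b, |f x - f y| ≤ K * |x - y|) {x : ℝ} (hx : x ∈ Ioo a b) :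
    |deriv f x| ≤ K := by
  apply abs_deriv_le_aux hK
  filter_upwards [Ioo_mem_nhds hx.1 hx.2] with y hy
  exact hf y (Ioo_subset_Icc_self hy) x (Ioo_subset_Icc_self hx)

lemma ftc_cs {f : ℝ → ℝ} {K a b : ℝ} (hab : a ≤ b) (hK : 0 ≤ K)
    (hf : ∀ x ∈ Icc a b, ∀ y ∈ Icc a b, |f x - f y| ≤ K * |x - y|) :
    (f b - f a) ^ 2 ≤ (b - a) * ∫ x in a..b, (deriv f x) ^ 2 := by
  rcases hab.eq_or_lt with rfl | hlt
  · simp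
  have hlip : LipschitzOnWith (Real.toNNReal K) f (uIcc a b) := by
    rw [uIcc_of_le hab]
    apply LipschitzOnWith.of_dist_le_mul
    intro x hx y hy
    rw [Real.dist_eq, Real.dist_eq, Real.coe_toNNReal K hK]
    exact hf x hx y hy
  have hac := hlip.absolutelyContinuousOnInterval
  have hIn := hac.intervalIntegrable_deriv
  have hftc := hac.integral_deriv_eq_sub
  have hIn2 : IntervalIntegrable (fun x => (deriv f x) ^ 2) volume a b := by
    rw [intervalIntegrable_iff_integrableOn_Ioo_of_le hab]
    refine Measure.integrableOn_of_bounded (M := K ^ 2) (by simp) ?_ ?_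
    · exact ((measurable_deriv f).pow_const 2).aestronglyMeasurable
    · refine (ae_restrict_iff' measurableSet_Ioo).2 (Filter.Eventually.of_forall fun x hx => ?_)
      rw [Real.norm_eq_abs, abs_pow]
      exact pow_le_pow_left₀ (abs_nonneg _) (deriv_sq_le_aux hK hf hx) 2
  set m := (f b - f a) / (b - a) with hm
  have h0 : 0 ≤ ∫ x in a..b, ((deriv f x) ^ 2 - 2 * m * deriv f x + m ^ 2) := by
    apply intervalIntegral.integral_nonneg hab
    intro x _
    nlinarith [sq_nonneg (deriv f x - m)]
  rw [intervalIntegral.integral_add (hIn2.sub (hIn.const_mul _)) (by simp),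
    intervalIntegral.integral_sub hIn2 (hIn.const_mul _), intervalIntegral.integral_const_mul,
    hftc, intervalIntegral.integral_const] at h0
  have hpos : 0 < b - a := by linarith
  have hmm : m * (b - a) = f b - f a := by rw [hm]; field_simp
  simp only [smul_eq_mul] at h0
  rw [← hmm] at h0 ⊢
  nlinarith

lemma int_deriv_sq_aux {f : ℝ → ℝ} {K : ℝ} (hK : 0 ≤ K)
    (hf : ∀ x y, |f x - f y| ≤ K * |x - y|) (a b : ℝ) :
    IntervalIntegrable (fun x => (deriv f x) ^ 2) volume a b := by
  rw [intervalIntegrable_iff]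
  refine Measure.integrableOn_of_bounded (M := K ^ 2) (by simp) ?_ ?_
  · exact ((measurable_deriv f).pow_const 2).aestronglyMeasurable
  · refine Filter.Eventually.of_forall fun x => ?_
    rw [Real.norm_eq_abs, abs_pow]
    exact pow_le_pow_left₀ (abs_nonneg _) (abs_deriv_le_aux hK
      (Filter.Eventually.of_forall fun y => hf y x)) 2

lemma cont_of_lip_aux {f : ℝ → ℝ} {K : ℝ} (hK : 0 ≤ K)
    (hf : ∀ x y, |f x - f y| ≤ K * |x - y|) : Continuous f := by
  have : LipschitzWith (Real.toNNReal K) f := by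
    apply LipschitzWith.of_dist_le_mul
    intro x y
    rw [Real.dist_eq, Real.dist_eq, Real.coe_toNNReal K hK]
    exact hf x y
  exact this.continuous

lemma periodic_deriv_aux {g : ℝ → ℝ} {L : ℝ} (hper : ∀ x, g (x + L) = g x) (x : ℝ) :
    deriv g (x + L) = deriv g x := by
  rw [← deriv_comp_add_const]
  congr 1
  funext y; exact hper y

lemma wirtinger {g : ℝ → ℝ} {K L : ℝ} (hL : 0 < L) (hK : 0 ≤ K)
    (hper : ∀ x, g (x + L) = g x)
    (hf : ∀ x y, |g x - g y| ≤ K * |x - y|) (t : ℝ) :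
    ∫ x in t..t + L, (g x - (∫ y in t..t + L, g y) / L) ^ 2 ≤
      L ^ 2 / 12 * ∫ x in t..t + L, (deriv g x) ^ 2 := by
  have hc : Continuous g := cont_of_lip_aux hK hf
  set F := ∫ x in t..t + L, (deriv g x) ^ 2 with hF
  set S := ∫ x in t..t + L, g x with hS
  set P := ∫ x in t..t + L, (g x) ^ 2 with hP
  have hi := int_deriv_sq_aux hK hf
  have hFper : ∀ θ, ∫ x in θ..θ + L, (deriv g x) ^ 2 = F := by
    intro θ
    have : Function.Periodic (fun x => (deriv g x) ^ 2) L := by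
      intro x; simp only [periodic_deriv_aux hper]
    exact this.intervalIntegral_add_eq θ t
  have key : ∀ θ φ, θ ≤ φ → φ ≤ θ + L →
      (g φ - g θ) ^ 2 ≤ F / L * ((φ - θ) * (L - (φ - θ))) := by
    intro θ φ h1 h2
    have e1 := ftc_cs (f := g) h1 hK (fun x _ y _ => hf x y)
    have e2 := ftc_cs (f := g) h2 hK (fun x _ y _ => hf x y)
    have e3 := intervalIntegral.integral_add_adjacent_intervals (hi θ φ) (hi φ (θ + L))
    rw [hFper] at e3
    rw [hper] at e2
    set A := ∫ x in θ..φ, (deriv g x) ^ 2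
    set B := ∫ x in φ..θ + L, (deriv g x) ^ 2
    rw [div_mul_eq_mul_div, le_div_iff₀ hL, ← e3]
    have q1 := mul_le_mul_of_nonneg_left e1 (by linarith : 0 ≤ L - (φ - θ))
    have q2 := mul_le_mul_of_nonneg_left e2 (by linarith : 0 ≤ φ - θ)
    nlinarith
  have key2 : ∀ θ, P - 2 * g θ * S + L * (g θ) ^ 2 ≤ F * L ^ 2 / 6 := by
    intro θ
    have e1 : ∫ φ in θ..θ + L, (g φ - g θ) ^ 2 ≤
        ∫ φ in θ..θ + L, F / L * ((φ - θ) * (L - (φ - θ))) := by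
      apply intervalIntegral.integral_mono_on (by linarith)
      · exact (by fun_prop : Continuous fun φ => (g φ - g θ) ^ 2).intervalIntegrable _ _
      · exact (by fun_prop : Continuous fun φ => F / L * ((φ - θ) * (L - (φ - θ)))).intervalIntegrable _ _
      · intro φ hφ; exact key θ φ hφ.1 hφ.2
    have e2 : ∫ φ in θ..θ + L, F / L * ((φ - θ) * (L - (φ - θ))) = F * L ^ 2 / 6 := by
      rw [intervalIntegral.integral_const_mul]
      have : ∫ φ in θ..θ + L, ((φ - θ) * (L - (φ - θ))) = ∫ φ in (0:ℝ)..L, φ * (L - φ) := by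
        rw [intervalIntegral.integral_comp_sub_right (fun φ => φ * (L - φ))]
        simp
      rw [this]
      have : ∫ φ in (0:ℝ)..L, φ * (L - φ) = L * (L ^ 2 / 2) - L ^ 3 / 3 := by
        have : (fun φ : ℝ => φ * (L - φ)) = fun φ => L * φ - φ ^ 2 := by funext φ; ring
        rw [this, intervalIntegral.integral_sub ((by fun_prop : Continuous fun φ : ℝ => L * φ).intervalIntegrable _ _)
          ((by fun_prop : Continuous fun φ : ℝ => φ ^ 2).intervalIntegrable _ _),
          intervalIntegral.integral_const_mul, integral_id, integral_pow]
        norm_num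
      rw [this]; field_simp; ring
    have e3 : ∫ φ in θ..θ + L, (g φ - g θ) ^ 2 = ∫ φ in t..t + L, (g φ - g θ) ^ 2 := by
      have : Function.Periodic (fun φ => (g φ - g θ) ^ 2) L := by
        intro x; simp only [hper]
      exact this.intervalIntegral_add_eq θ t
    have e4 : ∫ φ in t..t + L, (g φ - g θ) ^ 2 = P - 2 * g θ * S + L * (g θ) ^ 2 := by
      have : (fun φ => (g φ - g θ) ^ 2) = fun φ => (g φ) ^ 2 - 2 * g θ * g φ + (g θ) ^ 2 := by
        funext φ; ring
      rw [this, intervalIntegral.integral_add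
        ((by fun_prop : Continuous fun φ => (g φ) ^ 2 - 2 * g θ * g φ).intervalIntegrable _ _) (by simp),
        intervalIntegral.integral_sub
        ((by fun_prop : Continuous fun φ => (g φ) ^ 2).intervalIntegrable _ _)
        ((by fun_prop : Continuous fun φ => 2 * g θ * g φ).intervalIntegrable _ _),
        intervalIntegral.integral_const_mul, intervalIntegral.integral_const]
      simp [hP, hS]
    rw [← e4, ← e3, ← e2]; exact e1
  have key3 : L * P - 2 * S * S + L * P ≤ L * (F * L ^ 2 / 6) := by
    have e1 : ∫ θ in t..t + L, (P - 2 * g θ * S + L * (g θ) ^ 2) ≤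
        ∫ θ in t..t + L, F * L ^ 2 / 6 := by
      apply intervalIntegral.integral_mono_on (by linarith)
      · exact (by fun_prop : Continuous fun θ => P - 2 * g θ * S + L * (g θ) ^ 2).intervalIntegrable _ _
      · simp
      · intro φ hφ; exact key2 φ
    have : (fun θ => P - 2 * g θ * S + L * (g θ) ^ 2) = fun θ => P - (2 * S) * g θ + L * (g θ) ^ 2 := by
      funext φ; ring
    rw [this, intervalIntegral.integral_add
        ((by fun_prop : Continuous fun φ => P - 2 * S * g φ).intervalIntegrable _ _)
        ((by fun_prop : Continuous fun φ => L * (g φ) ^ 2).intervalIntegrable _ _),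
        intervalIntegral.integral_sub (by simp)
        ((by fun_prop : Continuous fun φ => 2 * S * g φ).intervalIntegrable _ _),
        intervalIntegral.integral_const_mul, intervalIntegral.integral_const_mul,
        intervalIntegral.integral_const, intervalIntegral.integral_const] at e1
    simpa [← hS, ← hP] using e1
  have e5 : ∫ x in t..t + L, (g x - S / L) ^ 2 = P - S ^ 2 / L := by
    have : (fun φ => (g φ - S / L) ^ 2) = fun φ => (g φ) ^ 2 - 2 * (S / L) * g φ + (S / L) ^ 2 := by
      funext φ; ring
    rw [this, intervalIntegral.integral_add
        ((by fun_prop : Continuous fun φ => (g φ) ^ 2 - 2 * (S / L) * g φ).intervalIntegrable _ _) (by simp),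
        intervalIntegral.integral_sub
        ((by fun_prop : Continuous fun φ => (g φ) ^ 2).intervalIntegrable _ _)
        ((by fun_prop : Continuous fun φ => 2 * (S / L) * g φ).intervalIntegrable _ _),
        intervalIntegral.integral_const_mul, intervalIntegral.integral_const, ← hS, ← hP]
    simp only [add_sub_cancel_left, smul_eq_mul]
    field_simp; ring
  rw [e5]
  have : 2 * L * (P - S ^ 2 / L) ≤ 2 * L * (L ^ 2 / 12 * F) := by
    have : 2 * L * (P - S ^ 2 / L) = L * P - 2 * S * S + L * P := by field_simp; ring
    rw [this]; linarith
  exact le_of_mul_le_mul_left this (by positivity)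

/-- Polar-coordinate Lipschitz functions on the unit ball of the cone of length `L`. -/
structure PolLip (L K : ℝ) (v : ℝ → ℝ → ℝ) : Prop where
  nonneg : 0 ≤ K
  per : ∀ r θ, v r (θ + L) = v r θ
  rad : ∀ r ∈ Icc (0:ℝ) 1, ∀ s ∈ Icc (0:ℝ) 1, ∀ θ, |v r θ - v s θ| ≤ K * |r - s|
  ang : ∀ r ∈ Icc (0:ℝ) 1, ∀ θ φ, |v r θ - v r φ| ≤ K * r * |θ - φ|

/-- Dirichlet energy on the angular window `(t, t+L)`. -/
def DirW (t L : ℝ) (v : ℝ → ℝ → ℝ) (ρ : ℝ) : ℝ :=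
  ∫ p in Ioo (0:ℝ) ρ ×ˢ Ioo t (t + L), gradSq v p * p.1

lemma gradSq_nonneg (v : ℝ → ℝ → ℝ) (p : ℝ × ℝ) : 0 ≤ gradSq v p := by
  unfold gradSq; positivity

lemma PolLip.zero {L K : ℝ} {v : ℝ → ℝ → ℝ} (h : PolLip L K v) (θ φ : ℝ) : v 0 θ = v 0 φ := by
  have := h.ang 0 (by simp) θ φ
  simp only [mul_zero, zero_mul] at this
  linarith [abs_nonpos_iff.1 this]

lemma PolLip.abs_dr {L K : ℝ} {v : ℝ → ℝ → ℝ} (h : PolLip L K v) {r : ℝ} (hr : r ∈ Ioo (0:ℝ) 1)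
    (θ : ℝ) : |deriv (fun s => v s θ) r| ≤ K :=
  deriv_sq_le_aux (a := 0) (b := 1) h.nonneg (fun x hx y hy => h.rad x hx y hy θ) hr

lemma PolLip.abs_dth {L K : ℝ} {v : ℝ → ℝ → ℝ} (h : PolLip L K v) {r : ℝ} (hr : r ∈ Icc (0:ℝ) 1)
    (θ : ℝ) : |deriv (fun φ => v r φ) θ| ≤ K * r :=
  abs_deriv_le_aux (mul_nonneg h.nonneg hr.1) (Filter.Eventually.of_forall fun y => h.ang r hr y θ)

lemma PolLip.gradSq_le {L K : ℝ} {v : ℝ → ℝ → ℝ} (h : PolLip L K v) {p : ℝ × ℝ}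
    (hp : p.1 ∈ Ioo (0:ℝ) 1) : gradSq v p ≤ 2 * K ^ 2 := by
  have h1 := sq_le_sq' (abs_le.1 (h.abs_dr hp p.2)).1 (abs_le.1 (h.abs_dr hp p.2)).2
  have h2 := h.abs_dth (Ioo_subset_Icc_self hp) p.2
  have h3 := sq_le_sq' (abs_le.1 h2).1 (abs_le.1 h2).2
  have h4 : (deriv (fun φ => v p.1 φ) p.2) ^ 2 / p.1 ^ 2 ≤ K ^ 2 := by
    rw [div_le_iff₀ (pow_pos hp.1 2)]; nlinarith
  unfold gradSq; linarith

/-- Radial clamping, to get a globally continuous function. -/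
def clampR (v : ℝ → ℝ → ℝ) : ℝ → ℝ → ℝ := fun r θ => v (max 0 (min r 1)) θ

lemma clamp_mem (r : ℝ) : max 0 (min r 1) ∈ Icc (0:ℝ) 1 := by
  constructor
  · exact le_max_left _ _
  · exact max_le zero_le_one (min_le_right _ _)

lemma clamp_eq {r : ℝ} (hr : r ∈ Icc (0:ℝ) 1) : max 0 (min r 1) = r := by
  rw [min_eq_left hr.2, max_eq_right hr.1]

lemma clamp_lip (r s : ℝ) : |max 0 (min r 1) - max 0 (min s 1)| ≤ |r - s| := by
  calc |max 0 (min r 1) - max 0 (min s 1)| ≤ |min r 1 - min s 1| := by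
        have := abs_max_sub_max_le_max 0 (min r 1) 0 (min s 1)
        simpa using this
    _ ≤ |r - s| := by
        have := abs_min_sub_min_le_max r 1 s 1
        simpa using this

lemma PolLip.clamp_lip {L K : ℝ} {v : ℝ → ℝ → ℝ} (h : PolLip L K v) (r s θ φ : ℝ) :
    |clampR v r θ - clampR v s φ| ≤ K * |r - s| + K * |θ - φ| := by
  unfold clampR
  have h1 := h.rad _ (clamp_mem r) _ (clamp_mem s) θ
  have h2 := h.ang _ (clamp_mem s) θ φ
  have h3 := _root_.clamp_lip r s
  have h4 : K * max 0 (min s 1) * |θ - φ| ≤ K * |θ - φ| := by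
    have := (clamp_mem s).2
    apply mul_le_mul_of_nonneg_right _ (abs_nonneg _)
    nlinarith [h.nonneg]
  have h5 := mul_le_mul_of_nonneg_left h3 h.nonneg
  have := abs_sub_le (v (max 0 (min r 1)) θ) (v (max 0 (min s 1)) θ) (v (max 0 (min s 1)) φ)
  linarith

lemma PolLip.clamp_lipschitz {L K : ℝ} {v : ℝ → ℝ → ℝ} (h : PolLip L K v) :
    LipschitzWith (Real.toNNReal (2 * K)) (fun p : ℝ × ℝ => clampR v p.1 p.2) := by
  apply LipschitzWith.of_dist_le_mul
  intro p q
  rw [Real.dist_eq, Real.coe_toNNReal _ (by linarith [h.nonneg])]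
  have h1 := h.clamp_lip p.1 q.1 p.2 q.2
  have h2 : |p.1 - q.1| ≤ dist p q := by rw [← Real.dist_eq, Prod.dist_eq]; exact le_max_left _ _
  have h3 : |p.2 - q.2| ≤ dist p q := by rw [← Real.dist_eq, Prod.dist_eq]; exact le_max_right _ _
  have h4 := mul_le_mul_of_nonneg_left h2 h.nonneg
  have h5 := mul_le_mul_of_nonneg_left h3 h.nonneg
  linarith

lemma clamp_deriv_r (v : ℝ → ℝ → ℝ) {p : ℝ × ℝ} (hp : p.1 ∈ Ioo (0:ℝ) 1) :
    deriv (fun s => clampR v s p.2) p.1 = deriv (fun s => v s p.2) p.1 := by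
  apply Filter.EventuallyEq.deriv_eq
  filter_upwards [Ioo_mem_nhds hp.1 hp.2] with s hs
  simp only [clampR, clamp_eq (Ioo_subset_Icc_self hs)]

lemma clamp_deriv_th (v : ℝ → ℝ → ℝ) {p : ℝ × ℝ} (hp : p.1 ∈ Ioo (0:ℝ) 1) :
    deriv (fun φ => clampR v p.1 φ) p.2 = deriv (fun φ => v p.1 φ) p.2 := by
  simp only [clampR, clamp_eq (Ioo_subset_Icc_self hp)]

lemma clamp_gradSq (v : ℝ → ℝ → ℝ) {p : ℝ × ℝ} (hp : p.1 ∈ Ioo (0:ℝ) 1) :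
    gradSq (clampR v) p = gradSq v p := by
  unfold gradSq; rw [clamp_deriv_r v hp, clamp_deriv_th v hp]

lemma PolLip.meas_dr {L K : ℝ} {v : ℝ → ℝ → ℝ} (h : PolLip L K v) :
    Measurable (fun p : ℝ × ℝ => deriv (fun s => clampR v s p.2) p.1) := by
  have hc : Continuous (Function.uncurry fun θ s => clampR v s θ) :=
    h.clamp_lipschitz.continuous.comp continuous_swap
  exact (measurable_deriv_with_param hc).comp measurable_swap

lemma PolLip.meas_dth {L K : ℝ} {v : ℝ → ℝ → ℝ} (h : PolLip L K v) :
    Measurable (fun p : ℝ × ℝ => deriv (fun φ => clampR v p.1 φ) p.2) := by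
  have hc : Continuous (Function.uncurry fun s θ => clampR v s θ) :=
    h.clamp_lipschitz.continuous
  exact (measurable_deriv_with_param hc)

lemma PolLip.meas_grad {L K : ℝ} {v : ℝ → ℝ → ℝ} (h : PolLip L K v) :
    Measurable (gradSq (clampR v)) := by
  unfold gradSq
  exact (h.meas_dr.pow_const 2).add ((h.meas_dth.pow_const 2).div (measurable_fst.pow_const 2))

lemma integrableOn_of_eq_bdd {f g : ℝ × ℝ → ℝ} {A : Set (ℝ × ℝ)} {M : ℝ} (hA : MeasurableSet A)
    (hfin : volume A ≠ ⊤) (hg : Measurable g) (hfg : ∀ p ∈ A, g p = f p)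
    (hb : ∀ p ∈ A, |f p| ≤ M) : IntegrableOn f A := by
  have : IntegrableOn g A := by
    refine Measure.integrableOn_of_bounded (M := M) hfin hg.aestronglyMeasurable ?_
    refine (ae_restrict_iff' hA).2 (Filter.Eventually.of_forall fun p hp => ?_)
    rw [Real.norm_eq_abs, hfg p hp]; exact hb p hp
  exact this.congr_fun (fun p hp => hfg p hp) hA

lemma PolLip.integrableOn {L K : ℝ} {v : ℝ → ℝ → ℝ} (h : PolLip L K v) {A : Set (ℝ × ℝ)}
    (hA : MeasurableSet A) (hfin : volume A ≠ ⊤) (hA1 : ∀ p ∈ A, p.1 ∈ Ioo (0:ℝ) 1) :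
    IntegrableOn (fun p => gradSq v p * p.1) A := by
  refine integrableOn_of_eq_bdd (M := 2 * K ^ 2) hA hfin (h.meas_grad.mul measurable_fst)
    (fun p hp => ?_) fun p hp => ?_
  · simp only [Pi.mul_apply, clamp_gradSq v (hA1 p hp)]
  · have h1 := h.gradSq_le (hA1 p hp)
    have h2 := gradSq_nonneg v p
    have h3 := hA1 p hp
    rw [abs_of_nonneg (mul_nonneg h2 h3.1.le)]
    nlinarith [h3.1, h3.2]

lemma vol_window (a b t s : ℝ) : volume (Ioo a b ×ˢ Ioo t s) ≠ ⊤ := by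
  rw [Measure.volume_eq_prod, Measure.prod_prod]
  simp [ENNReal.mul_eq_top]

lemma DirW_nonneg (t L : ℝ) (v : ℝ → ℝ → ℝ) (ρ : ℝ) : 0 ≤ DirW t L v ρ := by
  unfold DirW
  apply setIntegral_nonneg (measurableSet_Ioo.prod measurableSet_Ioo)
  intro p hp
  exact mul_nonneg (gradSq_nonneg v p) hp.1.1.le

lemma DirW_mono {t L K L' : ℝ} {v : ℝ → ℝ → ℝ} (h : PolLip L' K v) {ρ ρ' : ℝ} (hρ : ρ ≤ ρ')
    (hρ' : ρ' ≤ 1) : DirW t L v ρ ≤ DirW t L v ρ' := by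
  unfold DirW
  apply setIntegral_mono_set
  · exact h.integrableOn (measurableSet_Ioo.prod measurableSet_Ioo) (vol_window _ _ _ _)
      (fun p hp => ⟨hp.1.1, hp.1.2.trans_le hρ'⟩)
  · refine (ae_restrict_iff' (measurableSet_Ioo.prod measurableSet_Ioo)).2
      (Filter.Eventually.of_forall fun p hp => ?_)
    exact mul_nonneg (gradSq_nonneg v p) hp.1.1.le
  · exact (prod_mono (Ioo_subset_Ioo_right hρ) le_rfl).eventuallyLE

/-! Cone distance -/

lemma iInf_abs_bdd (l x : ℝ) : BddBelow (range fun k : ℤ => |x + (k : ℝ) * l|) :=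
  ⟨0, by rintro _ ⟨k, rfl⟩; exact abs_nonneg _⟩

lemma iInf_abs_nonneg (l x : ℝ) : 0 ≤ ⨅ k : ℤ, |x + (k : ℝ) * l| :=
  le_ciInf fun _ => abs_nonneg _

lemma iInf_abs_le (l x : ℝ) : ⨅ k : ℤ, |x + (k : ℝ) * l| ≤ |x| := by
  have := ciInf_le (iInf_abs_bdd l x) 0
  simpa using this

lemma iInf_abs_attained {l : ℝ} (hl : 0 < l) (x : ℝ) :
    ∃ k : ℤ, (⨅ k : ℤ, |x + (k : ℝ) * l|) = |x + (k : ℝ) * l| ∧ |x + (k : ℝ) * l| ≤ l / 2 := by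
  have e : ∀ k : ℤ, |x + (k : ℝ) * l| = l * |x / l - ((-k : ℤ) : ℝ)| := by
    intro k
    rw [← abs_of_pos hl, ← abs_mul, abs_of_pos hl]
    congr 1; push_cast; field_simp; ring
  refine ⟨-round (x / l), le_antisymm (ciInf_le (iInf_abs_bdd l x) _) (le_ciInf fun k => ?_), ?_⟩
  · rw [e, e]
    apply mul_le_mul_of_nonneg_left _ hl.le
    rw [neg_neg]
    exact round_le _ _
  · rw [e, neg_neg]
    have := abs_sub_round (x / l)
    nlinarith

lemma coneDist_rad (l r s θ : ℝ) : coneDist l (r, θ) (s, θ) = |r - s| := by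
  unfold coneDist
  have h : (⨅ k : ℤ, |θ - θ + (k : ℝ) * l|) = 0 := by
    apply le_antisymm _ (iInf_abs_nonneg _ _)
    have := iInf_abs_le l (θ - θ)
    simpa using this
  simp only [h]
  rw [min_eq_left Real.pi_pos.le, Real.cos_zero, ← Real.sqrt_sq_eq_abs]
  congr 1; ring

lemma coneDist_ang (l θ φ : ℝ) {r : ℝ} (hr : 0 ≤ r) :
    coneDist l (r, θ) (r, φ) ≤ r * |θ - φ| := by
  unfold coneDist
  simp only
  set δ := (⨅ k : ℤ, |θ - φ + (k : ℝ) * l|)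
  have h0 : 0 ≤ min δ Real.pi := le_min (iInf_abs_nonneg _ _) Real.pi_pos.le
  have h1 : min δ Real.pi ≤ |θ - φ| := (min_le_left _ _).trans (iInf_abs_le _ _)
  have h2 := Real.one_sub_sq_div_two_le_cos (x := min δ Real.pi)
  apply Real.sqrt_le_iff.2 ⟨by positivity, ?_⟩
  have h3 : (min δ Real.pi) ^ 2 ≤ |θ - φ| ^ 2 := pow_le_pow_left₀ h0 h1 2
  rw [mul_pow]
  nlinarith [sq_nonneg r]

lemma coneDist_lower {l : ℝ} (hl : 0 < l) (p q : ℝ × ℝ) (hp : 0 ≤ p.1) (hq : 0 ≤ q.1) :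
    |p.1 - q.1| ≤ coneDist l p q ∧ ∃ k : ℤ,
      min p.1 q.1 * |p.2 - q.2 + (k : ℝ) * l| ≤ 2 * (1 + l) * coneDist l p q := by
  obtain ⟨k, hk, hk2⟩ := iInf_abs_attained hl (p.2 - q.2)
  have hd : 0 ≤ |p.2 - q.2 + (k : ℝ) * l| := abs_nonneg _
  unfold coneDist
  rw [hk]
  set δ := |p.2 - q.2 + (k : ℝ) * l| with hδ
  set m := min δ Real.pi with hm
  have hm0 : 0 ≤ m := le_min hd Real.pi_pos.le
  have hmp : m ≤ Real.pi := min_le_right _ _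
  have hpq : 0 ≤ p.1 * q.1 := mul_nonneg hp hq
  constructor
  · apply Real.le_sqrt_of_sq_le
    rw [sq_abs]
    nlinarith [Real.cos_le_one m]
  · refine ⟨k, ?_⟩
    have h1 : δ ≤ (1 + l) * m := by
      rcases min_cases δ Real.pi with ⟨h, _⟩ | ⟨h, _⟩
      · rw [hm, h]; nlinarith
      · rw [hm, h]; nlinarith [Real.pi_gt_three]
    have h2 := Real.cos_le_one_sub_mul_cos_sq (x := m) (by rw [abs_of_nonneg hm0]; exact hmp)
    have h3 : min p.1 q.1 * m ≤ 2 * Real.sqrt (p.1 ^ 2 + q.1 ^ 2 - 2 * p.1 * q.1 * Real.cos m) := by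
      rw [← div_le_iff₀' (by norm_num)]
      apply Real.le_sqrt_of_sq_le
      have h4 : (min p.1 q.1) ^ 2 ≤ p.1 * q.1 := by
        rcases min_cases p.1 q.1 with ⟨h, h'⟩ | ⟨h, h'⟩ <;> rw [h] <;> nlinarith
      have h5 : (1:ℝ) / 8 ≤ 2 / Real.pi ^ 2 := by
        rw [div_le_div_iff₀ (by norm_num) (by positivity)]
        nlinarith [Real.pi_lt_four, Real.pi_pos]
      have h6 : m ^ 2 / 8 ≤ 1 - Real.cos m := by nlinarith [sq_nonneg m]
      have h7 : (min p.1 q.1 * m / 2) ^ 2 = (min p.1 q.1) ^ 2 * m ^ 2 / 4 := by ring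
      rw [h7]
      have h8 := mul_le_mul_of_nonneg_right h4 (sq_nonneg m)
      have h9 := mul_le_mul_of_nonneg_left h6 hpq
      nlinarith [sq_nonneg (p.1 - q.1)]
    calc min p.1 q.1 * δ ≤ min p.1 q.1 * ((1 + l) * m) :=
          mul_le_mul_of_nonneg_left h1 (le_min hp hq)
      _ = (1 + l) * (min p.1 q.1 * m) := by ring
      _ ≤ (1 + l) * (2 * Real.sqrt (p.1 ^ 2 + q.1 ^ 2 - 2 * p.1 * q.1 * Real.cos m)) :=
          mul_le_mul_of_nonneg_left h3 (by linarith)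
      _ = _ := by ring

lemma ConeLip.polLip {l : ℝ} {u : ℝ → ℝ → ℝ} (h : ConeLip l 1 u) : ∃ K, PolLip l K u := by
  obtain ⟨K, hK⟩ := h.lipschitz
  refine ⟨|K|, abs_nonneg _, h.periodic, fun r hr s hs θ => ?_, fun r hr θ φ => ?_⟩
  · have := hK (r, θ) (s, θ) hr hs
    rw [coneDist_rad] at this
    exact this.trans (mul_le_mul_of_nonneg_right (le_abs_self K) (abs_nonneg _))
  · have := hK (r, θ) (r, φ) hr hr
    have h2 := coneDist_ang l θ φ hr.1
    have h3 : 0 ≤ coneDist l (r, θ) (r, φ) := Real.sqrt_nonneg _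
    calc |u r θ - u r φ| ≤ K * coneDist l (r, θ) (r, φ) := this
      _ ≤ |K| * coneDist l (r, θ) (r, φ) := mul_le_mul_of_nonneg_right (le_abs_self K) h3
      _ ≤ |K| * (r * |θ - φ|) := mul_le_mul_of_nonneg_left h2 (abs_nonneg _)
      _ = _ := by ring

lemma per_int {l : ℝ} {f : ℝ → ℝ} (hf : ∀ x, f (x + l) = f x) (x : ℝ) (k : ℤ) :
    f (x + (k : ℝ) * l) = f x := by
  have : Function.Periodic f l := hf
  exact (this.int_mul k) x

lemma PolLip.coneBound {l K : ℝ} (hl : 0 < l) {u : ℝ → ℝ → ℝ} (h : PolLip l K u)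
    (p q : ℝ × ℝ) (hp : p.1 ∈ Icc (0:ℝ) 1) (hq : q.1 ∈ Icc (0:ℝ) 1) :
    |u p.1 p.2 - u q.1 q.2| ≤ (K * (3 + 2 * l)) * coneDist l p q := by
  obtain ⟨h1, k, h2⟩ := coneDist_lower hl p q hp.1 hq.1
  have e : u p.1 p.2 = u p.1 (p.2 + k * l) := (per_int (h.per p.1) p.2 k).symm
  have hx : p.2 + k * l - q.2 = p.2 - q.2 + k * l := by ring
  rw [e]
  have hK := h.nonneg
  have a1 := mul_le_mul_of_nonneg_left h1 hK
  have a2 := mul_le_mul_of_nonneg_left h2 hK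
  rcases le_total p.1 q.1 with hle | hle
  · rw [min_eq_left hle] at a2
    have b1 := h.ang p.1 hp (p.2 + k * l) q.2
    have b2 := h.rad p.1 hp q.1 hq q.2
    rw [hx] at b1
    have := abs_sub_le (u p.1 (p.2 + k * l)) (u p.1 q.2) (u q.1 q.2)
    nlinarith
  · rw [min_eq_right hle] at a2
    have b1 := h.ang q.1 hq (p.2 + k * l) q.2
    have b2 := h.rad p.1 hp q.1 hq (p.2 + k * l)
    rw [hx] at b1
    have := abs_sub_le (u p.1 (p.2 + k * l)) (u q.1 (p.2 + k * l)) (u q.1 q.2)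
    nlinarith

lemma PolLip.coneLip {l K : ℝ} (hl : 0 < l) {u : ℝ → ℝ → ℝ} (h : PolLip l K u) : ConeLip l 1 u :=
  ⟨h.per, K * (3 + 2 * l), fun p q hp hq => h.coneBound hl p q hp hq⟩

lemma Ioo_int_eq (f : ℝ → ℝ) {a b : ℝ} (hab : a ≤ b) :
    ∫ x in Ioo a b, f x = ∫ x in a..b, f x := by
  rw [intervalIntegral.integral_of_le hab, integral_Ioc_eq_integral_Ioo]

/-- angular energy of a slice -/
def angE (t L : ℝ) (v : ℝ → ℝ → ℝ) (s : ℝ) : ℝ := ∫ θ in t..t + L, (deriv (fun φ => v s φ) θ) ^ 2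

lemma angE_nonneg {t L : ℝ} (hL : 0 < L) (v : ℝ → ℝ → ℝ) (s : ℝ) : 0 ≤ angE t L v s :=
  intervalIntegral.integral_nonneg (by linarith) fun _ _ => sq_nonneg _

lemma shell_le {t L K L' : ℝ} {v : ℝ → ℝ → ℝ} (h : PolLip L' K v) {ρ₁ ρ₂ : ℝ} (h0 : 0 < ρ₁)
    (h12 : ρ₁ < ρ₂) (h2 : ρ₂ ≤ 1) :
    ∫ p in Ioo ρ₁ ρ₂ ×ˢ Ioo t (t + L), gradSq v p * p.1 ≤ DirW t L v ρ₂ - DirW t L v ρ₁ := by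
  have hi : ∀ a b, 0 ≤ a → b ≤ 1 →
      IntegrableOn (fun p => gradSq v p * p.1) (Ioo a b ×ˢ Ioo t (t + L)) := fun a b ha hb =>
    h.integrableOn (measurableSet_Ioo.prod measurableSet_Ioo) (vol_window _ _ _ _)
      (fun p hp => ⟨ha.trans_lt hp.1.1, hp.1.2.trans_le hb⟩)
  have hdisj : Disjoint (Ioo 0 ρ₁ ×ˢ Ioo t (t + L)) (Ioo ρ₁ ρ₂ ×ˢ Ioo t (t + L)) := by
    rw [Set.disjoint_left]
    intro p hp hq
    exact absurd (hp.1.2.trans hq.1.1) (lt_irrefl _)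
  have hu := setIntegral_union hdisj (measurableSet_Ioo.prod measurableSet_Ioo)
    (hi 0 ρ₁ le_rfl (by linarith)) (hi ρ₁ ρ₂ h0.le h2)
  have hm : ∫ p in (Ioo 0 ρ₁ ×ˢ Ioo t (t + L)) ∪ (Ioo ρ₁ ρ₂ ×ˢ Ioo t (t + L)), gradSq v p * p.1
      ≤ DirW t L v ρ₂ := by
    apply setIntegral_mono_set (hi 0 ρ₂ le_rfl h2)
    · refine (ae_restrict_iff' (measurableSet_Ioo.prod measurableSet_Ioo)).2
        (Filter.Eventually.of_forall fun p hp => ?_)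
      exact mul_nonneg (gradSq_nonneg v p) hp.1.1.le
    · apply LE.le.eventuallyLE
      apply union_subset
      · exact prod_mono (Ioo_subset_Ioo_right h12.le) le_rfl
      · exact prod_mono (Ioo_subset_Ioo_left h0.le) le_rfl
  rw [hu] at hm
  unfold DirW at *
  linarith

lemma slice_exists {t L K L' : ℝ} (hL : 0 < L) {v : ℝ → ℝ → ℝ} (h : PolLip L' K v) {ρ₁ ρ₂ : ℝ}
    (h0 : 0 < ρ₁) (h12 : ρ₁ < ρ₂) (h2 : ρ₂ ≤ 1) :
    ∃ s ∈ Ioo ρ₁ ρ₂, angE t L v s * (1 - ρ₁ / ρ₂) ≤ DirW t L v ρ₂ - DirW t L v ρ₁ := by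
  set B := Ioo ρ₁ ρ₂ ×ˢ Ioo t (t + L) with hB
  have hBm : MeasurableSet B := measurableSet_Ioo.prod measurableSet_Ioo
  have hρ2 : 0 < ρ₂ := h0.trans h12
  have hB1 : ∀ p ∈ B, p.1 ∈ Ioo (0:ℝ) 1 := fun p hp => ⟨h0.trans hp.1.1, hp.1.2.trans_le h2⟩
  have hIn : IntegrableOn (fun p : ℝ × ℝ => (deriv (fun φ => v p.1 φ) p.2) ^ 2) B := by
    refine integrableOn_of_eq_bdd (M := K ^ 2) hBm (vol_window _ _ _ _) (h.meas_dth.pow_const 2)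
      (fun p hp => ?_) (fun p hp => ?_)
    · simp only [clamp_deriv_th v (hB1 p hp)]
    · have h1 := h.abs_dth (Ioo_subset_Icc_self (hB1 p hp)) p.2
      have h3 : K * p.1 ≤ K := by nlinarith [h.nonneg, (hB1 p hp).2]
      rw [abs_pow]
      exact pow_le_pow_left₀ (abs_nonneg _) (h1.trans h3) 2
  have hle : (∫ p in B, (deriv (fun φ => v p.1 φ) p.2) ^ 2) / ρ₂ ≤
      DirW t L v ρ₂ - DirW t L v ρ₁ := by
    refine le_trans ?_ (shell_le h h0 h12 h2)
    rw [← integral_div]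
    apply setIntegral_mono_on (hIn.div_const _) _ hBm
    · intro p hp
      have hp1 := (hB1 p hp).1
      have e : (deriv (fun φ => v p.1 φ) p.2) ^ 2 / ρ₂ ≤
          (deriv (fun φ => v p.1 φ) p.2) ^ 2 / p.1 ^ 2 * p.1 := by
        have : (deriv (fun φ => v p.1 φ) p.2) ^ 2 / p.1 ^ 2 * p.1 =
          (deriv (fun φ => v p.1 φ) p.2) ^ 2 / p.1 := by field_simp
        rw [this]
        exact div_le_div_of_nonneg_left (sq_nonneg _) hp1 hp.1.2.le
      refine e.trans (mul_le_mul_of_nonneg_right ?_ hp1.le)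
      unfold gradSq
      linarith [sq_nonneg (deriv (fun s => v s p.2) p.1)]
    · exact h.integrableOn hBm (vol_window _ _ _ _) hB1
  have hfub : ∫ p in B, (deriv (fun φ => v p.1 φ) p.2) ^ 2 = ∫ s in Ioo ρ₁ ρ₂, angE t L v s := by
    rw [Measure.volume_eq_prod, hB, setIntegral_prod _ (by rw [← Measure.volume_eq_prod]; exact hIn)]
    congr 1
    funext s
    rw [Ioo_int_eq _ (by linarith)]; rfl
  have hInA : IntegrableOn (angE t L v) (Ioo ρ₁ ρ₂) := by
    have h1 : Integrable (fun p : ℝ × ℝ => (deriv (fun φ => v p.1 φ) p.2) ^ 2)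
        ((volume.restrict (Ioo ρ₁ ρ₂)).prod (volume.restrict (Ioo t (t + L)))) := by
      rw [Measure.prod_restrict, ← Measure.volume_eq_prod]; exact hIn
    have h3 := h1.integral_prod_left
    refine h3.congr (Filter.Eventually.of_forall fun s => ?_)
    simp only
    rw [Ioo_int_eq _ (by linarith)]; rfl
  obtain ⟨s, hs, hsle⟩ := exists_le_setAverage (μ := volume) (s := Ioo ρ₁ ρ₂) (f := angE t L v)
    (by simp [h12]) (by simp) hInA
  refine ⟨s, hs, ?_⟩
  rw [setAverage_eq, Measure.real, Real.volume_Ioo, ENNReal.toReal_ofReal (by linarith), smul_eq_mul,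
    ← hfub] at hsle
  have hd : 0 < ρ₂ - ρ₁ := by linarith
  calc angE t L v s * (1 - ρ₁ / ρ₂) = angE t L v s * (ρ₂ - ρ₁) / ρ₂ := by field_simp
    _ ≤ (∫ p in B, (deriv (fun φ => v p.1 φ) p.2) ^ 2) / ρ₂ := by
        apply div_le_div_of_nonneg_right _ hρ2.le
        calc angE t L v s * (ρ₂ - ρ₁) ≤ ((ρ₂ - ρ₁)⁻¹ * ∫ p in B, (deriv (fun φ => v p.1 φ) p.2) ^ 2) * (ρ₂ - ρ₁) :=
              mul_le_mul_of_nonneg_right hsle hd.le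
          _ = _ := by field_simp
    _ ≤ _ := hle

/-- angular mean -/
def angM (t L : ℝ) (v : ℝ → ℝ → ℝ) (s : ℝ) : ℝ := (∫ θ in t..t + L, v s θ) / L

lemma PolLip.slice_lip {L K : ℝ} {v : ℝ → ℝ → ℝ} (h : PolLip L K v) {r : ℝ} (hr : r ∈ Icc (0:ℝ) 1) :
    ∀ x y, |v r x - v r y| ≤ K * |x - y| := by
  intro x y
  refine (h.ang r hr x y).trans (mul_le_mul_of_nonneg_right ?_ (abs_nonneg _))
  nlinarith [h.nonneg, hr.2]

lemma PolLip.slice_cont {L K : ℝ} {v : ℝ → ℝ → ℝ} (h : PolLip L K v) {r : ℝ} (hr : r ∈ Icc (0:ℝ) 1) :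
    Continuous (v r) :=
  cont_of_lip_aux h.nonneg (h.slice_lip hr)

lemma angM_zero {t L K : ℝ} (hL : 0 < L) {v : ℝ → ℝ → ℝ} (h : PolLip L K v) {r : ℝ}
    (hr : r ∈ Icc (0:ℝ) 1) : |angM t L v r - v 0 0| ≤ K * r := by
  have e : angM t L v r - v 0 0 = (∫ θ in t..t + L, (v r θ - v 0 0)) / L := by
    rw [intervalIntegral.integral_sub ((h.slice_cont hr).intervalIntegrable _ _) (by simp),
      intervalIntegral.integral_const, angM]
    simp only [add_sub_cancel_left, smul_eq_mul]
    field_simp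
  rw [e, abs_div, abs_of_pos hL, div_le_iff₀ hL]
  have := intervalIntegral.norm_integral_le_of_norm_le_const (a := t) (b := t + L) (C := K * r)
    (f := fun θ => v r θ - v 0 0) (fun θ _ => by
      rw [Real.norm_eq_abs, h.zero 0 θ]
      have := h.rad r hr 0 (by simp) θ
      rwa [sub_zero, abs_of_nonneg hr.1] at this)
  rw [Real.norm_eq_abs] at this
  simpa [abs_of_pos hL] using this

lemma angM_osc {t L K : ℝ} (hL : 0 < L) {v : ℝ → ℝ → ℝ} (h : PolLip L K v) {r : ℝ}
    (hr : r ∈ Icc (0:ℝ) 1) (φ : ℝ) : (v r φ - angM t L v r) ^ 2 ≤ L * angE t L v r := by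
  have hlip := h.slice_lip hr
  have hE : ∀ θ, ∫ x in θ..θ + L, (deriv (v r) x) ^ 2 = angE t L v r := by
    intro θ
    have : Function.Periodic (fun x => (deriv (v r) x) ^ 2) L := by
      intro x; simp only [periodic_deriv_aux (h.per r)]
    exact this.intervalIntegral_add_eq θ t
  have hpt : ∀ θ ∈ Icc φ (φ + L), |v r θ - v r φ| ≤ Real.sqrt (L * angE t L v r) := by
    intro θ hθ
    apply Real.abs_le_sqrt
    have h1 := ftc_cs (f := v r) hθ.1 h.nonneg (fun x _ y _ => hlip x y)
    have hi := int_deriv_sq_aux h.nonneg hlip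
    have h2 := intervalIntegral.integral_add_adjacent_intervals (hi φ θ) (hi θ (φ + L))
    have h3 : 0 ≤ ∫ x in θ..φ + L, (deriv (v r) x) ^ 2 :=
      intervalIntegral.integral_nonneg hθ.2 fun _ _ => sq_nonneg _
    have h4 : 0 ≤ ∫ x in φ..θ, (deriv (v r) x) ^ 2 :=
      intervalIntegral.integral_nonneg hθ.1 fun _ _ => sq_nonneg _
    rw [hE] at h2
    have h5 : θ - φ ≤ L := by linarith [hθ.2]
    have h6 : 0 ≤ θ - φ := by linarith [hθ.1]
    nlinarith
  have e : angM t L v r - v r φ = (∫ θ in φ..φ + L, (v r θ - v r φ)) / L := by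
    have : ∫ θ in φ..φ + L, v r θ = ∫ θ in t..t + L, v r θ := by
      have : Function.Periodic (v r) L := h.per r
      exact this.intervalIntegral_add_eq φ t
    rw [intervalIntegral.integral_sub ((h.slice_cont hr).intervalIntegrable _ _) (by simp),
      intervalIntegral.integral_const, angM, this]
    simp only [add_sub_cancel_left, smul_eq_mul]
    field_simp
  have h7 : |angM t L v r - v r φ| ≤ Real.sqrt (L * angE t L v r) := by
    rw [e, abs_div, abs_of_pos hL, div_le_iff₀ hL]
    have := intervalIntegral.norm_integral_le_of_norm_le_const (a := φ) (b := φ + L)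
      (C := Real.sqrt (L * angE t L v r))
      (f := fun θ => v r θ - v r φ) (fun θ hθ => by
        rw [Real.norm_eq_abs]
        rw [uIoc_of_le (by linarith)] at hθ
        exact hpt θ ⟨hθ.1.le, hθ.2⟩)
    rw [Real.norm_eq_abs] at this
    simpa [abs_of_pos hL] using this
  have h8 : 0 ≤ L * angE t L v r := mul_nonneg hL.le (angE_nonneg hL v r)
  rw [← Real.sq_sqrt h8, ← sq_abs, abs_sub_comm]
  exact pow_le_pow_left₀ (abs_nonneg _) h7 2

lemma angM_step {t L K : ℝ} (hL : 0 < L) {v : ℝ → ℝ → ℝ} (h : PolLip L K v) {r : ℝ}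
    (hr0 : 0 < r) (hr1 : r ≤ 1) : (angM t L v r - angM t L v (r / 2)) ^ 2 ≤ DirW t L v r / L := by
  have hr : r ∈ Icc (0:ℝ) 1 := ⟨hr0.le, hr1⟩
  have hr2 : r / 2 ∈ Icc (0:ℝ) 1 := ⟨by linarith, by linarith⟩
  set B := Ioo (r / 2) r ×ˢ Ioo t (t + L) with hB
  have hBm : MeasurableSet B := measurableSet_Ioo.prod measurableSet_Ioo
  have hB1 : ∀ p ∈ B, p.1 ∈ Ioo (0:ℝ) 1 :=
    fun p hp => ⟨by linarith [hp.1.1], hp.1.2.trans_le hr1⟩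
  have hIn : IntegrableOn (fun p : ℝ × ℝ => (deriv (fun s => v s p.2) p.1) ^ 2 * p.1) B := by
    refine integrableOn_of_eq_bdd (M := K ^ 2) hBm (vol_window _ _ _ _)
      ((h.meas_dr.pow_const 2).mul measurable_fst)
      (fun p hp => ?_) (fun p hp => ?_)
    · simp only [Pi.mul_apply, clamp_deriv_r v (hB1 p hp)]
    · have h1 := h.abs_dr (hB1 p hp) p.2
      have h3 := hB1 p hp
      have h4 := pow_le_pow_left₀ (abs_nonneg _) h1 2
      rw [abs_mul, abs_pow, abs_of_pos h3.1]
      nlinarith [h3.1, h3.2, sq_nonneg |deriv (fun s => v s p.2) p.1|]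
  have hle : ∫ p in B, (deriv (fun s => v s p.2) p.1) ^ 2 * p.1 ≤ DirW t L v r := by
    have h1 := shell_le (t := t) (L := L) h (half_pos hr0) (half_lt_self hr0) hr1
    have h2 := DirW_nonneg t L v (r / 2)
    refine le_trans ?_ (h1.trans (by linarith))
    apply setIntegral_mono_on hIn (h.integrableOn hBm (vol_window _ _ _ _) hB1) hBm
    intro p hp
    apply mul_le_mul_of_nonneg_right _ (hB1 p hp).1.le
    unfold gradSq
    have : 0 ≤ (deriv (fun φ => v p.1 φ) p.2) ^ 2 / p.1 ^ 2 := by positivity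
    linarith
  have hi1 : Integrable (fun p : ℝ × ℝ => (deriv (fun s => v s p.2) p.1) ^ 2 * p.1)
      ((volume.restrict (Ioo (r / 2) r)).prod (volume.restrict (Ioo t (t + L)))) := by
    rw [Measure.prod_restrict, ← Measure.volume_eq_prod]; exact hIn
  have hfub : ∫ p in B, (deriv (fun s => v s p.2) p.1) ^ 2 * p.1 =
      ∫ θ in Ioo t (t + L), ∫ s in Ioo (r / 2) r, (deriv (fun s => v s θ) s) ^ 2 * s := by
    rw [Measure.volume_eq_prod, hB, ← Measure.prod_restrict, integral_prod_symm _ hi1]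
  set D : ℝ → ℝ := fun θ => v r θ - v (r / 2) θ with hD
  have hDc : Continuous D := (h.slice_cont hr).sub (h.slice_cont hr2)
  have hpt : ∀ θ, (D θ) ^ 2 ≤ ∫ s in Ioo (r / 2) r, (deriv (fun s => v s θ) s) ^ 2 * s := by
    intro θ
    have h1 := ftc_cs (f := fun s => v s θ) (half_lt_self hr0).le h.nonneg (fun x hx y hy =>
      h.rad x ⟨by linarith [hx.1], by linarith [hx.2]⟩ y ⟨by linarith [hy.1], by linarith [hy.2]⟩ θ)
    refine h1.trans ?_
    rw [← Ioo_int_eq _ (half_lt_self hr0).le, ← integral_const_mul]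
    have hb : ∀ s ∈ Ioo (r / 2) r, |deriv (fun s => v s θ) s| ≤ K := fun s hs =>
      h.abs_dr ⟨by linarith [hs.1], by linarith [hs.2]⟩ θ
    have i1 : IntegrableOn (fun s => (deriv (fun s => v s θ) s) ^ 2) (Ioo (r / 2) r) := by
      refine Measure.integrableOn_of_bounded (M := K ^ 2) (by simp)
        ((measurable_deriv _).pow_const 2).aestronglyMeasurable ?_
      refine (ae_restrict_iff' measurableSet_Ioo).2 (Filter.Eventually.of_forall fun s hs => ?_)
      rw [Real.norm_eq_abs, abs_pow]
      exact pow_le_pow_left₀ (abs_nonneg _) (hb s hs) 2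
    have i2 : IntegrableOn (fun s => (deriv (fun s => v s θ) s) ^ 2 * s) (Ioo (r / 2) r) := by
      refine Measure.integrableOn_of_bounded (M := K ^ 2) (by simp)
        (((measurable_deriv _).pow_const 2).mul measurable_id).aestronglyMeasurable ?_
      refine (ae_restrict_iff' measurableSet_Ioo).2 (Filter.Eventually.of_forall fun s hs => ?_)
      have h4 := pow_le_pow_left₀ (abs_nonneg _) (hb s hs) 2
      have : 0 < s := by linarith [hs.1]
      rw [Real.norm_eq_abs, abs_mul, abs_pow, abs_of_pos this]
      nlinarith [hs.2, sq_nonneg |deriv (fun s => v s θ) s|]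
    apply setIntegral_mono_on (i1.const_mul _) i2 measurableSet_Ioo
    intro s hs
    nlinarith [hs.1, sq_nonneg (deriv (fun s => v s θ) s)]
  have hDint : ∫ θ in t..t + L, (D θ) ^ 2 ≤ DirW t L v r := by
    refine le_trans ?_ hle
    rw [hfub, ← Ioo_int_eq _ (by linarith)]
    apply setIntegral_mono_on _ _ measurableSet_Ioo (fun θ _ => hpt θ)
    · exact ((hDc.pow 2).integrableOn_Icc (a := t) (b := t + L)).mono_set Ioo_subset_Icc_self
    · exact hi1.integral_prod_right
  set m := (∫ θ in t..t + L, D θ) / L with hm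
  have e : angM t L v r - angM t L v (r / 2) = m := by
    rw [hm, hD, intervalIntegral.integral_sub ((h.slice_cont hr).intervalIntegrable _ _)
      ((h.slice_cont hr2).intervalIntegrable _ _)]
    unfold angM; ring
  rw [e]
  have h0 : 0 ≤ ∫ θ in t..t + L, ((D θ) ^ 2 - 2 * m * D θ + m ^ 2) := by
    apply intervalIntegral.integral_nonneg (by linarith)
    intro x _
    nlinarith [sq_nonneg (D x - m)]
  rw [intervalIntegral.integral_add ((by fun_prop : Continuous fun θ => (D θ) ^ 2 - 2 * m * D θ).intervalIntegrable _ _) (by simp),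
    intervalIntegral.integral_sub ((by fun_prop : Continuous fun θ => (D θ) ^ 2).intervalIntegrable _ _)
      ((by fun_prop : Continuous fun θ => 2 * m * D θ).intervalIntegrable _ _),
    intervalIntegral.integral_const_mul, intervalIntegral.integral_const] at h0
  have hmm : ∫ θ in t..t + L, D θ = m * L := by rw [hm]; field_simp
  rw [hmm] at h0
  simp only [add_sub_cancel_left, smul_eq_mul] at h0
  rw [le_div_iff₀ hL]
  nlinarith

/-- truncated power profile -/
def psi (β ε x : ℝ) : ℝ := ((max x (ε ^ (1 / β))) ^ β - ε) / (1 - ε)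

section psi
variable {β ε : ℝ}

lemma x0_pow (hβ : 0 < β) (hε : ε ∈ Ioo (0:ℝ) 1) : (ε ^ (1 / β)) ^ β = ε := by
  rw [← Real.rpow_mul hε.1.le]; field_simp; simp

lemma x0_pos (hε : ε ∈ Ioo (0:ℝ) 1) : 0 < ε ^ (1 / β) := Real.rpow_pos_of_pos hε.1 _

lemma x0_lt (hβ : 0 < β) (hε : ε ∈ Ioo (0:ℝ) 1) : ε ^ (1 / β) < 1 :=
  Real.rpow_lt_one hε.1.le hε.2 (by positivity)

lemma psi_nonneg (hβ : 0 < β) (hε : ε ∈ Ioo (0:ℝ) 1) (x : ℝ) : 0 ≤ psi β ε x := by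
  unfold psi
  apply div_nonneg _ (by linarith [hε.2])
  have := Real.rpow_le_rpow (x0_pos (β := β) hε).le (le_max_right x (ε ^ (1 / β))) hβ.le
  rw [x0_pow hβ hε] at this
  linarith

lemma psi_zero (hβ : 0 < β) (hε : ε ∈ Ioo (0:ℝ) 1) {x : ℝ} (hx : x ≤ ε ^ (1 / β)) :
    psi β ε x = 0 := by
  unfold psi; rw [max_eq_right hx, x0_pow hβ hε]; simp

lemma psi_one (hβ : 0 < β) (hε : ε ∈ Ioo (0:ℝ) 1) : psi β ε 1 = 1 := by
  unfold psi; rw [max_eq_left (x0_lt hβ hε).le, Real.one_rpow]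
  exact div_self (by linarith [hε.2])

lemma psi_le (hβ : 0 < β) (hε : ε ∈ Ioo (0:ℝ) 1) {x : ℝ} (hx0 : 0 ≤ x) (hx1 : x ≤ 1) :
    psi β ε x ≤ x ^ β := by
  have h1ε : 0 < 1 - ε := by linarith [hε.2]
  rcases le_total x (ε ^ (1 / β)) with h | h
  · rw [psi_zero hβ hε h]; exact Real.rpow_nonneg hx0 _
  · unfold psi
    rw [max_eq_left h, div_le_iff₀ h1ε]
    have := Real.rpow_le_one hx0 hx1 hβ.le
    nlinarith [hε.1]

lemma psi_lip (hβ : 0 < β) (hε : ε ∈ Ioo (0:ℝ) 1) :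
    ∃ A, 0 ≤ A ∧ ∀ x ∈ Icc (0:ℝ) 1, ∀ y ∈ Icc (0:ℝ) 1, |psi β ε x - psi β ε y| ≤ A * |x - y| := by
  set x0 := ε ^ (1 / β) with hx0
  have hp : 0 < x0 := x0_pos hε
  have h1ε : 0 < 1 - ε := by linarith [hε.2]
  obtain ⟨C, hC⟩ : ∃ C, ∀ x ∈ Icc x0 1, ‖β * x ^ (β - 1)‖ ≤ C := by
    apply isCompact_Icc.exists_bound_of_continuousOn
    intro x hx
    apply ContinuousAt.continuousWithinAt
    have : x ≠ 0 := (hp.trans_le hx.1).ne'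
    exact continuousAt_const.mul (Real.continuousAt_rpow_const _ _ (Or.inl this))
  have hC0 : 0 ≤ C := (norm_nonneg _).trans (hC 1 ⟨(x0_lt hβ hε).le, le_rfl⟩)
  have hlip : ∀ x ∈ Icc x0 1, ∀ y ∈ Icc x0 1, ‖x ^ β - y ^ β‖ ≤ C * ‖x - y‖ := by
    intro x hx y hy
    exact (convex_Icc x0 1).norm_image_sub_le_of_norm_hasDerivWithin_le
      (fun z hz => (Real.hasDerivAt_rpow_const (Or.inl (hp.trans_le hz.1).ne')).hasDerivWithinAt)
      hC hy hx
  refine ⟨C / (1 - ε), by positivity, fun x hx y hy => ?_⟩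
  have e : psi β ε x - psi β ε y = ((max x x0) ^ β - (max y x0) ^ β) / (1 - ε) := by
    unfold psi; ring
  rw [e, abs_div, abs_of_pos h1ε, div_mul_eq_mul_div]
  apply div_le_div_of_nonneg_right _ h1ε.le
  have h1 := hlip (max x x0) ⟨le_max_right _ _, max_le hx.2 (x0_lt hβ hε).le⟩
    (max y x0) ⟨le_max_right _ _, max_le hy.2 (x0_lt hβ hε).le⟩
  have h2 : |max x x0 - max y x0| ≤ |x - y| := by
    have := abs_max_sub_max_le_max x x0 y x0
    simpa using this
  simp only [Real.norm_eq_abs] at h1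
  exact h1.trans (mul_le_mul_of_nonneg_left h2 hC0)

lemma psi_deriv (hβ : 0 < β) (hε : ε ∈ Ioo (0:ℝ) 1) {s r : ℝ} (hs : 0 < s) (hr : 0 < r) :
    |deriv (fun r => psi β ε (r / s)) r| ≤ β * (r / s) ^ β / r / (1 - ε) := by
  have h1ε : 0 < 1 - ε := by linarith [hε.2]
  have hrs : 0 < r / s := by positivity
  have hnn : 0 ≤ β * (r / s) ^ β / r / (1 - ε) := by
    have := Real.rpow_nonneg hrs.le β
    positivity
  rcases le_or_gt (r / s) (ε ^ (1 / β)) with h | h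
  · have : IsLocalMin (fun r => psi β ε (r / s)) r := by
      apply Filter.Eventually.of_forall
      intro y
      simp only [psi_zero hβ hε h]
      exact psi_nonneg hβ hε _
    rw [this.deriv_eq_zero]; simpa using hnn
  · have h2 : (fun r => psi β ε (r / s)) =ᶠ[nhds r] fun r => ((r / s) ^ β - ε) / (1 - ε) := by
      have : ∀ᶠ y in nhds r, ε ^ (1 / β) < y / s :=
        (continuous_id.div_const s).continuousAt.eventually (lt_mem_nhds h)
      filter_upwards [this] with y hy
      unfold psi; rw [max_eq_left hy.le]
    rw [h2.deriv_eq]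
    have h3 : HasDerivAt (fun r => ((r / s) ^ β - ε) / (1 - ε))
        (((1 / s) * β * (r / s) ^ (β - 1)) / (1 - ε)) r := by
      apply HasDerivAt.div_const
      apply HasDerivAt.sub_const
      exact ((hasDerivAt_id r).div_const s).rpow_const (Or.inl hrs.ne')
    rw [h3.deriv]
    have h4 : (r / s) ^ (β - 1) = (r / s) ^ β / (r / s) := by
      rw [Real.rpow_sub hrs, Real.rpow_one]
    rw [h4]
    have : (1 / s * β * ((r / s) ^ β / (r / s))) / (1 - ε) = β * (r / s) ^ β / r / (1 - ε) := by
      field_simp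
    rw [this, abs_of_nonneg hnn]

lemma psi_integral (hβ : 0 < β) {s : ℝ} (hs : 0 < s) :
    IntegrableOn (fun r => ((r / s) ^ β) ^ 2 / r) (Ioo 0 s) ∧
    ∫ r in Ioo 0 s, ((r / s) ^ β) ^ 2 / r = 1 / (2 * β) := by
  have e : ∀ r ∈ Ioo 0 s, r ^ (2 * β - 1) / s ^ (2 * β) = ((r / s) ^ β) ^ 2 / r := by
    intro r hr
    rw [Real.rpow_sub hr.1, Real.rpow_one, Real.div_rpow hr.1.le hs.le, div_pow,
      ← Real.rpow_mul_natCast hr.1.le, ← Real.rpow_mul_natCast hs.le]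
    have : β * ((2:ℕ) : ℝ) = 2 * β := by push_cast; ring
    rw [this]; field_simp
  have hi : IntervalIntegrable (fun r : ℝ => r ^ (2 * β - 1) / s ^ (2 * β)) volume 0 s :=
    (intervalIntegral.intervalIntegrable_rpow' (by linarith)).div_const _
  constructor
  · have h1 := (intervalIntegrable_iff_integrableOn_Ioo_of_le hs.le).1 hi
    exact h1.congr_fun e measurableSet_Ioo
  · rw [← setIntegral_congr_fun measurableSet_Ioo e, Ioo_int_eq _ hs.le,
      intervalIntegral.integral_div, integral_rpow (Or.inl (by linarith))]
    have : 2 * β - 1 + 1 = 2 * β := by ring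
    rw [this, Real.zero_rpow (by positivity)]
    have := Real.rpow_pos_of_pos hs (2 * β)
    field_simp; ring
end psi

/-- the competitor -/
def comp (β ε c s : ℝ) (v : ℝ → ℝ → ℝ) : ℝ → ℝ → ℝ := fun r θ =>
  if r ≤ s then c + psi β ε (r / s) * (v s θ - c) else v r θ

lemma comp_polLip {β ε L K : ℝ} (hβ : 0 < β) (hε : ε ∈ Ioo (0:ℝ) 1) {v : ℝ → ℝ → ℝ}
    (h : PolLip L K v) (c : ℝ) {s : ℝ} (hs : s ∈ Ioo (0:ℝ) 1) :
    ∃ K', PolLip L K' (comp β ε c s v) := by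
  obtain ⟨A, hA, hlip⟩ := psi_lip hβ hε
  have hK := h.nonneg
  have hs0 := hs.1
  have hsI : s ∈ Icc (0:ℝ) 1 := Ioo_subset_Icc_self hs
  set B := K + |v 0 0 - c| with hB
  have hB0 : 0 ≤ B := by positivity
  have hg : ∀ θ, |v s θ - c| ≤ B := by
    intro θ
    have h1 := h.rad s hsI 0 (by simp) θ
    rw [h.zero θ 0, sub_zero, abs_of_pos hs0] at h1
    have h2 := abs_sub_le (v s θ) (v 0 0) c
    nlinarith [hs.2]
  have hdiv : ∀ r, 0 ≤ r → r ≤ s → r / s ∈ Icc (0:ℝ) 1 := fun r h0 h1 =>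
    ⟨by positivity, (div_le_one hs0).2 h1⟩
  have hABs : 0 ≤ A * B / s := by positivity
  have hAK : 0 ≤ A * K := by positivity
  have heqs : ∀ θ, comp β ε c s v s θ = v s θ := by
    intro θ; unfold comp; rw [if_pos le_rfl, div_self hs0.ne', psi_one hβ hε]; ring
  have hlow : ∀ r ∈ Icc 0 s, ∀ r' ∈ Icc 0 s, ∀ θ,
      |comp β ε c s v r θ - comp β ε c s v r' θ| ≤ A * B / s * |r - r'| := by
    intro r hr r' hr' θ
    unfold comp
    rw [if_pos hr.2, if_pos hr'.2]
    have e : c + psi β ε (r / s) * (v s θ - c) - (c + psi β ε (r' / s) * (v s θ - c)) =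
      (psi β ε (r / s) - psi β ε (r' / s)) * (v s θ - c) := by ring
    rw [e, abs_mul]
    have h1 := hlip (r / s) (hdiv r hr.1 hr.2) (r' / s) (hdiv r' hr'.1 hr'.2)
    have h2 : |r / s - r' / s| = |r - r'| / s := by rw [← sub_div, abs_div, abs_of_pos hs0]
    rw [h2] at h1
    calc _ ≤ (A * (|r - r'| / s)) * B :=
          mul_le_mul h1 (hg θ) (abs_nonneg _) (by positivity)
      _ = _ := by ring
  have hhigh : ∀ r ∈ Icc s 1, ∀ r' ∈ Icc s 1, ∀ θ,
      |comp β ε c s v r θ - comp β ε c s v r' θ| ≤ K * |r - r'| := by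
    have e : ∀ r ∈ Icc s 1, ∀ θ, comp β ε c s v r θ = v r θ := by
      intro r hr θ
      rcases hr.1.eq_or_lt with rfl | hlt
      · exact heqs θ
      · unfold comp; rw [if_neg (not_le.2 hlt)]
    intro r hr r' hr' θ
    rw [e r hr, e r' hr']
    exact h.rad r ⟨hs0.le.trans hr.1, hr.2⟩ r' ⟨hs0.le.trans hr'.1, hr'.2⟩ θ
  have hmix : ∀ r ∈ Icc 0 s, ∀ r' ∈ Icc s 1, ∀ θ,
      |comp β ε c s v r θ - comp β ε c s v r' θ| ≤ (K + A * B / s) * |r - r'| := by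
    intro r hr r' hr' θ
    have h1 := hlow r hr s ⟨hs0.le, le_rfl⟩ θ
    have h2 := hhigh s ⟨le_rfl, hs.2.le⟩ r' hr' θ
    have h3 := abs_sub_le (comp β ε c s v r θ) (comp β ε c s v s θ) (comp β ε c s v r' θ)
    have a1 : |r - s| ≤ |r - r'| := by
      rw [abs_of_nonpos (by linarith [hr.2]), abs_of_nonpos (by linarith [hr.2, hr'.1])]
      linarith [hr'.1]
    have a2 : |s - r'| ≤ |r - r'| := by
      rw [abs_of_nonpos (by linarith [hr'.1]), abs_of_nonpos (by linarith [hr.2, hr'.1])]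
      linarith [hr.2]
    have b1 := mul_le_mul_of_nonneg_left a1 hABs
    have b2 := mul_le_mul_of_nonneg_left a2 hK
    linarith
  refine ⟨K + A * B / s + A * K, by positivity, ?_, ?_, ?_⟩
  · intro r θ
    unfold comp; rw [h.per, h.per]
  · intro r hr r' hr' θ
    have h0 := abs_nonneg (r - r')
    have m1 := mul_nonneg hABs h0
    have m2 := mul_nonneg hK h0
    have m3 := mul_nonneg hAK h0
    rcases le_total r s with h1 | h1 <;> rcases le_total r' s with h2 | h2
    · have := hlow r ⟨hr.1, h1⟩ r' ⟨hr'.1, h2⟩ θ; nlinarith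
    · have := hmix r ⟨hr.1, h1⟩ r' ⟨h2, hr'.2⟩ θ; nlinarith
    · have := hmix r' ⟨hr'.1, h2⟩ r ⟨h1, hr.2⟩ θ
      rw [abs_sub_comm, abs_sub_comm r' r] at this; nlinarith
    · have := hhigh r ⟨h1, hr.2⟩ r' ⟨h2, hr'.2⟩ θ; nlinarith
  · intro r hr θ φ
    have h0 := abs_nonneg (θ - φ)
    have m1 : 0 ≤ A * B / s * r * |θ - φ| := mul_nonneg (mul_nonneg hABs hr.1) h0
    have m2 : 0 ≤ K * r * |θ - φ| := mul_nonneg (mul_nonneg hK hr.1) h0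
    have m3 : 0 ≤ A * K * r * |θ - φ| := mul_nonneg (mul_nonneg hAK hr.1) h0
    have goal' : |comp β ε c s v r θ - comp β ε c s v r φ| ≤
        K * r * |θ - φ| + A * K * r * |θ - φ| := by
      unfold comp
      rcases le_or_gt r s with h1 | h1
      · rw [if_pos h1, if_pos h1]
        have e : c + psi β ε (r / s) * (v s θ - c) - (c + psi β ε (r / s) * (v s φ - c)) =
          psi β ε (r / s) * (v s θ - v s φ) := by ring
        rw [e, abs_mul, abs_of_nonneg (psi_nonneg hβ hε _)]
        have h2 := hlip (r / s) (hdiv r hr.1 h1) 0 (by simp)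
        rw [psi_zero hβ hε (x0_pos hε).le, sub_zero, sub_zero,
          abs_of_nonneg (psi_nonneg hβ hε _), abs_of_nonneg (hdiv r hr.1 h1).1] at h2
        have h3 := h.ang s hsI θ φ
        have : psi β ε (r / s) * |v s θ - v s φ| ≤ (A * (r / s)) * (K * s * |θ - φ|) :=
          mul_le_mul h2 h3 (abs_nonneg _) (mul_nonneg hA (hdiv r hr.1 h1).1)
        have e2 : (A * (r / s)) * (K * s * |θ - φ|) = A * K * r * |θ - φ| := by field_simp
        rw [e2] at this
        linarith
      · rw [if_neg (not_le.2 h1), if_neg (not_le.2 h1)]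
        have := h.ang r hr θ φ
        linarith
    nlinarith

lemma comp_energy {β ε L K t : ℝ} (hL : 0 < L) (hβ : β = Real.sqrt 12 / L) (hε : ε ∈ Ioo (0:ℝ) 1)
    {v : ℝ → ℝ → ℝ} (h : PolLip L K v) {s : ℝ} (hs : s ∈ Ioo (0:ℝ) 1) :
    DirW t L (comp β ε (angM t L v s) s v) s ≤ (1 / (1 - ε) ^ 2) * (angE t L v s / β) := by
  have hβ0 : 0 < β := by rw [hβ]; positivity
  have hs0 := hs.1
  have h1ε : 0 < 1 - ε := by linarith [hε.2]
  set c := angM t L v s with hc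
  have hsI : s ∈ Icc (0:ℝ) 1 := Ioo_subset_Icc_self hs
  set w := comp β ε c s v with hw
  set g := v s with hg
  set a : ℝ → ℝ := fun r => ((r / s) ^ β) ^ 2 / r with ha
  set b : ℝ → ℝ := fun θ => (1 / (1 - ε) ^ 2) * (β ^ 2 * (g θ - c) ^ 2 + (deriv g θ) ^ 2) with hb
  have hpt : ∀ p ∈ Ioo 0 s ×ˢ Ioo t (t + L), gradSq w p * p.1 ≤ a p.1 * b p.2 := by
    rintro ⟨r, θ⟩ ⟨hr, hθ⟩
    simp only at hr hθ
    have hr0 := hr.1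
    have d1 : deriv (fun r => w r θ) r = deriv (fun r => psi β ε (r / s)) r * (g θ - c) := by
      have : (fun r => w r θ) =ᶠ[nhds r] fun r => c + psi β ε (r / s) * (g θ - c) := by
        filter_upwards [Iio_mem_nhds hr.2] with y hy
        simp only [hw, comp]; rw [if_pos (le_of_lt hy)]
      rw [this.deriv_eq, deriv_const_add, deriv_mul_const_field]
    have d2 : deriv (fun φ => w r φ) θ = psi β ε (r / s) * deriv g θ := by
      have : (fun φ => w r φ) = fun φ => c + psi β ε (r / s) * (g φ - c) := by
        funext φ; simp only [hw, comp]; rw [if_pos hr.2.le]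
      rw [this, deriv_const_add, deriv_const_mul_field, deriv_sub_const]
    have p1 := psi_deriv hβ0 hε hs0 hr0
    have p2 := psi_le hβ0 hε (x := r / s) (by positivity) ((div_le_one hs0).2 hr.2.le)
    have p3 := psi_nonneg hβ0 hε (r / s)
    have hX : 0 ≤ (r / s) ^ β := Real.rpow_nonneg (by positivity) _
    set X := (r / s) ^ β
    have q1 : (deriv (fun r => psi β ε (r / s)) r) ^ 2 ≤ (β * X / r / (1 - ε)) ^ 2 := by
      rw [← sq_abs]; exact pow_le_pow_left₀ (abs_nonneg _) p1 2
    have q2 : (psi β ε (r / s)) ^ 2 ≤ (1 / (1 - ε) ^ 2) * X ^ 2 := by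
      have : (psi β ε (r / s)) ^ 2 ≤ X ^ 2 := pow_le_pow_left₀ p3 p2 2
      have h3 : 1 ≤ 1 / (1 - ε) ^ 2 := by
        rw [le_div_iff₀ (by positivity)]
        nlinarith [hε.1]
      nlinarith [sq_nonneg X]
    unfold gradSq
    simp only [ha, hb]
    rw [d1, d2]
    calc ((deriv (fun r => psi β ε (r / s)) r * (g θ - c)) ^ 2 +
          (psi β ε (r / s) * deriv g θ) ^ 2 / r ^ 2) * r
        = (deriv (fun r => psi β ε (r / s)) r) ^ 2 * ((g θ - c) ^ 2 * r) +
          (psi β ε (r / s)) ^ 2 * ((deriv g θ) ^ 2 / r) := by field_simp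
      _ ≤ (β * X / r / (1 - ε)) ^ 2 * ((g θ - c) ^ 2 * r) +
          ((1 / (1 - ε) ^ 2) * X ^ 2) * ((deriv g θ) ^ 2 / r) := by
          gcongr
      _ = X ^ 2 / r * (1 / (1 - ε) ^ 2 * (β ^ 2 * (g θ - c) ^ 2 + (deriv g θ) ^ 2)) := by
          field_simp
  have hlip := h.slice_lip hsI
  have hgc : Continuous g := h.slice_cont hsI
  have i1 : IntervalIntegrable (fun θ => β ^ 2 * (g θ - c) ^ 2) volume t (t + L) :=
    (by fun_prop : Continuous fun θ => β ^ 2 * (g θ - c) ^ 2).intervalIntegrable _ _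
  have i2 := int_deriv_sq_aux h.nonneg hlip t (t + L)
  have ib : IntegrableOn b (Ioo t (t + L)) := by
    rw [← intervalIntegrable_iff_integrableOn_Ioo_of_le (by linarith)]
    exact (i1.add i2).const_mul _
  obtain ⟨ia, ea⟩ := psi_integral hβ0 hs0
  obtain ⟨K', hwl⟩ := comp_polLip hβ0 hε h c hs
  have hmain : DirW t L w s ≤ (∫ r in Ioo 0 s, a r) * ∫ θ in Ioo t (t + L), b θ := by
    rw [← setIntegral_prod_mul, ← Measure.volume_eq_prod]
    unfold DirW
    apply setIntegral_mono_on _ _ (measurableSet_Ioo.prod measurableSet_Ioo) hpt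
    · exact hwl.integrableOn (measurableSet_Ioo.prod measurableSet_Ioo) (vol_window _ _ _ _)
        (fun p hp => ⟨hp.1.1, hp.1.2.trans hs.2⟩)
    · have := Integrable.mul_prod ia ib
      rw [Measure.prod_restrict, ← Measure.volume_eq_prod] at this
      exact this
  have hbint : ∫ θ in Ioo t (t + L), b θ ≤ (1 / (1 - ε) ^ 2) * (2 * angE t L v s) := by
    rw [Ioo_int_eq _ (by linarith)]
    simp only [hb]
    rw [intervalIntegral.integral_const_mul]
    apply mul_le_mul_of_nonneg_left _ (by positivity)
    rw [intervalIntegral.integral_add i1 i2, intervalIntegral.integral_const_mul]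
    have hW := wirtinger hL h.nonneg (h.per s) hlip t
    have e1 : ∫ θ in t..t + L, (deriv g θ) ^ 2 = angE t L v s := rfl
    have e2 : β ^ 2 * (L ^ 2 / 12) = 1 := by
      rw [hβ, div_pow, Real.sq_sqrt (by norm_num)]; field_simp
    rw [e1]
    have hW' : ∫ θ in t..t + L, (g θ - c) ^ 2 ≤ L ^ 2 / 12 * angE t L v s := hW
    have := mul_le_mul_of_nonneg_left hW' (sq_nonneg β)
    rw [← mul_assoc, e2, one_mul] at this
    linarith
  rw [ea] at hmain
  calc DirW t L w s ≤ _ := hmain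
    _ ≤ 1 / (2 * β) * ((1 / (1 - ε) ^ 2) * (2 * angE t L v s)) :=
        mul_le_mul_of_nonneg_left hbint (by positivity)
    _ = _ := by field_simp

/-- almost minimality of the Dirichlet energy on balls around the vertex -/
def AlmostMin (t L M Λ : ℝ) (v : ℝ → ℝ → ℝ) : Prop :=
  ∀ ρ ∈ Ioo (0:ℝ) 1, ∀ (w : ℝ → ℝ → ℝ) (K : ℝ), PolLip L K w →
    (∀ r, ρ ≤ r → ∀ θ, w r θ = v r θ) → DirW t L v ρ ≤ M * DirW t L w ρ + Λ * ρ ^ 2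

lemma key_ineq {t L M Λ γ K : ℝ} (hL : 0 < L) (hM : 0 < M) (hγ : 0 < γ)
    (hlt : M * γ < Real.sqrt 12 / L) {v : ℝ → ℝ → ℝ} (h : PolLip L K v)
    (hA : AlmostMin t L M Λ v) {s : ℝ} (hs : s ∈ Ioo (0:ℝ) 1) :
    γ * DirW t L v s ≤ angE t L v s + γ * (Λ * s ^ 2) := by
  set β := Real.sqrt 12 / L with hβ
  have hβ0 : 0 < β := by positivity
  set q := M * γ / β with hq
  have hq1 : q < 1 := by rw [hq, div_lt_one hβ0]; exact hlt
  have hq0 : 0 < q := by positivity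
  set ε := (1 - q) / 2 with hε'
  have hε : ε ∈ Ioo (0:ℝ) 1 := ⟨by linarith, by linarith⟩
  have h1ε : 0 < 1 - ε := by linarith [hε.2]
  obtain ⟨K', hw⟩ := comp_polLip hβ0 hε h (angM t L v s) hs
  have h1 := hA s hs _ K' hw (by
    intro r hr θ
    unfold comp
    split_ifs with hrs
    · have : r = s := le_antisymm hrs hr
      subst this
      rw [div_self hs.1.ne', psi_one hβ0 hε]; ring
    · rfl)
  have h2 := comp_energy (t := t) hL hβ hε h hs
  have h3 : M * ((1 / (1 - ε) ^ 2) * (angE t L v s / β)) ≤ angE t L v s / γ := by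
    have hE := angE_nonneg (t := t) hL v s
    have e : M * ((1 / (1 - ε) ^ 2) * (angE t L v s / β))
      = (angE t L v s / γ) * (q / (1 - ε) ^ 2) := by rw [hq]; field_simp
    rw [e]
    have : q / (1 - ε) ^ 2 ≤ 1 := by
      rw [div_le_one (by positivity)]; nlinarith
    calc _ ≤ (angE t L v s / γ) * 1 := mul_le_mul_of_nonneg_left this (by positivity)
      _ = _ := mul_one _
  have h4 : DirW t L v s ≤ angE t L v s / γ + Λ * s ^ 2 := by
    have := mul_le_mul_of_nonneg_left h2 hM.le
    linarith
  have h5 := mul_le_mul_of_nonneg_left h4 hγ.le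
  have e : γ * (angE t L v s / γ + Λ * s ^ 2) = angE t L v s + γ * (Λ * s ^ 2) := by
    field_simp
  linarith

lemma decay {L M γ' : ℝ} (hL : 0 < L) (hM : 0 < M) (hγ0 : 0 < γ') (hγ1 : γ' ≤ 1)
    (hlt : M * γ' < Real.sqrt 12 / L) : ∃ C > 0, ∀ (t : ℝ) (v : ℝ → ℝ → ℝ) (K Λ : ℝ), 0 ≤ Λ →
      PolLip L K v → AlmostMin t L M Λ v → ∀ ρ ∈ Ioc (0:ℝ) 1,
      DirW t L v ρ ≤ C * ρ ^ γ' * (DirW t L v 1 + Λ) := by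
  set β := Real.sqrt 12 / L with hβ
  set γ := (γ' + β / M) / 2 with hγd
  have hb : γ' < β / M := by rw [lt_div_iff₀ hM]; linarith
  have hγγ : γ' < γ := by linarith
  have hγ : 0 < γ := by linarith
  have hlt2 : M * γ < β := by
    have : γ < β / M := by linarith
    rw [lt_div_iff₀ hM] at this; linarith
  set μ := γ' / γ with hμ
  have hμ0 : 0 < μ := by positivity
  have hμ1 : μ < 1 := by rw [hμ, div_lt_one hγ]; exact hγγ
  set q := μ ^ γ' with hqd
  have hq0 : 0 < q := Real.rpow_pos_of_pos hμ0 _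
  have hμq : μ ≤ q := by
    have := Real.rpow_le_rpow_of_exponent_ge hμ0 hμ1.le hγ1
    rwa [Real.rpow_one] at this
  have hq1 : 1 ≤ q * (1 + γ * (1 - μ)) := by
    have hB := rpow_one_add_le_one_add_mul_self (s := 1 / μ - 1) (p := γ') (by
      have : 0 < 1 / μ := by positivity
      linarith) hγ0.le hγ1
    have e1 : 1 + γ' * (1 / μ - 1) = 1 + γ * (1 - μ) := by rw [hμ]; field_simp
    have e2 : (1 + (1 / μ - 1)) ^ γ' = q⁻¹ := by
      rw [hqd, ← Real.inv_rpow hμ0.le]; congr 1; field_simp; ring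
    rw [e1, e2] at hB
    have := mul_le_mul_of_nonneg_left hB hq0.le
    rwa [mul_inv_cancel₀ hq0.ne'] at this
  refine ⟨(1 / μ) ^ γ' * (1 + γ), by positivity, ?_⟩
  intro t v K Λ hΛ h hA ρ hρ
  set E := DirW t L v with hE
  have hE0 : ∀ r, 0 ≤ E r := DirW_nonneg t L v
  have hstep : ∀ r ∈ Ioc (0:ℝ) 1, E (μ * r) + γ * Λ * (μ * r) ^ 2 ≤ q * (E r + γ * Λ * r ^ 2) := by
    intro r hr
    have hr0 := hr.1
    have hlt' : μ * r < r := by nlinarith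
    obtain ⟨s, hs, hsE⟩ := slice_exists (t := t) hL h (mul_pos hμ0 hr0) hlt' hr.2
    have e : μ * r / r = μ := by field_simp
    rw [e] at hsE
    have hs1 : s < 1 := hs.2.trans_le hr.2
    have hs0 : 0 < s := (mul_pos hμ0 hr0).trans hs.1
    have hk := key_ineq (t := t) hL hM hγ hlt2 h hA (s := s) ⟨hs0, hs1⟩
    have hm : E (μ * r) ≤ E s := DirW_mono h hs.1.le hs1.le
    have hs2 : s ^ 2 ≤ r ^ 2 := pow_le_pow_left₀ hs0.le hs.2.le 2
    have h1 : γ * E (μ * r) ≤ angE t L v s + γ * (Λ * r ^ 2) := by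
      have a1 := mul_le_mul_of_nonneg_left hm hγ.le
      have a2 := mul_le_mul_of_nonneg_left (mul_le_mul_of_nonneg_left hs2 hΛ) hγ.le
      linarith
    have h2 : E (μ * r) * (1 + γ * (1 - μ)) ≤ E r + γ * (1 - μ) * (Λ * r ^ 2) := by
      have := mul_le_mul_of_nonneg_right h1 (by linarith : 0 ≤ 1 - μ)
      simp only [← hE] at hsE
      linarith
    have h3 : E (μ * r) ≤ q * (E r + γ * (1 - μ) * (Λ * r ^ 2)) := by
      have a1 := mul_le_mul_of_nonneg_left h2 hq0.le
      have a2 := mul_le_mul_of_nonneg_left hq1 (hE0 (μ * r))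
      linarith
    have h4 : μ * (γ * (Λ * r ^ 2) * μ) ≤ q * (γ * (Λ * r ^ 2) * μ) :=
      mul_le_mul_of_nonneg_right hμq (by positivity)
    linarith
  have hiter : ∀ n : ℕ, E (μ ^ n) + γ * Λ * (μ ^ n) ^ 2 ≤ q ^ n * (E 1 + γ * Λ) := by
    intro n
    induction n with
    | zero => simp
    | succ n ih =>
      have := hstep (μ ^ n) ⟨by positivity, pow_le_one₀ hμ0.le hμ1.le⟩
      rw [pow_succ', pow_succ' q]
      have a := mul_le_mul_of_nonneg_left ih hq0.le
      linarith
  obtain ⟨n, hn1, hn2⟩ := exists_nat_pow_near_of_lt_one hρ.1 hρ.2 hμ0 hμ1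
  have h1 : E ρ ≤ E (μ ^ n) := DirW_mono h hn2 (pow_le_one₀ hμ0.le hμ1.le)
  have h2 := hiter n
  have h3 : q ^ n ≤ (1 / μ) ^ γ' * ρ ^ γ' := by
    rw [hqd, ← Real.rpow_natCast, ← Real.rpow_mul hμ0.le, mul_comm γ', Real.rpow_mul hμ0.le,
      Real.rpow_natCast, ← Real.mul_rpow (by positivity) hρ.1.le]
    apply Real.rpow_le_rpow (by positivity) _ hγ0.le
    rw [pow_succ] at hn1
    rw [one_div, inv_mul_eq_div, le_div_iff₀ hμ0]
    exact hn1.le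
  have h4 : 0 ≤ γ * Λ * (μ ^ n) ^ 2 := by positivity
  have h5 : E 1 + γ * Λ ≤ (1 + γ) * (E 1 + Λ) := by nlinarith [hE0 1]
  have hp : 0 ≤ (1 / μ) ^ γ' * ρ ^ γ' := by have := hρ.1; positivity
  calc E ρ ≤ q ^ n * (E 1 + γ * Λ) := by linarith
    _ ≤ ((1 / μ) ^ γ' * ρ ^ γ') * ((1 + γ) * (E 1 + Λ)) :=
        mul_le_mul h3 h5 (by nlinarith [hE0 1, mul_nonneg hγ.le hΛ]) hp
    _ = _ := by ring

lemma avg_bound {t L K B σ : ℝ} (hL : 0 < L) (hσ : 0 < σ) (hB : 0 ≤ B) {v : ℝ → ℝ → ℝ}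
    (h : PolLip L K v) (hE : ∀ ρ ∈ Ioc (0:ℝ) 1, DirW t L v ρ ≤ B * (ρ ^ σ) ^ 2)
    {r : ℝ} (hr : r ∈ Ioc (0:ℝ) 1) :
    |angM t L v r - v 0 0| ≤ Real.sqrt (B / L) / (1 - (1 / 2) ^ σ) * r ^ σ := by
  set x : ℝ := (1 / 2) ^ σ with hx
  have hx1 : x < 1 := Real.rpow_lt_one (by norm_num) (by norm_num) hσ
  set D := Real.sqrt (B / L) / (1 - x) with hD
  have hD0 : 0 ≤ D := div_nonneg (Real.sqrt_nonneg _) (by linarith)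
  have hDe : Real.sqrt (B / L) = D * (1 - x) := by
    rw [hD, div_mul_cancel₀]; linarith
  have hstep : ∀ r ∈ Ioc (0:ℝ) 1, |angM t L v r - angM t L v (r / 2)| ≤ D * (1 - x) * r ^ σ := by
    intro r hr
    have h1 := angM_step (t := t) hL h hr.1 hr.2
    have h2 := hE r hr
    have hp : 0 ≤ r ^ σ := Real.rpow_nonneg hr.1.le _
    rw [← hDe]
    apply abs_le_of_sq_le_sq _ (by positivity)
    rw [mul_pow, Real.sq_sqrt (by positivity)]
    calc _ ≤ _ := h1
      _ ≤ B * (r ^ σ) ^ 2 / L := by gcongr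
      _ = _ := by ring
  have hn : ∀ n : ℕ, ∀ r ∈ Ioc (0:ℝ) 1, |angM t L v r - angM t L v (r / 2 ^ n)| ≤ D * r ^ σ := by
    intro n
    induction n with
    | zero =>
      intro r hr
      have hp : 0 ≤ r ^ σ := Real.rpow_nonneg hr.1.le _
      simp only [pow_zero, div_one, sub_self, abs_zero]; positivity
    | succ n ih =>
      intro r hr
      have h1 := hstep r hr
      have h2 := ih (r / 2) ⟨by linarith [hr.1], by linarith [hr.1, hr.2]⟩
      have e : r / 2 / 2 ^ n = r / 2 ^ (n + 1) := by rw [pow_succ']; field_simp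
      rw [e] at h2
      have e2 : (r / 2) ^ σ = r ^ σ * x := by
        rw [hx, ← Real.mul_rpow hr.1.le (by norm_num)]; congr 1; ring
      rw [e2] at h2
      have h3 := abs_sub_le (angM t L v r) (angM t L v (r / 2)) (angM t L v (r / 2 ^ (n + 1)))
      linarith
  have hlim : Filter.Tendsto (fun n : ℕ => D * r ^ σ + K * (r * (1 / 2) ^ n)) Filter.atTop
      (nhds (D * r ^ σ + K * (r * 0))) := by
    have := tendsto_pow_atTop_nhds_zero_of_lt_one (r := (1 / 2 : ℝ)) (by norm_num) (by norm_num)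
    exact ((this.const_mul r).const_mul K).const_add _
  simp only [mul_zero, add_zero] at hlim
  refine ge_of_tendsto' hlim fun n => ?_
  have h1 := hn n r hr
  have hle : r / 2 ^ n ≤ 1 := by
    rw [div_le_one (by positivity)]
    exact hr.2.trans (one_le_pow₀ (by norm_num))
  have h2 := angM_zero (t := t) hL h (r := r / 2 ^ n)
    ⟨div_nonneg hr.1.le (by positivity), hle⟩
  have h3 := abs_sub_le (angM t L v r) (angM t L v (r / 2 ^ n)) (v 0 0)
  have e : r / 2 ^ n = r * (1 / 2) ^ n := by rw [one_div, inv_pow]; rfl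
  rw [← e]
  linarith

lemma good_circle {L M γ' κ : ℝ} (hL : 0 < L) (hM : 0 < M) (hγ0 : 0 < γ') (hγ1 : γ' ≤ 1)
    (hlt : M * γ' < Real.sqrt 12 / L) (hκ : 1 < κ) :
    ∃ C > 0, ∀ (t : ℝ) (v : ℝ → ℝ → ℝ) (K Λ : ℝ), 0 ≤ Λ →
      PolLip L K v → AlmostMin t L M Λ v → ∀ ρ, 0 < ρ → κ * ρ ≤ 1 →
      ∃ s ∈ Ioo ρ (κ * ρ), ∀ φ,
        |v s φ - v 0 0| ≤ C * Real.sqrt (DirW t L v 1 + Λ) * ρ ^ (γ' / 2) := by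
  obtain ⟨C, hC, hdec⟩ := decay hL hM hγ0 hγ1 hlt
  set σ := γ' / 2 with hσd
  have hσ : 0 < σ := by positivity
  set x : ℝ := (1 / 2) ^ σ with hx
  have hx1 : x < 1 := Real.rpow_lt_one (by norm_num) (by norm_num) hσ
  have hk1 : 0 < 1 - 1 / κ := by
    have : 1 / κ < 1 := by rw [div_lt_one (by linarith)]; exact hκ
    linarith
  have hκ0 : 0 < κ := by linarith
  refine ⟨(Real.sqrt (L * C / (1 - 1 / κ)) + Real.sqrt (C / L) / (1 - x)) * κ ^ σ, ?_, ?_⟩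
  · have : 0 < 1 - x := by linarith
    positivity
  intro t v K Λ hΛ h hA ρ hρ hκρ
  set Q := DirW t L v 1 + Λ with hQ
  have hQ0 : 0 ≤ Q := add_nonneg (DirW_nonneg _ _ _ _) hΛ
  have hE : ∀ r ∈ Ioc (0:ℝ) 1, DirW t L v r ≤ (C * Q) * (r ^ σ) ^ 2 := by
    intro r hr
    have := hdec t v K Λ hΛ h hA r hr
    have e : (r ^ σ) ^ 2 = r ^ γ' := by
      rw [← Real.rpow_natCast, ← Real.rpow_mul hr.1.le, hσd]; congr 1; push_cast; ring
    rw [e]; linarith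
  have hlt' : ρ < κ * ρ := by nlinarith
  obtain ⟨s, hs, hsE⟩ := slice_exists (t := t) hL h hρ hlt' hκρ
  have e : ρ / (κ * ρ) = 1 / κ := by field_simp
  rw [e] at hsE
  have hs01 : s ∈ Ioc (0:ℝ) 1 := ⟨hρ.trans hs.1, hs.2.le.trans hκρ⟩
  refine ⟨s, hs, fun φ => ?_⟩
  have h1 := angM_osc (t := t) hL h (Ioc_subset_Icc_self hs01) φ
  have h2 := avg_bound (t := t) hL hσ (mul_nonneg hC.le hQ0) h hE hs01
  rw [← hx] at h2
  set y := (κ * ρ) ^ σ with hy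
  have hy0 : 0 ≤ y := Real.rpow_nonneg (by positivity) _
  have hsy : s ^ σ ≤ y := Real.rpow_le_rpow hs01.1.le hs.2.le hσ.le
  have hEs : angE t L v s ≤ C * Q * y ^ 2 / (1 - 1 / κ) := by
    rw [le_div_iff₀ hk1]
    have := hE (κ * ρ) ⟨by positivity, hκρ⟩
    have := DirW_nonneg t L v ρ
    linarith
  have h3 : |v s φ - angM t L v s| ≤ Real.sqrt (L * C / (1 - 1 / κ)) * Real.sqrt Q * y := by
    apply abs_le_of_sq_le_sq _ (by positivity)
    rw [mul_pow, mul_pow, Real.sq_sqrt (by positivity), Real.sq_sqrt hQ0]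
    calc _ ≤ _ := h1
      _ ≤ L * (C * Q * y ^ 2 / (1 - 1 / κ)) := by gcongr
      _ = _ := by ring
  have h4 : Real.sqrt (C * Q / L) = Real.sqrt (C / L) * Real.sqrt Q := by
    rw [← Real.sqrt_mul (by positivity)]; congr 1; ring
  rw [h4] at h2
  have h5 : Real.sqrt (C / L) * Real.sqrt Q / (1 - x) * s ^ σ ≤
      Real.sqrt (C / L) * Real.sqrt Q / (1 - x) * y :=
    mul_le_mul_of_nonneg_left hsy (div_nonneg (by positivity) (by linarith))
  have h6 := abs_sub_le (v s φ) (angM t L v s) (v 0 0)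
  have e3 : y = κ ^ σ * ρ ^ σ := Real.mul_rpow hκ0.le hρ.le
  calc |v s φ - v 0 0| ≤ Real.sqrt (L * C / (1 - 1 / κ)) * Real.sqrt Q * y +
        Real.sqrt (C / L) * Real.sqrt Q / (1 - x) * y := by linarith
    _ = _ := by rw [e3]; ring

/-- the density of the functional -/
def Jden (lp lm : ℝ) (u : ℝ → ℝ → ℝ) (p : ℝ × ℝ) : ℝ :=
  (gradSq u p + (if 0 < u p.1 p.2 then lp else 0) + (if u p.1 p.2 < 0 then lm else 0)) * p.1

lemma Jden_lower {lp lm : ℝ} (hlp : 0 ≤ lp) (hlm : 0 ≤ lm) (u : ℝ → ℝ → ℝ) {p : ℝ × ℝ}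
    (hp : 0 ≤ p.1) : gradSq u p * p.1 ≤ Jden lp lm u p := by
  unfold Jden
  apply mul_le_mul_of_nonneg_right _ hp
  split_ifs <;> linarith

lemma Jden_upper {lp lm : ℝ} (hlp : 0 ≤ lp) (hlm : 0 ≤ lm) (u : ℝ → ℝ → ℝ) {p : ℝ × ℝ}
    (hp : 0 ≤ p.1) : Jden lp lm u p ≤ gradSq u p * p.1 + (lp + lm) * p.1 := by
  unfold Jden
  rw [← add_mul]
  apply mul_le_mul_of_nonneg_right _ hp
  split_ifs <;> linarith

lemma Jden_integrable {lp lm l K : ℝ} (hlp : 0 ≤ lp) (hlm : 0 ≤ lm) {u : ℝ → ℝ → ℝ}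
    (h : PolLip l K u) {A : Set (ℝ × ℝ)} (hA : MeasurableSet A) (hfin : volume A ≠ ⊤)
    (hA1 : ∀ p ∈ A, p.1 ∈ Ioo (0:ℝ) 1) : IntegrableOn (Jden lp lm u) A := by
  have hc : Measurable fun p : ℝ × ℝ => clampR u p.1 p.2 := h.clamp_lipschitz.continuous.measurable
  refine integrableOn_of_eq_bdd (g := Jden lp lm (clampR u)) (M := 2 * K ^ 2 + (lp + lm)) hA hfin
    ?_ (fun p hp => ?_) fun p hp => ?_
  · unfold Jden
    refine Measurable.mul ?_ measurable_fst
    refine (h.meas_grad.add ?_).add ?_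
    · exact Measurable.ite (measurableSet_lt measurable_const hc) measurable_const measurable_const
    · exact Measurable.ite (measurableSet_lt hc measurable_const) measurable_const measurable_const
  · unfold Jden
    rw [clamp_gradSq u (hA1 p hp)]
    simp only [clampR, clamp_eq (Ioo_subset_Icc_self (hA1 p hp))]
  · have h0 := (hA1 p hp).1
    have h1 := (hA1 p hp).2
    have a1 := Jden_lower hlp hlm u h0.le
    have a2 := Jden_upper hlp hlm u h0.le
    have a3 := h.gradSq_le (hA1 p hp)
    have a4 := gradSq_nonneg u p
    rw [abs_of_nonneg (by nlinarith)]
    have a5 : (gradSq u p + (lp + lm)) * p.1 ≤ (2 * K ^ 2 + (lp + lm)) * 1 :=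
      mul_le_mul (by linarith) h1.le h0.le (by positivity)
    linarith

lemma Jcomp {l lp lm K : ℝ} (hlp : 0 ≤ lp) (hlm : 0 ≤ lm) (hl : 0 < l) {u W : ℝ → ℝ → ℝ}
    (hu : IsMinimizerJ l lp lm 1 u) (hW : PolLip l K W) (h1 : ∀ θ, W 1 θ = u 1 θ)
    {Ω : Set (ℝ × ℝ)} (hΩ : MeasurableSet Ω) (hΩS : Ω ⊆ Ioo (0:ℝ) 1 ×ˢ Ioo (0:ℝ) l)
    (heq : ∀ p ∈ (Ioo (0:ℝ) 1 ×ˢ Ioo (0:ℝ) l) \ Ω, gradSq W p = gradSq u p ∧ W p.1 p.2 = u p.1 p.2) :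
    ∫ p in Ω, gradSq u p * p.1 ≤ (∫ p in Ω, gradSq W p * p.1) + (lp + lm) * ∫ p in Ω, p.1 := by
  obtain ⟨K', hu'⟩ := hu.1.polLip
  set S := Ioo (0:ℝ) 1 ×ˢ Ioo (0:ℝ) l with hS
  have hSm : MeasurableSet S := measurableSet_Ioo.prod measurableSet_Ioo
  have hSf : volume S ≠ ⊤ := vol_window _ _ _ _
  have hΩf : volume Ω ≠ ⊤ := ne_top_of_le_ne_top hSf (measure_mono hΩS)
  have hJ : ∫ p in S, Jden lp lm u p ≤ ∫ p in S, Jden lp lm W p := hu.2 W (hW.coneLip hl) h1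
  have split : ∀ {w : ℝ → ℝ → ℝ} {k : ℝ}, PolLip l k w → ∫ p in S, Jden lp lm w p =
      (∫ p in Ω, Jden lp lm w p) + ∫ p in S \ Ω, Jden lp lm w p := by
    intro w k hw
    have hi := Jden_integrable hlp hlm hw hSm hSf (fun p hp => hp.1)
    rw [← setIntegral_union disjoint_sdiff_right (hSm.diff hΩ) (hi.mono_set hΩS)
      (hi.mono_set sdiff_subset), union_sdiff_cancel hΩS]
  rw [split hu', split hW] at hJ
  have e : ∫ p in S \ Ω, Jden lp lm u p = ∫ p in S \ Ω, Jden lp lm W p := by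
    apply setIntegral_congr_fun (hSm.diff hΩ)
    intro p hp
    simp only [Jden]
    rw [(heq p hp).1, (heq p hp).2]
  rw [e] at hJ
  have hΩ1 : ∀ p ∈ Ω, p.1 ∈ Ioo (0:ℝ) 1 := fun p hp => (hΩS hp).1
  have i1 := hu'.integrableOn hΩ hΩf hΩ1
  have i2 := hW.integrableOn hΩ hΩf hΩ1
  have i3 := Jden_integrable hlp hlm hu' hΩ hΩf hΩ1
  have i4 := Jden_integrable hlp hlm hW hΩ hΩf hΩ1
  have i5 : IntegrableOn (fun p : ℝ × ℝ => p.1) Ω :=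
    integrableOn_of_eq_bdd (M := 1) hΩ hΩf measurable_fst (fun _ _ => rfl) fun p hp => by
      rw [abs_of_pos (hΩ1 p hp).1]; exact (hΩ1 p hp).2.le
  have a1 : ∫ p in Ω, gradSq u p * p.1 ≤ ∫ p in Ω, Jden lp lm u p :=
    setIntegral_mono_on i1 i3 hΩ fun p hp => Jden_lower hlp hlm u (hΩ1 p hp).1.le
  have a2 : ∫ p in Ω, Jden lp lm W p ≤ ∫ p in Ω, (gradSq W p * p.1 + (lp + lm) * p.1) :=
    setIntegral_mono_on i4 (i2.add (i5.const_mul _)) hΩ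
      fun p hp => Jden_upper hlp hlm W (hΩ1 p hp).1.le
  rw [integral_add i2 (i5.const_mul _), integral_const_mul] at a2
  linarith

lemma fst_int_le {Ω : Set (ℝ × ℝ)} {b : ℝ} (hΩ : MeasurableSet Ω) (hf : volume Ω ≠ ⊤)
    (hb : ∀ p ∈ Ω, 0 ≤ p.1 ∧ p.1 ≤ b) : ∫ p in Ω, p.1 ≤ b * volume.real Ω := by
  have i5 : IntegrableOn (fun p : ℝ × ℝ => p.1) Ω :=
    integrableOn_of_eq_bdd (M := b) hΩ hf measurable_fst (fun _ _ => rfl) fun p hp => by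
      rw [abs_of_nonneg (hb p hp).1]; exact (hb p hp).2
  have := setIntegral_mono_on i5 (integrableOn_const (C := b) hf) hΩ fun p hp => (hb p hp).2
  rw [setIntegral_const, smul_eq_mul] at this
  linarith

lemma gradSq_congr {u w : ℝ → ℝ → ℝ} {p : ℝ × ℝ}
    (h : ∀ᶠ q in nhds p, w q.1 q.2 = u q.1 q.2) : gradSq w p = gradSq u p := by
  have h1 : (fun s => w s p.2) =ᶠ[nhds p.1] fun s => u s p.2 := by
    have hc : Filter.Tendsto (fun s : ℝ => (s, p.2)) (nhds p.1) (nhds p) :=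
      (by fun_prop : Continuous fun s : ℝ => (s, p.2)).tendsto p.1
    exact hc.eventually h
  have h2 : (fun φ => w p.1 φ) =ᶠ[nhds p.2] fun φ => u p.1 φ := by
    have hc : Filter.Tendsto (fun s : ℝ => (p.1, s)) (nhds p.2) (nhds p) :=
      (by fun_prop : Continuous fun s : ℝ => (p.1, s)).tendsto p.2
    exact hc.eventually h
  unfold gradSq
  rw [h1.deriv_eq, h2.deriv_eq]

lemma prod_Ioc_ae (ρ a b : ℝ) :
    (Ioc (0:ℝ) ρ ×ˢ Ioo a b : Set (ℝ × ℝ)) =ᵐ[volume] (Ioo (0:ℝ) ρ ×ˢ Ioo a b : Set (ℝ × ℝ)) := by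
  rw [Measure.volume_eq_prod]
  exact Measure.set_prod_ae_eq Ioo_ae_eq_Ioc.symm (Filter.EventuallyEq.refl _ _)

lemma vertex_almostMin {l lp lm : ℝ} (hlp : 0 ≤ lp) (hlm : 0 ≤ lm) (hl : 0 < l) {u : ℝ → ℝ → ℝ}
    (hu : IsMinimizerJ l lp lm 1 u) : AlmostMin 0 l 1 ((lp + lm) * l) u := by
  intro ρ hρ w K hw hwu
  have hΩm : MeasurableSet (Ioc (0:ℝ) ρ ×ˢ Ioo (0:ℝ) l : Set (ℝ × ℝ)) :=
    measurableSet_Ioc.prod measurableSet_Ioo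
  have h := Jcomp hlp hlm hl hu hw (hwu 1 hρ.2.le) (Ω := Ioc (0:ℝ) ρ ×ˢ Ioo (0:ℝ) l) hΩm
    (fun p hp => ⟨⟨hp.1.1, hp.1.2.trans_lt hρ.2⟩, hp.2⟩) (by
      rintro p ⟨hp1, hp2⟩
      have hlt : ρ < p.1 := by
        by_contra hcon
        exact hp2 ⟨⟨hp1.1.1, not_lt.1 hcon⟩, hp1.2⟩
      refine ⟨gradSq_congr ?_, hwu _ hlt.le _⟩
      filter_upwards [(continuous_fst.tendsto p).eventually (lt_mem_nhds hlt)] with q hq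
      exact hwu _ hq.le _)
  have hv : volume.real (Ioc (0:ℝ) ρ ×ˢ Ioo (0:ℝ) l : Set (ℝ × ℝ)) = ρ * l := by
    rw [Measure.real, Measure.volume_eq_prod, Measure.prod_prod]
    simp [ENNReal.toReal_mul, hρ.1.le, hl.le]
  have hf := fst_int_le (b := ρ) hΩm (by
    rw [Measure.volume_eq_prod, Measure.prod_prod]; simp [ENNReal.mul_eq_top])
    (fun p hp => ⟨hp.1.1.le, hp.1.2⟩)
  rw [hv] at hf
  rw [setIntegral_congr_set (prod_Ioc_ae ρ 0 l), setIntegral_congr_set (prod_Ioc_ae ρ 0 l)] at h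
  unfold DirW
  simp only [zero_add, one_mul]
  have := mul_le_mul_of_nonneg_left hf (add_nonneg hlp hlm)
  linarith

lemma PolLip.shift {l K : ℝ} {u : ℝ → ℝ → ℝ} (h : PolLip l K u) (t : ℝ) :
    PolLip l K (fun r θ => u r (θ + t)) := by
  refine ⟨h.nonneg, fun r θ => ?_, fun r hr s hs θ => h.rad r hr s hs _, fun r hr θ φ => ?_⟩
  · rw [← h.per r (θ + t)]; congr 1; ring
  · have := h.ang r hr (θ + t) (φ + t)
    rwa [add_sub_add_right_eq_sub] at this

lemma gradSq_shift (u : ℝ → ℝ → ℝ) (t r θ : ℝ) :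
    gradSq (fun r θ => u r (θ + t)) (r, θ) = gradSq u (r, θ + t) := by
  unfold gradSq
  simp only
  rw [deriv_comp_add_const (fun φ => u r φ) t θ]

lemma Jfun_shift {l lp lm K : ℝ} (hlp : 0 ≤ lp) (hlm : 0 ≤ lm) (hl : 0 < l) {u : ℝ → ℝ → ℝ}
    (h : PolLip l K u) (t : ℝ) : Jfun l lp lm (fun r θ => u r (θ + t)) 1 = Jfun l lp lm u 1 := by
  have fub : ∀ {w : ℝ → ℝ → ℝ} {k : ℝ}, PolLip l k w → Jfun l lp lm w 1 =
      ∫ r in Ioo (0:ℝ) 1, ∫ θ in (0:ℝ)..l, Jden lp lm w (r, θ) := by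
    intro w k hw
    have hi := Jden_integrable hlp hlm hw (A := Ioo (0:ℝ) 1 ×ˢ Ioo (0:ℝ) l)
      (measurableSet_Ioo.prod measurableSet_Ioo) (vol_window _ _ _ _) (fun p hp => hp.1)
    have : Jfun l lp lm w 1 = ∫ p in Ioo (0:ℝ) 1 ×ˢ Ioo (0:ℝ) l, Jden lp lm w p := rfl
    rw [this, Measure.volume_eq_prod, setIntegral_prod _ (by rwa [← Measure.volume_eq_prod])]
    simp_rw [Ioo_int_eq _ hl.le]
  rw [fub (h.shift t), fub h]
  congr 1
  funext r
  have e : ∀ θ, Jden lp lm (fun r θ => u r (θ + t)) (r, θ) = Jden lp lm u (r, θ + t) := by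
    intro θ
    unfold Jden
    rw [gradSq_shift]
  simp_rw [e]
  rw [intervalIntegral.integral_comp_add_right (fun θ => Jden lp lm u (r, θ)) t]
  have hper : Function.Periodic (fun θ => Jden lp lm u (r, θ)) l := by
    intro θ
    have e2 : (fun r θ => u r (θ + l)) = u := by funext r θ; exact h.per r θ
    have := gradSq_shift u l r θ
    rw [e2] at this
    simp only [Jden]
    rw [← this, h.per]
  have := hper.intervalIntegral_add_eq (0 + t) 0
  rw [zero_add] at this ⊢
  rw [add_comm l t, this, zero_add]

lemma Dir_eq (l : ℝ) (u : ℝ → ℝ → ℝ) : Dir l u 1 = Jfun l 0 0 u 1 := by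
  unfold Dir Jfun; simp

lemma minimizer_shift {l lp lm : ℝ} (hlp : 0 ≤ lp) (hlm : 0 ≤ lm) (hl : 0 < l) {u : ℝ → ℝ → ℝ}
    (hu : IsMinimizerJ l lp lm 1 u) (hD : Dir l u 1 ≤ 1) (t : ℝ) :
    IsMinimizerJ l lp lm 1 (fun r θ => u r (θ + t)) ∧ Dir l (fun r θ => u r (θ + t)) 1 ≤ 1 := by
  obtain ⟨K, h⟩ := hu.1.polLip
  refine ⟨⟨(h.shift t).coneLip hl, fun w hw hw1 => ?_⟩, ?_⟩
  · obtain ⟨K', h'⟩ := hw.polLip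
    rw [Jfun_shift hlp hlm hl h, ← Jfun_shift hlp hlm hl h' (-t)]
    apply hu.2 _ ((h'.shift (-t)).coneLip hl)
    intro θ
    show w 1 (θ + -t) = u 1 θ
    rw [hw1]
    show u 1 (θ + -t + t) = u 1 θ
    rw [neg_add_cancel_right]
  · rw [Dir_eq, Jfun_shift le_rfl le_rfl hl h, ← Dir_eq]; exact hD

lemma polar_ae {Q : ℝ × ℝ → Prop} (h : ∀ᵐ z : ℝ × ℝ, Q z) :
    ∀ᵐ p : ℝ × ℝ, p ∈ polarCoord.target → Q (polarCoord.symm p) := by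
  obtain ⟨N, hN, hNm, hN0⟩ := exists_measurable_superset_of_null (ae_iff.1 h)
  have h1 := lintegral_comp_polarCoord_symm (N.indicator (fun _ => (1 : ENNReal)))
  rw [lintegral_indicator_const hNm, hN0, mul_zero] at h1
  have hmP : Measurable fun p : ℝ × ℝ => polarCoord.symm p :=
    continuous_polarCoord_symm.measurable
  have hm : Measurable fun p : ℝ × ℝ =>
      ENNReal.ofReal p.1 • N.indicator (fun _ => (1 : ENNReal)) (polarCoord.symm p) :=
    (measurable_fst.ennreal_ofReal).smul ((measurable_const.indicator hNm).comp hmP)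
  rw [lintegral_eq_zero_iff hm, Filter.EventuallyEq, ae_restrict_iff' polarCoord.open_target.measurableSet] at h1
  filter_upwards [h1] with p hp hpt
  have hp' := hp hpt
  by_contra hcon
  have hin : polarCoord.symm p ∈ N := hN hcon
  have hpos : 0 < p.1 := by
    rw [polarCoord_target] at hpt; exact hpt.1
  rw [indicator_of_mem hin] at hp'
  simp at hp'
  linarith

/-- squared euclidean gradient -/
def gV (V : ℝ × ℝ → ℝ) (z : ℝ × ℝ) : ℝ :=
  (deriv (fun x => V (x, z.2)) z.1) ^ 2 + (deriv (fun y => V (z.1, y)) z.2) ^ 2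

lemma gV_polar {V : ℝ × ℝ → ℝ} {v : ℝ → ℝ → ℝ} {s φ : ℝ} (hs : s ∈ Ioo (0:ℝ) 1)
    (hv : ∀ s ∈ Ioo (0:ℝ) 1, ∀ φ, v s φ = V (s * Real.cos φ, s * Real.sin φ))
    (hd : DifferentiableAt ℝ V (s * Real.cos φ, s * Real.sin φ)) :
    gradSq v (s, φ) = gV V (s * Real.cos φ, s * Real.sin φ) := by
  set D := fderiv ℝ V (s * Real.cos φ, s * Real.sin φ) with hD
  have hD' : HasFDerivAt V D (s * Real.cos φ, s * Real.sin φ) := hd.hasFDerivAt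
  have e1 : deriv (fun x => V (x, s * Real.sin φ)) (s * Real.cos φ) = D (1, 0) := by
    have hc : HasDerivAt (fun x : ℝ => (x, s * Real.sin φ)) ((1 : ℝ), (0 : ℝ)) (s * Real.cos φ) :=
      (hasDerivAt_id _).prodMk (hasDerivAt_const _ _)
    exact (HasFDerivAt.comp_hasDerivAt (s * Real.cos φ) (l := V)
      (f := fun x : ℝ => (x, s * Real.sin φ)) hD' hc).deriv
  have e2 : deriv (fun y => V (s * Real.cos φ, y)) (s * Real.sin φ) = D (0, 1) := by
    have hc : HasDerivAt (fun x : ℝ => (s * Real.cos φ, x)) ((0 : ℝ), (1 : ℝ)) (s * Real.sin φ) :=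
      (hasDerivAt_const _ _).prodMk (hasDerivAt_id _)
    exact (HasFDerivAt.comp_hasDerivAt (s * Real.sin φ) (l := V)
      (f := fun x : ℝ => (s * Real.cos φ, x)) hD' hc).deriv
  have lin : ∀ x y : ℝ, D (x, y) = x * D (1, 0) + y * D (0, 1) := by
    intro x y
    have : (x, y) = x • ((1 : ℝ), (0 : ℝ)) + y • ((0 : ℝ), (1 : ℝ)) := by simp
    rw [this, map_add, map_smul, map_smul]; rfl
  have e3 : deriv (fun r => v r φ) s = D (Real.cos φ, Real.sin φ) := by
    have : (fun r => v r φ) =ᶠ[nhds s] fun r => V (r * Real.cos φ, r * Real.sin φ) := by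
      filter_upwards [Ioo_mem_nhds hs.1 hs.2] with r hr
      exact hv r hr φ
    rw [this.deriv_eq]
    have hc : HasDerivAt (fun r : ℝ => (r * Real.cos φ, r * Real.sin φ))
        (1 * Real.cos φ, 1 * Real.sin φ) s :=
      ((hasDerivAt_id s).mul_const _).prodMk ((hasDerivAt_id s).mul_const _)
    rw [one_mul, one_mul] at hc
    exact (HasFDerivAt.comp_hasDerivAt s (l := V)
      (f := fun r : ℝ => (r * Real.cos φ, r * Real.sin φ)) hD' hc).deriv
  have e4 : deriv (fun ψ => v s ψ) φ = D (s * -Real.sin φ, s * Real.cos φ) := by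
    have : (fun ψ => v s ψ) = fun ψ => V (s * Real.cos ψ, s * Real.sin ψ) := by
      funext ψ; exact hv s hs ψ
    rw [this]
    have hc : HasDerivAt (fun ψ : ℝ => (s * Real.cos ψ, s * Real.sin ψ))
        (s * -Real.sin φ, s * Real.cos φ) φ :=
      ((Real.hasDerivAt_cos φ).const_mul s).prodMk ((Real.hasDerivAt_sin φ).const_mul s)
    exact (HasFDerivAt.comp_hasDerivAt φ (l := V)
      (f := fun ψ : ℝ => (s * Real.cos ψ, s * Real.sin ψ)) hD' hc).deriv
  unfold gradSq gV
  simp only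
  rw [e1, e2, e3, e4, lin (Real.cos φ), lin (s * -Real.sin φ)]
  have hs0 : s ≠ 0 := hs.1.ne'
  field_simp
  linear_combination (D (1, 0) ^ 2 + D (0, 1) ^ 2) * (Real.sin_sq_add_cos_sq φ)

def Dsk (ρ : ℝ) : Set (ℝ × ℝ) := {z | z.1 ^ 2 + z.2 ^ 2 ≤ ρ ^ 2}

lemma Dsk_meas (ρ : ℝ) : MeasurableSet (Dsk ρ) :=
  (isClosed_le (by fun_prop) continuous_const).measurableSet

lemma polar_transfer {V : ℝ × ℝ → ℝ} {C : NNReal} (hV : LipschitzWith C V) {v : ℝ → ℝ → ℝ}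
    (hv : ∀ s ∈ Ioo (0:ℝ) 1, ∀ φ, v s φ = V (s * Real.cos φ, s * Real.sin φ)) {ρ : ℝ}
    (hρ : ρ ∈ Ioc (0:ℝ) 1) :
    DirW (-Real.pi) (2 * Real.pi) v ρ = ∫ z in Dsk ρ, gV V z := by
  have hw : -Real.pi + 2 * Real.pi = Real.pi := by ring
  unfold DirW
  rw [hw, ← integral_indicator (Dsk_meas ρ), ← integral_comp_polarCoord_symm]
  have h1 : ∫ p in polarCoord.target, p.1 • (Dsk ρ).indicator (gV V) (polarCoord.symm p)
      = ∫ p in polarCoord.target, (Ioc 0 ρ ×ˢ univ).indicator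
        (fun p => p.1 * gV V (polarCoord.symm p)) p := by
    apply setIntegral_congr_fun polarCoord.open_target.measurableSet
    intro p hp
    rw [polarCoord_target] at hp
    have hp0 : 0 < p.1 := hp.1
    have hiff : polarCoord.symm p ∈ Dsk ρ ↔ p ∈ Ioc 0 ρ ×ˢ (univ : Set ℝ) := by
      have e : (p.1 * Real.cos p.2) ^ 2 + (p.1 * Real.sin p.2) ^ 2 = p.1 ^ 2 := by
        have := Real.sin_sq_add_cos_sq p.2
        linear_combination p.1 ^ 2 * this
      simp only [Dsk, polarCoord_symm_apply, mem_ofPred_eq, e, mem_prod, mem_Ioc, mem_univ, and_true]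
      rw [pow_le_pow_iff_left₀ hp0.le hρ.1.le (by norm_num)]
      exact ⟨fun h => ⟨hp0, h⟩, fun h => h.2⟩
    simp only [smul_eq_mul]
    by_cases hm : p ∈ Ioc 0 ρ ×ˢ (univ : Set ℝ)
    · rw [indicator_of_mem hm, indicator_of_mem (hiff.2 hm)]
    · rw [indicator_of_notMem hm, indicator_of_notMem (fun h => hm (hiff.1 h)), mul_zero]
  have h2 : polarCoord.target ∩ Ioc 0 ρ ×ˢ univ = Ioc 0 ρ ×ˢ Ioo (-Real.pi) Real.pi := by
    rw [polarCoord_target]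
    ext p
    simp only [mem_inter_iff, mem_prod, mem_Ioi, mem_Ioc, mem_univ, mem_Ioo]
    tauto
  rw [h1, setIntegral_indicator (measurableSet_Ioc.prod MeasurableSet.univ), h2,
    setIntegral_congr_set (prod_Ioc_ae ρ _ _)]
  apply setIntegral_congr_ae (measurableSet_Ioo.prod measurableSet_Ioo)
  filter_upwards [polar_ae hV.ae_differentiableAt] with p hp hpm
  have hpt : p ∈ polarCoord.target := by
    rw [polarCoord_target]; exact ⟨hpm.1.1, hpm.2⟩
  have hd := hp hpt
  rw [polarCoord_symm_apply] at hd ⊢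
  rw [← gV_polar (v := v) ⟨hpm.1.1, hpm.1.2.trans_le hρ.2⟩ hv hd, mul_comm]

/-- elliptical region -/
def Ell (r1 θ1 a b ρ : ℝ) : Set (ℝ × ℝ) := {p | ((p.1 - r1) / a, (p.2 - θ1) / b) ∈ Dsk ρ}

lemma Ell_meas (r1 θ1 a b ρ : ℝ) : MeasurableSet (Ell r1 θ1 a b ρ) :=
  (Dsk_meas ρ).preimage (by fun_prop)

lemma Ell_image {r1 θ1 a b ρ : ℝ} (ha : 0 < a) (hb : 0 < b) :
    (fun z : ℝ × ℝ => (r1 + a * z.1, θ1 + b * z.2)) '' Dsk ρ = Ell r1 θ1 a b ρ := by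
  ext p
  constructor
  · rintro ⟨z, hz, rfl⟩
    simp only [Ell, mem_ofPred_eq, add_sub_cancel_left]
    rw [mul_div_cancel_left₀ _ ha.ne', mul_div_cancel_left₀ _ hb.ne']
    exact hz
  · intro hp
    refine ⟨_, hp, ?_⟩
    ext
    · simp only; field_simp; ring
    · simp only; field_simp; ring

lemma affine_transfer {r1 θ1 a b ρ : ℝ} (ha : 0 < a) (hb : 0 < b) (G : ℝ × ℝ → ℝ) :
    ∫ p in Ell r1 θ1 a b ρ, G p = ∫ z in Dsk ρ, (a * b) * G (r1 + a * z.1, θ1 + b * z.2) := by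
  set A : (ℝ × ℝ) →L[ℝ] (ℝ × ℝ) :=
    (a • ContinuousLinearMap.id ℝ ℝ).prodMap (b • ContinuousLinearMap.id ℝ ℝ) with hA
  have hdet : A.det = a * b := by
    have : (A : (ℝ × ℝ) →ₗ[ℝ] (ℝ × ℝ)) = LinearMap.prodMap (a • LinearMap.id) (b • LinearMap.id) := by
      ext <;> simp [hA]
    rw [ContinuousLinearMap.det, this, LinearMap.det_prodMap]
    simp
  rw [← Ell_image ha hb, integral_image_eq_integral_abs_det_fderiv_smul volume (Dsk_meas ρ)
    (f' := fun _ => A)]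
  · simp only [hdet, smul_eq_mul]
    rw [abs_of_pos (mul_pos ha hb)]
  · intro z _
    apply HasFDerivAt.hasFDerivWithinAt
    have h1 : HasFDerivAt (fun z : ℝ × ℝ => (r1, θ1) + A z) A z := A.hasFDerivAt.const_add _
    have h2 : (fun z : ℝ × ℝ => (r1 + a * z.1, θ1 + b * z.2)) = fun z => (r1, θ1) + A z := by
      funext z; rfl
    rw [h2]; exact h1
  · intro z _ z' _ h
    simp only [Prod.mk.injEq, add_right_inj] at h
    ext
    · exact mul_left_cancel₀ ha.ne' h.1
    · exact mul_left_cancel₀ hb.ne' h.2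

lemma chart_transfer {r1 θ1 a b ρ : ℝ} (ha : 0 < a) (hb : 0 < b) {V : ℝ × ℝ → ℝ} {C : NNReal}
    (hV : LipschitzWith C V) {v u : ℝ → ℝ → ℝ}
    (hv : ∀ s ∈ Ioo (0:ℝ) 1, ∀ φ, v s φ = V (s * Real.cos φ, s * Real.sin φ))
    (hρ : ρ ∈ Ioc (0:ℝ) 1)
    (hu : ∀ z ∈ Dsk ρ, ∀ᶠ y in nhds z, V y = u (r1 + a * y.1) (θ1 + b * y.2)) :
    DirW (-Real.pi) (2 * Real.pi) v ρ = ∫ p in Ell r1 θ1 a b ρ,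
      (a / b * (deriv (fun s => u s p.2) p.1) ^ 2 +
        (deriv (fun φ => u p.1 φ) p.2) ^ 2 / (a / b)) := by
  rw [polar_transfer hV hv hρ, affine_transfer ha hb]
  apply setIntegral_congr_fun (Dsk_meas ρ)
  intro z hz
  have h1 : (fun x => V (x, z.2)) =ᶠ[nhds z.1] fun x => u (r1 + a * x) (θ1 + b * z.2) := by
    have hc : Filter.Tendsto (fun s : ℝ => (s, z.2)) (nhds z.1) (nhds z) :=
      (by fun_prop : Continuous fun s : ℝ => (s, z.2)).tendsto z.1
    exact hc.eventually (hu z hz)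
  have h2 : (fun y => V (z.1, y)) =ᶠ[nhds z.2] fun y => u (r1 + a * z.1) (θ1 + b * y) := by
    have hc : Filter.Tendsto (fun s : ℝ => (z.1, s)) (nhds z.2) (nhds z) :=
      (by fun_prop : Continuous fun s : ℝ => (z.1, s)).tendsto z.2
    exact hc.eventually (hu z hz)
  have d : ∀ (f : ℝ → ℝ) (c m x : ℝ), deriv (fun x => f (c + m * x)) x = m * deriv f (c + m * x) := by
    intro f c m x
    have := deriv_comp_mul_left m (fun y => f (c + y)) x
    rw [this, deriv_comp_const_add, smul_eq_mul]
  unfold gV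
  simp only
  rw [h1.deriv_eq, h2.deriv_eq, d (fun r => u r (θ1 + b * z.2)) r1 a,
    d (fun y => u (r1 + a * z.1) y) θ1 b]
  field_simp

/-- complex number of a point -/
def toC (z : ℝ × ℝ) : ℂ := ⟨z.1, z.2⟩

/-- function on the plane from a function in polar coordinates -/
def lift (g : ℝ → ℝ → ℝ) (z : ℝ × ℝ) : ℝ := g ‖toC z‖ (toC z).arg

lemma toC_norm_sq (z : ℝ × ℝ) : ‖toC z‖ ^ 2 = z.1 ^ 2 + z.2 ^ 2 := by
  rw [Complex.sq_norm, Complex.normSq_apply]; simp only [toC]; ring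

lemma toC_dist (z y : ℝ × ℝ) : ‖toC z - toC y‖ ≤ 2 * dist z y := by
  have h := Complex.norm_le_abs_re_add_abs_im (toC z - toC y)
  simp only [Complex.sub_re, Complex.sub_im, toC] at h
  have h2 : |z.1 - y.1| ≤ dist z y := by rw [← Real.dist_eq, Prod.dist_eq]; exact le_max_left _ _
  have h3 : |z.2 - y.2| ≤ dist z y := by rw [← Real.dist_eq, Prod.dist_eq]; exact le_max_right _ _
  exact h.trans (by linarith)

lemma coneDist_polar (x y : ℂ) : coneDist (2 * Real.pi) (‖x‖, x.arg) (‖y‖, y.arg) = ‖x - y‖ := by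
  obtain ⟨k, hk, hk2⟩ := iInf_abs_attained (l := 2 * Real.pi) (by positivity) (x.arg - y.arg)
  unfold coneDist
  simp only
  rw [hk, min_eq_left (by linarith), Real.cos_abs, Real.cos_add_int_mul_two_pi, Real.cos_sub]
  have hx1 := Complex.norm_mul_cos_arg x
  have hx2 := Complex.norm_mul_sin_arg x
  have hy1 := Complex.norm_mul_cos_arg y
  have hy2 := Complex.norm_mul_sin_arg y
  have nx := Complex.sq_norm x
  have ny := Complex.sq_norm y
  rw [Complex.normSq_apply] at nx ny
  rw [show ‖x - y‖ = Real.sqrt (‖x - y‖ ^ 2) from (Real.sqrt_sq (norm_nonneg _)).symm]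
  congr 1
  rw [Complex.sq_norm (x - y), Complex.normSq_apply, Complex.sub_re, Complex.sub_im, nx, ny]
  calc _ = x.re * x.re + x.im * x.im + (y.re * y.re + y.im * y.im) -
        2 * ((‖x‖ * Real.cos x.arg) * (‖y‖ * Real.cos y.arg) +
          (‖x‖ * Real.sin x.arg) * (‖y‖ * Real.sin y.arg)) := by ring
    _ = _ := by rw [hx1, hx2, hy1, hy2]; ring

lemma lift_lip {g : ℝ → ℝ → ℝ} {K : ℝ} (h : PolLip (2 * Real.pi) K g)
    (h0 : ∀ r, 1 ≤ r → ∀ θ, g r θ = 0) : ∃ C : NNReal, LipschitzWith C (lift g) := by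
  have hpi := Real.pi_pos
  have hK := h.nonneg
  set M := K * (3 + 2 * (2 * Real.pi)) with hM
  have hM0 : 0 ≤ M := by positivity
  have hKM : K ≤ M := by nlinarith
  have key : ∀ z y : ℝ × ℝ, ‖toC z‖ ≤ 1 → |lift g z - lift g y| ≤ M * ‖toC z - toC y‖ := by
    intro z y hz
    by_cases hy : ‖toC y‖ ≤ 1
    · have := h.coneBound (by positivity) (‖toC z‖, (toC z).arg) (‖toC y‖, (toC y).arg)
        ⟨norm_nonneg _, hz⟩ ⟨norm_nonneg _, hy⟩
      rw [coneDist_polar] at this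
      exact this
    · push Not at hy
      have e1 : lift g y = 0 := h0 _ hy.le _
      have e2 := h.rad ‖toC z‖ ⟨norm_nonneg _, hz⟩ 1 (by simp) (toC z).arg
      rw [h0 1 le_rfl] at e2
      have e3 : |‖toC z‖ - 1| ≤ ‖toC z - toC y‖ := by
        rw [abs_sub_comm, abs_of_nonneg (by linarith)]
        have := norm_sub_norm_le (toC y) (toC z)
        rw [norm_sub_rev] at this
        linarith
      rw [e1]
      exact e2.trans (mul_le_mul hKM e3 (abs_nonneg _) hM0)
  have key2 : ∀ z y : ℝ × ℝ, |lift g z - lift g y| ≤ M * ‖toC z - toC y‖ := by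
    intro z y
    by_cases hz : ‖toC z‖ ≤ 1
    · exact key z y hz
    by_cases hy : ‖toC y‖ ≤ 1
    · have := key y z hy
      rwa [abs_sub_comm, norm_sub_rev] at this
    · push Not at hz hy
      have e1 : lift g y = 0 := h0 _ hy.le _
      have e2 : lift g z = 0 := h0 _ hz.le _
      rw [e1, e2, sub_self, abs_zero]; positivity
  refine ⟨Real.toNNReal (2 * M), LipschitzWith.of_dist_le_mul fun z y => ?_⟩
  rw [Real.dist_eq, Real.coe_toNNReal _ (by positivity)]
  have := mul_le_mul_of_nonneg_left (toC_dist z y) hM0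
  linarith [key2 z y]

lemma toC_polar_norm {s : ℝ} (hs : 0 ≤ s) (φ : ℝ) :
    ‖toC (s * Real.cos φ, s * Real.sin φ)‖ = s := by
  have := toC_norm_sq (s * Real.cos φ, s * Real.sin φ)
  simp only at this
  have e : (s * Real.cos φ) ^ 2 + (s * Real.sin φ) ^ 2 = s ^ 2 := by
    linear_combination s ^ 2 * Real.sin_sq_add_cos_sq φ
  rw [e] at this
  exact (pow_left_inj₀ (norm_nonneg _) hs (by norm_num)).1 this

lemma lift_polar {g : ℝ → ℝ → ℝ} {K : ℝ} (h : PolLip (2 * Real.pi) K g) {s : ℝ} (hs : 0 < s)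
    (φ : ℝ) : lift g (s * Real.cos φ, s * Real.sin φ) = g s φ := by
  unfold lift
  rw [toC_polar_norm hs.le]
  have e : toC (s * Real.cos φ, s * Real.sin φ) =
      (s : ℂ) * (Complex.cos φ + Complex.sin φ * Complex.I) := by
    apply Complex.ext
    · simp [toC, Complex.cos_ofReal_re, Complex.sin_ofReal_im]
    · simp [toC, Complex.cos_ofReal_im, Complex.sin_ofReal_re]
  rw [e, Complex.arg_mul_cos_add_sin_mul_I_eq_toIocMod hs]
  have h2 := toIocMod_add_toIocDiv_zsmul Real.two_pi_pos (-Real.pi) φ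
  rw [zsmul_eq_mul] at h2
  have h3 := per_int (h.per s) (toIocMod Real.two_pi_pos (-Real.pi) φ)
    (toIocDiv Real.two_pi_pos (-Real.pi) φ)
  rw [h2] at h3
  exact h3.symm

lemma polLip_of_lip {V : ℝ × ℝ → ℝ} {C : NNReal} (hV : LipschitzWith C V) :
    PolLip (2 * Real.pi) C (fun s φ => V (s * Real.cos φ, s * Real.sin φ)) := by
  refine ⟨C.2, fun r θ => by simp, fun r hr s hs θ => ?_, fun r hr θ φ => ?_⟩
  · have := hV.dist_le_mul (r * Real.cos θ, r * Real.sin θ) (s * Real.cos θ, s * Real.sin θ)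
    rw [Real.dist_eq] at this
    refine this.trans (mul_le_mul_of_nonneg_left ?_ C.2)
    rw [Prod.dist_eq]
    simp only [Real.dist_eq, ← sub_mul, abs_mul]
    apply max_le
    · exact mul_le_of_le_one_right (abs_nonneg _) (Real.abs_cos_le_one _)
    · exact mul_le_of_le_one_right (abs_nonneg _) (Real.abs_sin_le_one _)
  · have := hV.dist_le_mul (r * Real.cos θ, r * Real.sin θ) (r * Real.cos φ, r * Real.sin φ)
    rw [Real.dist_eq] at this
    rw [mul_assoc]
    refine this.trans (mul_le_mul_of_nonneg_left ?_ C.2)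
    rw [Prod.dist_eq]
    simp only [Real.dist_eq, ← mul_sub, abs_mul, abs_of_nonneg hr.1]
    apply max_le
    · exact mul_le_mul_of_nonneg_left (Real.abs_cos_sub_cos_le _ _) hr.1
    · exact mul_le_mul_of_nonneg_left (Real.abs_sin_sub_sin_le _ _) hr.1

lemma PolLip.sub {L K K' : ℝ} {v w : ℝ → ℝ → ℝ} (h : PolLip L K v) (h' : PolLip L K' w) :
    PolLip L (K + K') (fun r θ => v r θ - w r θ) := by
  refine ⟨add_nonneg h.nonneg h'.nonneg, fun r θ => by rw [h.per, h'.per], fun r hr s hs θ => ?_,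
    fun r hr θ φ => ?_⟩
  · have h1 := h.rad r hr s hs θ
    have h2 := h'.rad r hr s hs θ
    rw [abs_le] at *
    constructor <;> linarith [h1.1, h1.2, h2.1, h2.2]
  · have h1 := h.ang r hr θ φ
    have h2 := h'.ang r hr θ φ
    rw [abs_le] at *
    constructor <;> linarith [h1.1, h1.2, h2.1, h2.2]

/-- periodic extension of a Lipschitz function vanishing at the endpoints -/
lemma per_ext_lip {l C : ℝ} (hl : 0 < l) (hC : 0 ≤ C) {k : ℝ → ℝ}
    (hk : ∀ x y, |k x - k y| ≤ C * |x - y|) (h0 : k 0 = 0) (h1 : k l = 0) (θ φ : ℝ) :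
    |k (toIcoMod hl 0 θ) - k (toIcoMod hl 0 φ)| ≤ C * |θ - φ| := by
  wlog hle : θ ≤ φ generalizing θ φ
  · have := this φ θ (le_of_not_ge hle)
    rwa [abs_sub_comm, abs_sub_comm φ θ] at this
  set x := toIcoMod hl 0 θ with hx
  set y := toIcoMod hl 0 φ with hy
  set m := toIcoDiv hl 0 θ
  set n := toIcoDiv hl 0 φ
  have ex : x + (m : ℝ) * l = θ := by
    rw [← toIcoMod_add_toIcoDiv_zsmul hl 0 θ, zsmul_eq_mul]
  have ey : y + (n : ℝ) * l = φ := by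
    rw [← toIcoMod_add_toIcoDiv_zsmul hl 0 φ, zsmul_eq_mul]
  have mx := toIcoMod_mem_Ico' hl θ
  have my := toIcoMod_mem_Ico' hl φ
  rw [← hx] at mx
  rw [← hy] at my
  rcases lt_trichotomy m n with hmn | hmn | hmn
  · have hmn' : (m : ℝ) + 1 ≤ n := by exact_mod_cast hmn
    have a1 := hk x l
    have a2 := hk 0 y
    rw [h1] at a1
    rw [h0] at a2
    rw [abs_of_nonpos (by linarith [mx.2] : x - l ≤ 0)] at a1
    rw [abs_of_nonpos (by linarith [my.1] : 0 - y ≤ 0)] at a2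
    rw [abs_of_nonpos (by linarith : θ - φ ≤ 0)]
    have a3 : -(x - l) + -(0 - y) ≤ -(θ - φ) := by nlinarith
    have a4 := mul_le_mul_of_nonneg_left a3 hC
    rw [abs_le] at *
    constructor <;> linarith [a1.1, a1.2, a2.1, a2.2]
  · have := hk x y
    rw [← ex, ← ey, hmn]
    convert this using 3
    ring
  · exfalso
    have hmn' : (n : ℝ) + 1 ≤ m := by exact_mod_cast hmn
    nlinarith [mx.1, my.2]

/-- admissible elliptical charts -/
structure Chart (l r1 θ1 a b m : ℝ) : Prop where
  ha : 0 < a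
  hb : 0 < b
  hm : 0 < m
  h1 : a < r1
  h2 : r1 + a < 1
  h3 : b < θ1
  h4 : θ1 + b < l
  m1 : m * (a / b) ≤ r1 - a
  m2 : m * (r1 + a) ≤ a / b

def flatV (r1 θ1 a b : ℝ) (u : ℝ → ℝ → ℝ) (z : ℝ × ℝ) : ℝ :=
  clampR u (r1 + a * z.1) (θ1 + b * z.2)

def flat (r1 θ1 a b : ℝ) (u : ℝ → ℝ → ℝ) (s φ : ℝ) : ℝ :=
  flatV r1 θ1 a b u (s * Real.cos φ, s * Real.sin φ)

lemma flatV_lip {l K r1 θ1 a b : ℝ} (ha : 0 < a) (hb : 0 < b) {u : ℝ → ℝ → ℝ} (h : PolLip l K u) :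
    ∃ C : NNReal, LipschitzWith C (flatV r1 θ1 a b u) := by
  have hK := h.nonneg
  refine ⟨Real.toNNReal (K * (a + b)), LipschitzWith.of_dist_le_mul fun z y => ?_⟩
  rw [Real.dist_eq, Real.coe_toNNReal _ (by positivity)]
  have h1 := h.clamp_lip (r1 + a * z.1) (r1 + a * y.1) (θ1 + b * z.2) (θ1 + b * y.2)
  have e1 : r1 + a * z.1 - (r1 + a * y.1) = a * (z.1 - y.1) := by ring
  have e2 : θ1 + b * z.2 - (θ1 + b * y.2) = b * (z.2 - y.2) := by ring
  rw [e1, e2, abs_mul, abs_mul, abs_of_pos ha, abs_of_pos hb] at h1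
  have h2 : |z.1 - y.1| ≤ dist z y := by rw [← Real.dist_eq, Prod.dist_eq]; exact le_max_left _ _
  have h3 : |z.2 - y.2| ≤ dist z y := by rw [← Real.dist_eq, Prod.dist_eq]; exact le_max_right _ _
  refine h1.trans ?_
  have := mul_le_mul_of_nonneg_left h2 ha.le
  have := mul_le_mul_of_nonneg_left h3 hb.le
  calc K * (a * |z.1 - y.1|) + K * (b * |z.2 - y.2|) ≤ K * (a * dist z y) + K * (b * dist z y) := by
        gcongr
    _ = _ := by ring

lemma Dsk_abs {ρ : ℝ} (hρ : 0 ≤ ρ) {z : ℝ × ℝ} (hz : z ∈ Dsk ρ) : |z.1| ≤ ρ ∧ |z.2| ≤ ρ := by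
  have hz' : z.1 ^ 2 + z.2 ^ 2 ≤ ρ ^ 2 := hz
  constructor
  · exact abs_le_of_sq_le_sq (by nlinarith [sq_nonneg z.2]) hρ
  · exact abs_le_of_sq_le_sq (by nlinarith [sq_nonneg z.1]) hρ

lemma Ell_bounds {l r1 θ1 a b m : ℝ} (hc : Chart l r1 θ1 a b m) {ρ : ℝ} (hρ : 0 ≤ ρ) {p : ℝ × ℝ}
    (hp : p ∈ Ell r1 θ1 a b ρ) : |p.1 - r1| ≤ a * ρ ∧ |p.2 - θ1| ≤ b * ρ := by
  obtain ⟨h1, h2⟩ := Dsk_abs hρ hp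
  simp only at h1 h2
  rw [abs_div, abs_of_pos hc.ha, div_le_iff₀ hc.ha] at h1
  rw [abs_div, abs_of_pos hc.hb, div_le_iff₀ hc.hb] at h2
  constructor <;> linarith

lemma Ell_mem {l r1 θ1 a b m : ℝ} (hc : Chart l r1 θ1 a b m) {ρ : ℝ} (hρ : ρ ∈ Icc (0:ℝ) 1)
    {p : ℝ × ℝ} (hp : p ∈ Ell r1 θ1 a b ρ) :
    p.1 ∈ Icc (r1 - a) (r1 + a) ∧ p.2 ∈ Icc (θ1 - b) (θ1 + b) := by
  obtain ⟨h1, h2⟩ := Ell_bounds hc hρ.1 hp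
  have := hc.ha
  have := hc.hb
  rw [abs_le] at h1 h2
  refine ⟨⟨?_, ?_⟩, ⟨?_, ?_⟩⟩ <;> nlinarith [hρ.2]

lemma Ell_sub {l r1 θ1 a b m : ℝ} (hc : Chart l r1 θ1 a b m) {ρ : ℝ} (hρ : ρ ∈ Icc (0:ℝ) 1) :
    Ell r1 θ1 a b ρ ⊆ Ioo (0:ℝ) 1 ×ˢ Ioo (0:ℝ) l := by
  intro p hp
  obtain ⟨h1, h2⟩ := Ell_mem hc hρ hp
  refine ⟨⟨?_, ?_⟩, ⟨?_, ?_⟩⟩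
  · linarith [h1.1, hc.h1]
  · linarith [h1.2, hc.h2]
  · linarith [h2.1, hc.h3]
  · linarith [h2.2, hc.h4]

/-- anisotropic density -/
def cden (c : ℝ) (u : ℝ → ℝ → ℝ) (p : ℝ × ℝ) : ℝ :=
  c * (deriv (fun s => u s p.2) p.1) ^ 2 + (deriv (fun φ => u p.1 φ) p.2) ^ 2 / c

lemma cden_integrable {l K c : ℝ} (hc : 0 < c) {u : ℝ → ℝ → ℝ} (h : PolLip l K u)
    {A : Set (ℝ × ℝ)} (hA : MeasurableSet A) (hfin : volume A ≠ ⊤)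
    (hA1 : ∀ p ∈ A, p.1 ∈ Ioo (0:ℝ) 1) : IntegrableOn (cden c u) A := by
  refine integrableOn_of_eq_bdd (g := cden c (clampR u)) (M := c * K ^ 2 + K ^ 2 / c) hA hfin
    (((h.meas_dr.pow_const 2).const_mul c).add ((h.meas_dth.pow_const 2).div_const c))
    (fun p hp => ?_) fun p hp => ?_
  · unfold cden; rw [clamp_deriv_r u (hA1 p hp), clamp_deriv_th u (hA1 p hp)]
  · have h1 := h.abs_dr (hA1 p hp) p.2
    have h2 := h.abs_dth (Ioo_subset_Icc_self (hA1 p hp)) p.2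
    have h3 : |deriv (fun φ => u p.1 φ) p.2| ≤ K := h2.trans
      (mul_le_of_le_one_right h.nonneg (hA1 p hp).2.le)
    unfold cden
    rw [abs_of_nonneg (by positivity)]
    have s1 := sq_le_sq' (abs_le.1 h1).1 (abs_le.1 h1).2
    have s2 := sq_le_sq' (abs_le.1 h3).1 (abs_le.1 h3).2
    gcongr

lemma cden_compare {l r1 θ1 a b m : ℝ} (hc : Chart l r1 θ1 a b m) (u : ℝ → ℝ → ℝ) {p : ℝ × ℝ}
    (hp : p.1 ∈ Icc (r1 - a) (r1 + a)) :
    cden (a / b) u p ≤ (1 / m) * (gradSq u p * p.1) ∧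
    gradSq u p * p.1 ≤ (1 / m) * cden (a / b) u p := by
  have hm := hc.hm
  set c := a / b with hcd
  have hc0 : 0 < c := div_pos hc.ha hc.hb
  have hp0 : 0 < p.1 := by linarith [hp.1, hc.h1]
  have k1 : m * c ≤ p.1 := hc.m1.trans hp.1
  have k2 : m * p.1 ≤ c := (mul_le_mul_of_nonneg_left hp.2 hm.le).trans hc.m2
  unfold cden gradSq
  set X := (deriv (fun s => u s p.2) p.1) ^ 2
  set Y := (deriv (fun φ => u p.1 φ) p.2) ^ 2
  have hX : 0 ≤ X := sq_nonneg _
  have hY : 0 ≤ Y := sq_nonneg _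
  have e : (X + Y / p.1 ^ 2) * p.1 = X * p.1 + Y / p.1 := by field_simp
  rw [e]
  have i1 : Y / c ≤ Y / (m * p.1) := div_le_div_of_nonneg_left hY (by positivity) k2
  have i2 : Y / p.1 ≤ Y / (m * c) := div_le_div_of_nonneg_left hY (by positivity) k1
  have i3 : c ≤ p.1 / m := by rw [le_div_iff₀ hm]; linarith
  have i4 : p.1 ≤ c / m := by rw [le_div_iff₀ hm]; linarith
  constructor
  · calc c * X + Y / c ≤ p.1 / m * X + Y / (m * p.1) := by gcongr
      _ = _ := by field_simp
  · calc X * p.1 + Y / p.1 ≤ X * (c / m) + Y / (m * c) := by gcongr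
      _ = _ := by field_simp

lemma Ell_vol_ne {l r1 θ1 a b m : ℝ} (hc : Chart l r1 θ1 a b m) {ρ : ℝ} (hρ : ρ ∈ Icc (0:ℝ) 1) :
    volume (Ell r1 θ1 a b ρ) ≠ ⊤ :=
  ne_top_of_le_ne_top (vol_window 0 1 0 l) (measure_mono (Ell_sub hc hρ))

lemma cden_int_compare {l r1 θ1 a b m K : ℝ} (hc : Chart l r1 θ1 a b m) {u : ℝ → ℝ → ℝ}
    (h : PolLip l K u) {ρ : ℝ} (hρ : ρ ∈ Icc (0:ℝ) 1) :
    ∫ p in Ell r1 θ1 a b ρ, cden (a / b) u p ≤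
      (1 / m) * ∫ p in Ell r1 θ1 a b ρ, gradSq u p * p.1 ∧
    ∫ p in Ell r1 θ1 a b ρ, gradSq u p * p.1 ≤
      (1 / m) * ∫ p in Ell r1 θ1 a b ρ, cden (a / b) u p := by
  have hΩ := Ell_meas r1 θ1 a b ρ
  have hf := Ell_vol_ne hc hρ
  have hΩ1 : ∀ p ∈ Ell r1 θ1 a b ρ, p.1 ∈ Ioo (0:ℝ) 1 := fun p hp => (Ell_sub hc hρ hp).1
  have i1 := h.integrableOn hΩ hf hΩ1
  have i2 := cden_integrable (div_pos hc.ha hc.hb) h hΩ hf hΩ1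
  rw [← integral_const_mul, ← integral_const_mul]
  exact ⟨setIntegral_mono_on i2 (i1.const_mul _) hΩ
      fun p hp => (cden_compare hc u (Ell_mem hc hρ hp).1).1,
    setIntegral_mono_on i1 (i2.const_mul _) hΩ
      fun p hp => (cden_compare hc u (Ell_mem hc hρ hp).1).2⟩

lemma flatV_eq {l r1 θ1 a b m : ℝ} (hc : Chart l r1 θ1 a b m) (u : ℝ → ℝ → ℝ) {z : ℝ × ℝ}
    (hz : z ∈ Dsk 1) : ∀ᶠ y in nhds z, flatV r1 θ1 a b u y = u (r1 + a * y.1) (θ1 + b * y.2) := by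
  obtain ⟨h1, h2⟩ := Dsk_abs zero_le_one hz
  rw [abs_le] at h1
  have ha := hc.ha
  have hcont : Continuous fun y : ℝ × ℝ => r1 + a * y.1 := by fun_prop
  have hm : r1 + a * z.1 ∈ Ioo (0:ℝ) 1 := ⟨by nlinarith [hc.h1], by nlinarith [hc.h2]⟩
  filter_upwards [(hcont.tendsto z).eventually (Ioo_mem_nhds hm.1 hm.2)] with y hy
  simp only [flatV, clampR, clamp_eq (Ioo_subset_Icc_self hy)]

lemma flat_dirW {l r1 θ1 a b m K : ℝ} (hc : Chart l r1 θ1 a b m) {u : ℝ → ℝ → ℝ}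
    (h : PolLip l K u) {ρ : ℝ} (hρ : ρ ∈ Ioc (0:ℝ) 1) :
    DirW (-Real.pi) (2 * Real.pi) (flat r1 θ1 a b u) ρ =
      ∫ p in Ell r1 θ1 a b ρ, cden (a / b) u p := by
  obtain ⟨C, hC⟩ := flatV_lip (r1 := r1) (θ1 := θ1) hc.ha hc.hb h
  refine chart_transfer hc.ha hc.hb hC (fun s _ φ => rfl) hρ fun z hz => flatV_eq hc u ?_
  have hz' : z.1 ^ 2 + z.2 ^ 2 ≤ ρ ^ 2 := hz
  have : ρ ^ 2 ≤ 1 ^ 2 := pow_le_pow_left₀ hρ.1.le hρ.2 2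
  exact hz'.trans this

lemma flat_energy {l r1 θ1 a b m K R : ℝ} (hc : Chart l r1 θ1 a b m) {u : ℝ → ℝ → ℝ}
    (h : PolLip l K u) (hR : r1 + a < R) (hR1 : R ≤ 1) :
    DirW (-Real.pi) (2 * Real.pi) (flat r1 θ1 a b u) 1 ≤ (1 / m) * DirW 0 l u R := by
  rw [flat_dirW hc h (by simp)]
  refine (cden_int_compare hc h (by simp)).1.trans ?_
  apply mul_le_mul_of_nonneg_left _ (by have := hc.hm; positivity)
  unfold DirW
  apply setIntegral_mono_set
  · exact h.integrableOn (measurableSet_Ioo.prod measurableSet_Ioo) (vol_window _ _ _ _)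
      (fun p hp => ⟨hp.1.1, hp.1.2.trans_le hR1⟩)
  · refine (ae_restrict_iff' (measurableSet_Ioo.prod measurableSet_Ioo)).2
      (Filter.Eventually.of_forall fun p hp => ?_)
    exact mul_nonneg (gradSq_nonneg u p) hp.1.1.le
  · apply LE.le.eventuallyLE
    intro p hp
    have a1 := Ell_sub hc (by simp) hp
    have a2 := Ell_mem hc (by simp) hp
    refine ⟨⟨a1.1.1, by linarith [a2.1.2]⟩, ?_⟩
    rw [zero_add]; exact a1.2

lemma Ell_fst_int {l r1 θ1 a b m : ℝ} (hc : Chart l r1 θ1 a b m) {ρ : ℝ} (hρ : ρ ∈ Icc (0:ℝ) 1) :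
    ∫ p in Ell r1 θ1 a b ρ, p.1 ≤ 4 * a * b * ρ ^ 2 := by
  have h1 := fst_int_le (b := 1) (Ell_meas r1 θ1 a b ρ) (Ell_vol_ne hc hρ) fun p hp =>
    ⟨(Ell_sub hc hρ hp).1.1.le, (Ell_sub hc hρ hp).1.2.le⟩
  have ha := hc.ha
  have hb := hc.hb
  have hsub : Ell r1 θ1 a b ρ ⊆ Icc (r1 - a * ρ) (r1 + a * ρ) ×ˢ Icc (θ1 - b * ρ) (θ1 + b * ρ) := by
    intro p hp
    obtain ⟨h1, h2⟩ := Ell_bounds hc hρ.1 hp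
    rw [abs_le] at h1 h2
    refine ⟨⟨?_, ?_⟩, ⟨?_, ?_⟩⟩ <;> linarith
  have hv : volume.real (Icc (r1 - a * ρ) (r1 + a * ρ) ×ˢ Icc (θ1 - b * ρ) (θ1 + b * ρ) : Set (ℝ × ℝ))
      = (2 * a * ρ) * (2 * b * ρ) := by
    have hρ0 := hρ.1
    rw [Measure.real, Measure.volume_eq_prod, Measure.prod_prod, ENNReal.toReal_mul,
      Real.volume_Icc, Real.volume_Icc, ENNReal.toReal_ofReal, ENNReal.toReal_ofReal]
    · ring
    · have := mul_nonneg hb.le hρ0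
      linarith
    · have := mul_nonneg ha.le hρ0
      linarith
  have h2 := measureReal_mono (μ := volume) hsub (by
    rw [Measure.volume_eq_prod, Measure.prod_prod]; simp [ENNReal.mul_eq_top])
  rw [hv] at h2
  linarith

/-- graft of a compactly supported planar function onto the cone -/
def graft {l : ℝ} (hl : 0 < l) (r1 θ1 a b : ℝ) (u : ℝ → ℝ → ℝ) (h : ℝ × ℝ → ℝ) (r θ : ℝ) : ℝ :=
  u r θ + h ((r - r1) / a, (toIcoMod hl 0 θ - θ1) / b)

lemma not_Dsk_fst {ρ x y : ℝ} (hρ : ρ ∈ Ioo (0:ℝ) 1) (hx : 1 ≤ |x|) : (x, y) ∉ Dsk ρ := fun hz => by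
  have := (Dsk_abs hρ.1.le hz).1
  simp only at this
  linarith [hρ.2]

lemma not_Dsk_snd {ρ x y : ℝ} (hρ : ρ ∈ Ioo (0:ℝ) 1) (hx : 1 ≤ |y|) : (x, y) ∉ Dsk ρ := fun hz => by
  have := (Dsk_abs hρ.1.le hz).2
  simp only at this
  linarith [hρ.2]

lemma graft_polLip {l r1 θ1 a b m K : ℝ} (hl : 0 < l) (hc : Chart l r1 θ1 a b m) {u : ℝ → ℝ → ℝ}
    (hu : PolLip l K u) {h : ℝ × ℝ → ℝ} {C : NNReal} (hh : LipschitzWith C h) {ρ : ℝ}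
    (hρ : ρ ∈ Ioo (0:ℝ) 1) (h0 : ∀ z ∉ Dsk ρ, h z = 0) :
    ∃ K', PolLip l K' (graft hl r1 θ1 a b u h) := by
  have ha := hc.ha
  have hb := hc.hb
  have hr : 0 < r1 - a := by linarith [hc.h1]
  have hK := hu.nonneg
  have hC := C.2
  set M1 := (C : ℝ) / a
  set M2 := (C : ℝ) / b
  have hM1 : 0 ≤ M1 := by positivity
  have hM2 : 0 ≤ M2 := by positivity
  have hM3 : 0 ≤ M2 / (r1 - a) := by positivity
  refine ⟨K + M1 + M2 / (r1 - a), by positivity, fun r θ => ?_, fun r hr s hs θ => ?_,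
    fun r hr' θ φ => ?_⟩
  · simp only [graft, toIcoMod_add_right, hu.per]
  · have e1 := hu.rad r hr s hs θ
    have e2 := hh.dist_le_mul ((r - r1) / a, (toIcoMod hl 0 θ - θ1) / b)
      ((s - r1) / a, (toIcoMod hl 0 θ - θ1) / b)
    rw [Real.dist_eq, Prod.dist_eq, dist_self, max_eq_left dist_nonneg, Real.dist_eq,
      ← sub_div, sub_sub_sub_cancel_right, abs_div, abs_of_pos ha] at e2
    have e3 : (C : ℝ) * (|r - s| / a) = M1 * |r - s| := by simp only [M1]; ring
    rw [e3] at e2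
    have e4 := mul_nonneg hM3 (abs_nonneg (r - s))
    unfold graft
    rw [abs_le] at *
    constructor <;> linarith [e1.1, e1.2, e2.1, e2.2]
  · have e1 := hu.ang r hr' θ φ
    have p1 := mul_nonneg (mul_nonneg hM1 hr'.1) (abs_nonneg (θ - φ))
    have p2 := mul_nonneg (mul_nonneg hM3 hr'.1) (abs_nonneg (θ - φ))
    unfold graft
    rcases le_or_gt r (r1 - a) with hle | hgt
    · have hx : 1 ≤ |(r - r1) / a| := by
        rw [abs_div, abs_of_pos ha, le_div_iff₀ ha, abs_of_nonpos (by linarith)]; linarith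
      rw [h0 _ (not_Dsk_fst hρ hx), h0 _ (not_Dsk_fst hρ hx), add_zero, add_zero]
      linarith
    · have e2 := per_ext_lip hl hM2 (k := fun t => h ((r - r1) / a, (t - θ1) / b))
        (fun x y => by
          have e2 := hh.dist_le_mul ((r - r1) / a, (x - θ1) / b) ((r - r1) / a, (y - θ1) / b)
          rw [Real.dist_eq, Prod.dist_eq, dist_self, max_eq_right dist_nonneg, Real.dist_eq,
            ← sub_div, sub_sub_sub_cancel_right, abs_div, abs_of_pos hb] at e2
          have e3 : (C : ℝ) * (|x - y| / b) = M2 * |x - y| := by simp only [M2]; ring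
          rwa [e3] at e2)
        (h0 _ (not_Dsk_snd hρ (by
          rw [abs_div, abs_of_pos hb, le_div_iff₀ hb, abs_of_nonpos (by linarith [hc.h3])]
          linarith [hc.h3])))
        (h0 _ (not_Dsk_snd hρ (by
          rw [abs_div, abs_of_pos hb, le_div_iff₀ hb, abs_of_nonneg (by linarith [hc.h4])]
          linarith [hc.h4]))) θ φ
      have e3 : M2 * |θ - φ| ≤ M2 / (r1 - a) * r * |θ - φ| := by
        apply mul_le_mul_of_nonneg_right _ (abs_nonneg _)
        rw [div_mul_eq_mul_div, le_div_iff₀ hr]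
        exact mul_le_mul_of_nonneg_left hgt.le hM2
      replace e2 := e2.trans e3
      rw [abs_le] at *
      constructor <;> linarith [e1.1, e1.2, e2.1, e2.2]

lemma toIcoMod_self' {l : ℝ} (hl : 0 < l) {θ : ℝ} (hθ : θ ∈ Ioo (0:ℝ) l) : toIcoMod hl 0 θ = θ := by
  rw [toIcoMod_eq_self hl]
  exact ⟨hθ.1.le, by linarith [hθ.2]⟩

lemma chart_almostMin {l r1 θ1 a b m lp lm : ℝ} (hlp : 0 ≤ lp) (hlm : 0 ≤ lm) (hl : 0 < l)
    (hc : Chart l r1 θ1 a b m) {u : ℝ → ℝ → ℝ} (hu : IsMinimizerJ l lp lm 1 u) :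
    AlmostMin (-Real.pi) (2 * Real.pi) (1 / m ^ 2) (4 * a * b / m * (lp + lm))
      (flat r1 θ1 a b u) := by
  intro ρ hρ w K hw hwu
  have ha := hc.ha
  have hb := hc.hb
  have hm := hc.hm
  have hρc : ρ ∈ Icc (0:ℝ) 1 := ⟨hρ.1.le, hρ.2.le⟩
  have hρo : ρ ∈ Ioc (0:ℝ) 1 := ⟨hρ.1, hρ.2.le⟩
  obtain ⟨Ku, hu'⟩ := hu.1.polLip
  obtain ⟨Cf, hCf⟩ := flatV_lip (r1 := r1) (θ1 := θ1) ha hb hu'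
  have hflat : PolLip (2 * Real.pi) Cf (flat r1 θ1 a b u) := polLip_of_lip hCf
  have hg := hw.sub hflat
  set g : ℝ → ℝ → ℝ := fun r θ => w r θ - flat r1 θ1 a b u r θ with hgd
  have hg0 : ∀ r, ρ ≤ r → ∀ θ, g r θ = 0 := fun r hr θ => by simp only [hgd, hwu r hr θ, sub_self]
  obtain ⟨Cg, hCg⟩ := lift_lip hg fun r hr θ => hg0 r (hρ.2.le.trans hr) θ
  have h0 : ∀ z ∉ Dsk ρ, lift g z = 0 := fun z hz => by
    apply hg0
    by_contra hcon
    push Not at hcon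
    apply hz
    show z.1 ^ 2 + z.2 ^ 2 ≤ ρ ^ 2
    rw [← toC_norm_sq]
    exact pow_le_pow_left₀ (norm_nonneg _) hcon.le 2
  obtain ⟨KW, hW⟩ := graft_polLip hl hc hu' hCg hρ h0
  set W := graft hl r1 θ1 a b u (lift g) with hWd
  have hoff : ∀ p ∈ (Ioo (0:ℝ) 1 ×ˢ Ioo (0:ℝ) l) \ Ell r1 θ1 a b ρ, W p.1 p.2 = u p.1 p.2 := by
    rintro p ⟨hp1, hp2⟩
    simp only [hWd, graft]
    rw [toIcoMod_self' hl hp1.2, h0 _ hp2, add_zero]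
  have hopen : IsOpen ((Ioo (0:ℝ) 1 ×ˢ Ioo (0:ℝ) l) \ Ell r1 θ1 a b ρ) := by
    apply (isOpen_Ioo.prod isOpen_Ioo).sdiff
    have : IsClosed (Dsk ρ) := isClosed_le (by fun_prop) continuous_const
    exact this.preimage (f := fun p : ℝ × ℝ => ((p.1 - r1) / a, (p.2 - θ1) / b)) (by fun_prop)
  have hJ := Jcomp hlp hlm hl hu hW (fun θ => by
      simp only [hWd, graft]
      rw [h0 _ (not_Dsk_fst hρ _), add_zero]
      rw [abs_div, abs_of_pos ha, le_div_iff₀ ha, abs_of_nonneg (by linarith [hc.h2])]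
      linarith [hc.h2])
    (Ell_meas r1 θ1 a b ρ) (Ell_sub hc hρc) (fun p hp =>
      ⟨gradSq_congr (Filter.eventually_of_mem (hopen.mem_nhds hp) hoff), hoff p hp⟩)
  have hTW : DirW (-Real.pi) (2 * Real.pi) w ρ = ∫ p in Ell r1 θ1 a b ρ, cden (a / b) W p := by
    refine chart_transfer ha hb (hCf.add hCg) (fun s hs φ => ?_) hρo fun z hz => ?_
    · show w s φ = flatV r1 θ1 a b u _ + lift g _
      rw [lift_polar hg hs.1]
      simp only [hgd, flat]; ring
    · have hz1 : z ∈ Dsk 1 := by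
        have hz' : z.1 ^ 2 + z.2 ^ 2 ≤ ρ ^ 2 := hz
        have : ρ ^ 2 ≤ 1 ^ 2 := pow_le_pow_left₀ hρ.1.le hρ.2.le 2
        exact hz'.trans this
      obtain ⟨k1, k2⟩ := Dsk_abs zero_le_one hz1
      rw [abs_le] at k2
      have hcont : Continuous fun y : ℝ × ℝ => θ1 + b * y.2 := by fun_prop
      have hm : θ1 + b * z.2 ∈ Ioo (0:ℝ) l := ⟨by nlinarith [hc.h3], by nlinarith [hc.h4]⟩
      filter_upwards [flatV_eq hc u hz1,
        (hcont.tendsto z).eventually (Ioo_mem_nhds hm.1 hm.2)] with y hy1 hy2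
      simp only [hWd, graft]
      rw [toIcoMod_self' hl hy2, hy1]
      congr 2
      apply Prod.ext
      · simp only; field_simp; ring
      · simp only; field_simp; ring
  rw [flat_dirW hc hu' hρo, hTW]
  have c1 := (cden_int_compare hc hu' hρc).1
  have c2 := (cden_int_compare hc hW hρc).2
  have c3 := mul_le_mul_of_nonneg_left (Ell_fst_int hc hρc) (add_nonneg hlp hlm)
  have c4 : ∫ p in Ell r1 θ1 a b ρ, gradSq u p * p.1 ≤
    (1 / m) * (∫ p in Ell r1 θ1 a b ρ, cden (a / b) W p) + (lp + lm) * (4 * a * b * ρ ^ 2) := by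
    linarith
  have c5 := mul_le_mul_of_nonneg_left c4 (by positivity : 0 ≤ 1 / m)
  calc _ ≤ _ := c1
    _ ≤ _ := c5
    _ = _ := by field_simp

lemma polar_exists {x y s : ℝ} (hs : 0 ≤ s) (h : x ^ 2 + y ^ 2 = s ^ 2) :
    ∃ φ, x = s * Real.cos φ ∧ y = s * Real.sin φ := by
  have hn : ‖toC (x, y)‖ = s := by
    have := toC_norm_sq (x, y)
    simp only at this
    rw [h] at this
    exact (pow_left_inj₀ (norm_nonneg _) hs (by norm_num)).1 this
  refine ⟨(toC (x, y)).arg, ?_, ?_⟩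
  · rw [← hn, Complex.norm_mul_cos_arg]; rfl
  · rw [← hn, Complex.norm_mul_sin_arg]; rfl

lemma circles_meet {z : ℝ × ℝ} {N s s' : ℝ} (hN : 0 < N) (hz : z.1 ^ 2 + z.2 ^ 2 = N ^ 2)
    (hs : s ∈ Ioo N (2 * N)) (hs' : s' ∈ Ioo N (2 * N)) :
    ∃ x y, x ^ 2 + y ^ 2 = s ^ 2 ∧ (x - z.1) ^ 2 + (y - z.2) ^ 2 = s' ^ 2 := by
  obtain ⟨a1, a2⟩ := hs
  obtain ⟨b1, b2⟩ := hs'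
  set t := (N ^ 2 + s ^ 2 - s' ^ 2) / (2 * N) with ht
  have ht2 : 2 * N * t = N ^ 2 + s ^ 2 - s' ^ 2 := by rw [ht]; field_simp
  have h1 : t ≤ s := by
    rw [ht, div_le_iff₀ (by positivity)]; nlinarith
  have h2 : -s ≤ t := by
    rw [ht, le_div_iff₀ (by positivity)]; nlinarith
  have h3 : 0 ≤ s ^ 2 - t ^ 2 := by nlinarith
  set k := Real.sqrt (s ^ 2 - t ^ 2)
  have hk : k ^ 2 = s ^ 2 - t ^ 2 := Real.sq_sqrt h3
  have e1 : ((t * z.1 - k * z.2) / N) ^ 2 + ((t * z.2 + k * z.1) / N) ^ 2 = s ^ 2 := by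
    have : ((t * z.1 - k * z.2) / N) ^ 2 + ((t * z.2 + k * z.1) / N) ^ 2 =
      (t ^ 2 + k ^ 2) * (z.1 ^ 2 + z.2 ^ 2) / N ^ 2 := by field_simp; ring
    rw [this, hz, hk]; field_simp; ring
  refine ⟨(t * z.1 - k * z.2) / N, (t * z.2 + k * z.1) / N, e1, ?_⟩
  have e2 : (t * z.1 - k * z.2) / N * z.1 + (t * z.2 + k * z.1) / N * z.2 = t * N := by
    have : (t * z.1 - k * z.2) / N * z.1 + (t * z.2 + k * z.1) / N * z.2 =
      t * (z.1 ^ 2 + z.2 ^ 2) / N := by field_simp; ring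
    rw [this, hz]; field_simp
  nlinarith

/-- the standard chart size -/
def bb (l : ℝ) : ℝ := min (1 / 50) (l / 8)

lemma bb_pos {l : ℝ} (hl : 0 < l) : 0 < bb l := lt_min (by norm_num) (by positivity)

lemma bb_le (l : ℝ) : bb l ≤ 1 / 50 := min_le_left _ _

lemma bb_le' (l : ℝ) : bb l ≤ l / 8 := min_le_right _ _

lemma std_chart {l r0 : ℝ} (hl : 0 < l) (hr : r0 ∈ Ioc (0:ℝ) (1 / 10)) {z : ℝ × ℝ}
    (h1 : |z.1| ≤ 1 / 2) (h2 : |z.2| ≤ 1 / 2) :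
    Chart l (r0 + r0 * bb l * z.1) (l / 2 + bb l * z.2) (r0 * bb l) (bb l) (1 - 2 * bb l) := by
  have hb := bb_pos hl
  have hb1 := bb_le l
  have hb2 := bb_le' l
  obtain ⟨hr0, hr1⟩ := hr
  rw [abs_le] at h1 h2
  set b := bb l
  have hrb : 0 < r0 * b := by positivity
  have hrb1 : r0 * b ≤ r0 * (1 / 50) := by gcongr
  have k1 : r0 * b * z.1 ≤ r0 * b * (1 / 2) := by gcongr; exact h1.2
  have k2 : r0 * b * (-(1 / 2)) ≤ r0 * b * z.1 := by gcongr; exact h1.1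
  have k3 : b * z.2 ≤ b * (1 / 2) := by gcongr; exact h2.2
  have k4 : b * (-(1 / 2)) ≤ b * z.2 := by gcongr; exact h2.1
  have e : r0 * b / b = r0 := by field_simp
  refine ⟨hrb, hb, by linarith, by linarith, by linarith, by linarith, by linarith, ?_, ?_⟩
  · rw [e]; linarith
  · rw [e]
    have : r0 + r0 * b * z.1 + r0 * b ≤ r0 + r0 * b * (3 / 2) := by linarith
    calc (1 - 2 * b) * (r0 + r0 * b * z.1 + r0 * b) ≤ (1 - 2 * b) * (r0 + r0 * b * (3 / 2)) :=
          mul_le_mul_of_nonneg_left this (by linarith)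
      _ ≤ r0 := by nlinarith [mul_pos hrb hb]

/-- the data of exponents -/
lemma exps {l α : ℝ} (hl : 0 < l) (hα : α ∈ Ioo (0:ℝ) (min 1 (2 * Real.pi / l))) :
    0 < α / 2 ∧ α / 2 ≤ 1 ∧ 1 * (α / 2) < Real.sqrt 12 / l ∧
    1 / (1 - 2 * bb l) ^ 2 * (α / 2) < Real.sqrt 12 / (2 * Real.pi) := by
  obtain ⟨h0, h1⟩ := hα
  have h2 := h1.trans_le (min_le_left _ _)
  have h3 := h1.trans_le (min_le_right _ _)
  have hs : 3.464 < Real.sqrt 12 := Real.lt_sqrt_of_sq_lt (by norm_num)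
  have hp := Real.pi_lt_d4
  have hp0 := Real.pi_pos
  refine ⟨by linarith, by linarith, ?_, ?_⟩
  · rw [lt_div_iff₀ hl] at h3 ⊢
    linarith
  · have hb := bb_pos hl
    have hb1 := bb_le l
    have hm : (0.96 : ℝ) ≤ 1 - 2 * bb l := by linarith
    have hm2 : (0.9216 : ℝ) ≤ (1 - 2 * bb l) ^ 2 := by nlinarith
    have i1 : 1 / (1 - 2 * bb l) ^ 2 ≤ 1 / 0.9216 := one_div_le_one_div_of_le (by norm_num) hm2
    have i2 : 1 / (1 - 2 * bb l) ^ 2 * (α / 2) ≤ 1 / 0.9216 * (1 / 2) := by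
      apply mul_le_mul i1 (by linarith) (by linarith) (by norm_num)
    refine i2.trans_lt ?_
    rw [lt_div_iff₀ (by positivity)]
    linarith

lemma flat_holder {l lp lm α : ℝ} (hl : 0 < l) (hlp : 0 ≤ lp) (hlm : 0 ≤ lm)
    (hα : α ∈ Ioo (0:ℝ) (min 1 (2 * Real.pi / l))) :
    ∃ C > (0:ℝ), ∀ u : ℝ → ℝ → ℝ, IsMinimizerJ l lp lm 1 u → Dir l u 1 ≤ 1 →
      ∀ r0 ∈ Ioc (0:ℝ) (1 / 10), ∀ z : ℝ × ℝ, ∀ N : ℝ, 0 ≤ N → N ≤ 1 / 2 →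
        z.1 ^ 2 + z.2 ^ 2 = N ^ 2 →
        |u (r0 + r0 * bb l * z.1) (l / 2 + bb l * z.2) - u r0 (l / 2)| ≤
          C * r0 ^ (α / 4) * N ^ (α / 4) := by
  obtain ⟨g0, g1, gv, gf⟩ := exps hl hα
  have hb := bb_pos hl
  have hb1 := bb_le l
  set b := bb l with hbd
  have hm : 0 < 1 - 2 * b := by linarith
  set m := 1 - 2 * b with hmd
  obtain ⟨C1, hC1, hdec⟩ := decay hl one_pos g0 g1 gv
  obtain ⟨C2, hC2, hgc⟩ := good_circle Real.two_pi_pos (by positivity) g0 g1 gf (κ := 2) (by norm_num)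
  have hll : 0 ≤ lp + lm := by linarith
  set E := 1 / m * (C1 * 2 * (1 + (lp + lm) * l)) + 4 * b * b / m * (lp + lm) with hE
  have hE0 : 0 < E := by positivity
  have hαhalf : α / 4 = α / 2 / 2 := by ring
  refine ⟨2 * C2 * Real.sqrt E, by positivity, fun u hu hD r0 hr z N hN0 hN hz => ?_⟩
  rw [hαhalf]
  rcases hN0.eq_or_lt with rfl | hNp
  · have hz1 : z.1 = 0 := by nlinarith [sq_nonneg z.1, sq_nonneg z.2]
    have hz2 : z.2 = 0 := by nlinarith [sq_nonneg z.1, sq_nonneg z.2]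
    rw [hz1, hz2, mul_zero, mul_zero, add_zero, add_zero, sub_self, abs_zero,
      Real.zero_rpow (by positivity), mul_zero]
  obtain ⟨K, hP⟩ := hu.1.polLip
  have hr0 := hr.1
  have hD' : DirW 0 l u 1 ≤ 1 := by
    have e : DirW 0 l u 1 = Dir l u 1 := by unfold DirW Dir; rw [zero_add]
    rw [e]; exact hD
  -- energy bound for charts
  have hr0g : r0 ≤ r0 ^ (α / 2) := by
    calc r0 = r0 ^ (1:ℝ) := (Real.rpow_one r0).symm
      _ ≤ _ := Real.rpow_le_rpow_of_exponent_ge hr0 (by linarith [hr.2]) g1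
  have key : ∀ y : ℝ × ℝ, |y.1| ≤ 1 / 2 → |y.2| ≤ 1 / 2 → ∃ s ∈ Ioo N (2 * N), ∀ φ,
      |flat (r0 + r0 * b * y.1) (l / 2 + b * y.2) (r0 * b) b u s φ -
        u (r0 + r0 * b * y.1) (l / 2 + b * y.2)| ≤
      C2 * (Real.sqrt E * r0 ^ (α / 2 / 2)) * N ^ (α / 2 / 2) := by
    intro y hy1 hy2
    have hc := std_chart hl hr hy1 hy2
    rw [← hbd, ← hmd] at hc
    have ham := chart_almostMin hlp hlm hl hc hu
    obtain ⟨Cf, hCf⟩ := flatV_lip (r1 := r0 + r0 * b * y.1) (θ1 := l / 2 + b * y.2) hc.ha hc.hb hP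
    have hfl : PolLip (2 * Real.pi) Cf (flat (r0 + r0 * b * y.1) (l / 2 + b * y.2) (r0 * b) b u) :=
      polLip_of_lip hCf
    have hΛ : 0 ≤ 4 * (r0 * b) * b / m * (lp + lm) := by positivity
    obtain ⟨s, hs, hsb⟩ := hgc _ _ _ _ hΛ hfl ham N hNp (by linarith)
    refine ⟨s, hs, fun φ => ?_⟩
    have e0 : flat (r0 + r0 * b * y.1) (l / 2 + b * y.2) (r0 * b) b u 0 0 =
        u (r0 + r0 * b * y.1) (l / 2 + b * y.2) := by
      unfold flat flatV clampR
      simp only [zero_mul, mul_zero, add_zero]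
      rw [clamp_eq]
      exact ⟨by linarith [hc.h1, hc.ha], by linarith [hc.h2, hc.ha]⟩
    have h1 := hsb φ
    rw [e0] at h1
    refine h1.trans ?_
    have hen : DirW (-Real.pi) (2 * Real.pi)
        (flat (r0 + r0 * b * y.1) (l / 2 + b * y.2) (r0 * b) b u) 1 ≤ 1 / m * DirW 0 l u (2 * r0) := by
      apply flat_energy hc hP _ (by linarith [hr.2])
      have := hc.m2
      rw [abs_le] at hy1
      have k1 : r0 * b * y.1 ≤ r0 * b * (1 / 2) := by gcongr; exact hy1.2
      have hrb1 : r0 * b ≤ r0 * (1 / 50) := by gcongr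
      linarith
    have hde := hdec 0 u K ((lp + lm) * l) (by positivity) hP (vertex_almostMin hlp hlm hl hu)
      (2 * r0) ⟨by linarith, by linarith [hr.2]⟩
    have h2r : (2 * r0) ^ (α / 2) ≤ 2 * r0 ^ (α / 2) := by
      rw [Real.mul_rpow (by norm_num) hr0.le]
      gcongr
      calc (2:ℝ) ^ (α / 2) ≤ 2 ^ (1:ℝ) := Real.rpow_le_rpow_of_exponent_le (by norm_num) g1
        _ = 2 := Real.rpow_one 2
    have hde2 : DirW 0 l u (2 * r0) ≤ C1 * (2 * r0 ^ (α / 2)) * (1 + (lp + lm) * l) := by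
      refine hde.trans ?_
      have h0 := DirW_nonneg 0 l u 1
      gcongr
    have htot : DirW (-Real.pi) (2 * Real.pi)
        (flat (r0 + r0 * b * y.1) (l / 2 + b * y.2) (r0 * b) b u) 1 + 4 * (r0 * b) * b / m * (lp + lm)
        ≤ E * r0 ^ (α / 2) := by
      calc _ ≤ 1 / m * (C1 * (2 * r0 ^ (α / 2)) * (1 + (lp + lm) * l)) +
            4 * (r0 ^ (α / 2) * b) * b / m * (lp + lm) := by
            apply add_le_add
            · exact hen.trans (mul_le_mul_of_nonneg_left hde2 (by positivity))
            · gcongr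
        _ = _ := by rw [hE]; ring
    have hsq : Real.sqrt (E * r0 ^ (α / 2)) = Real.sqrt E * r0 ^ (α / 2 / 2) := by
      rw [Real.sqrt_mul hE0.le, Real.sqrt_eq_rpow (r0 ^ (α / 2)), ← Real.rpow_mul hr0.le]
      congr 2; ring
    have := Real.sqrt_le_sqrt htot
    rw [hsq] at this
    gcongr
  have hzN : z ∈ Dsk (1 / 2) := by
    show z.1 ^ 2 + z.2 ^ 2 ≤ (1 / 2) ^ 2
    rw [hz]; gcongr
  obtain ⟨hz1, hz2⟩ := Dsk_abs (by norm_num) hzN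
  obtain ⟨s, hs, hsb⟩ := key (0, 0) (by norm_num) (by norm_num)
  obtain ⟨s', hs', hsb'⟩ := key z hz1 hz2
  obtain ⟨x, y, hxy, hxy'⟩ := circles_meet hNp hz hs hs'
  obtain ⟨φ, p1, p2⟩ := polar_exists (by linarith [hs.1]) hxy
  obtain ⟨φ', q1, q2⟩ := polar_exists (by linarith [hs'.1]) hxy'
  have t1 := hsb φ
  have t2 := hsb' φ'
  simp only [flat, flatV] at t1 t2
  rw [← p1, ← p2] at t1
  rw [← q1, ← q2] at t2
  simp only [mul_zero, add_zero] at t1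
  have w1 : r0 + r0 * b * z.1 + r0 * b * (x - z.1) = r0 + r0 * b * x := by ring
  have w2 : l / 2 + b * z.2 + b * (y - z.2) = l / 2 + b * y := by ring
  rw [w1, w2] at t2
  rw [abs_le] at *
  constructor <;> linarith [t1.1, t1.2, t2.1, t2.2]

lemma vertex_mid {l lp lm α : ℝ} (hl : 0 < l) (hlp : 0 ≤ lp) (hlm : 0 ≤ lm)
    (hα : α ∈ Ioo (0:ℝ) (min 1 (2 * Real.pi / l))) :
    ∃ C > (0:ℝ), ∀ u : ℝ → ℝ → ℝ, IsMinimizerJ l lp lm 1 u → Dir l u 1 ≤ 1 →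
      ∀ r0 ∈ Ioc (0:ℝ) (1 / 10), |u r0 (l / 2) - u 0 0| ≤ C * r0 ^ (α / 4) := by
  obtain ⟨g0, g1, gv, gf⟩ := exps hl hα
  have hb := bb_pos hl
  have hb1 := bb_le l
  obtain ⟨C1, hC1, hF⟩ := flat_holder hl hlp hlm hα
  obtain ⟨C2, hC2, hgc⟩ := good_circle hl one_pos g0 g1 gv (κ := 1 + bb l / 4) (by linarith)
  set b := bb l with hbd
  have hll : 0 ≤ lp + lm := by linarith
  have hαhalf : α / 4 = α / 2 / 2 := by ring
  refine ⟨C1 + C2 * Real.sqrt (1 + (lp + lm) * l), by positivity, fun u hu hD r0 hr => ?_⟩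
  obtain ⟨K, hP⟩ := hu.1.polLip
  have hr0 := hr.1
  have hD' : DirW 0 l u 1 ≤ 1 := by
    have e : DirW 0 l u 1 = Dir l u 1 := by unfold DirW Dir; rw [zero_add]
    rw [e]; exact hD
  obtain ⟨s, hs, hsb⟩ := hgc 0 u K ((lp + lm) * l) (by positivity) hP
    (vertex_almostMin hlp hlm hl hu) r0 hr0 (by nlinarith [hr.2])
  have h1 := hsb (l / 2)
  rw [← hαhalf] at h1
  have hsq : Real.sqrt (DirW 0 l u 1 + (lp + lm) * l) ≤ Real.sqrt (1 + (lp + lm) * l) :=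
    Real.sqrt_le_sqrt (by linarith)
  have h2 : |u s (l / 2) - u 0 0| ≤ C2 * Real.sqrt (1 + (lp + lm) * l) * r0 ^ (α / 4) := by
    refine h1.trans ?_
    gcongr
  set N := (s - r0) / (r0 * b) with hN
  have hN0 : 0 ≤ N := div_nonneg (by linarith [hs.1]) (by positivity)
  have hN1 : N ≤ 1 / 2 := by
    rw [hN, div_le_iff₀ (by positivity)]
    nlinarith [hs.2, mul_pos hr0 hb]
  have h3 := hF u hu hD r0 hr (N, 0) N hN0 hN1 (by simp)
  have e : r0 + r0 * b * N = s := by rw [hN]; field_simp; ring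
  simp only [mul_zero, add_zero] at h3
  rw [e] at h3
  have h4 : N ^ (α / 4) ≤ 1 := Real.rpow_le_one hN0 (by linarith) (by linarith)
  have h5 : C1 * r0 ^ (α / 4) * N ^ (α / 4) ≤ C1 * r0 ^ (α / 4) :=
    mul_le_of_le_one_right (by positivity) h4
  rw [abs_le] at *
  constructor <;> linarith [h2.1, h2.2, h3.1, h3.2]

lemma vertex_all {l lp lm α : ℝ} (hl : 0 < l) (hlp : 0 ≤ lp) (hlm : 0 ≤ lm)
    (hα : α ∈ Ioo (0:ℝ) (min 1 (2 * Real.pi / l))) :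
    ∃ C > (0:ℝ), ∀ u : ℝ → ℝ → ℝ, IsMinimizerJ l lp lm 1 u → Dir l u 1 ≤ 1 →
      ∀ r ∈ Icc (0:ℝ) (1 / 10), ∀ θ, |u r θ - u 0 0| ≤ C * r ^ (α / 4) := by
  obtain ⟨C, hC, h⟩ := vertex_mid hl hlp hlm hα
  refine ⟨C, hC, fun u hu hD r hr θ => ?_⟩
  obtain ⟨K, hP⟩ := hu.1.polLip
  rcases hr.1.eq_or_lt with rfl | hr0
  · rw [hP.zero θ 0, sub_self, abs_zero]
    positivity
  · obtain ⟨m1, m2⟩ := minimizer_shift hlp hlm hl hu hD (θ - l / 2)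
    have h1 := h _ m1 m2 r ⟨hr0, hr.2⟩
    simp only [zero_add] at h1
    rwa [hP.zero (θ - l / 2) 0, add_sub_cancel] at h1

lemma core {l lp lm α : ℝ} (hl : 0 < l) (hlp : 0 ≤ lp) (hlm : 0 ≤ lm)
    (hα : α ∈ Ioo (0:ℝ) (min 1 (2 * Real.pi / l))) :
    ∃ C > (0:ℝ), ∀ u : ℝ → ℝ → ℝ, IsMinimizerJ l lp lm 1 u → Dir l u 1 ≤ 1 →
      ∀ r0 θ0 r1 θ1 D : ℝ, r0 ∈ Icc (0:ℝ) (1 / 10) → r1 ∈ Icc (0:ℝ) r0 → |r0 - r1| ≤ D →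
        (∃ k : ℤ, r1 * |θ0 - θ1 + (k : ℝ) * l| ≤ 2 * (1 + l) * D) →
        |u r0 θ0 - u r1 θ1| ≤ C * D ^ (α / 4) := by
  obtain ⟨C1, hC1, hF⟩ := flat_holder hl hlp hlm hα
  obtain ⟨C2, hC2, hV⟩ := vertex_all hl hlp hlm hα
  have hb := bb_pos hl
  have hb1 := bb_le l
  have hα0 := hα.1
  set b := bb l with hbd
  set A := (5 + 4 * l) / b with hA
  set B := 16 * (1 + l) / b with hB
  have hA0 : 0 < A := by positivity
  have hB0 : 0 < B := by positivity
  refine ⟨C1 * A ^ (α / 4) + 2 * C2 * B ^ (α / 4), by positivity, ?_⟩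
  intro u hu hD r0 θ0 r1 θ1 D hr0 hr1 hD1 hk
  obtain ⟨k, hk⟩ := hk
  have hD0 : 0 ≤ D := (abs_nonneg _).trans hD1
  obtain ⟨K, hP⟩ := hu.1.polLip
  rcases hr0.1.eq_or_lt with h0 | hp
  · have h1 : r1 = 0 := by linarith [hr1.1, hr1.2]
    rw [← h0, h1, hP.zero θ0 θ1, sub_self, abs_zero]
    positivity
  set ψ := θ1 - (k : ℝ) * l with hψ
  have hψu : u r1 θ1 = u r1 ψ := by
    have := per_int (hP.per r1) ψ k
    rw [← this]; congr 1; rw [hψ]; ring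
  have hθψ : θ0 - θ1 + (k : ℝ) * l = -(ψ - θ0) := by rw [hψ]; ring
  rw [hθψ, abs_neg] at hk
  rw [hψu]
  set z : ℝ × ℝ := ((r1 - r0) / (r0 * b), (ψ - θ0) / b) with hz
  have ez1 : r0 * b * z.1 = r1 - r0 := by simp only [hz]; field_simp
  have ez2 : b * z.2 = ψ - θ0 := by simp only [hz]; field_simp
  have hσ : 0 < α / 4 := by positivity
  by_cases hzD : z ∈ Dsk (1 / 2)
  · set N := Real.sqrt (z.1 ^ 2 + z.2 ^ 2) with hN
    have hN2 : z.1 ^ 2 + z.2 ^ 2 = N ^ 2 := (Real.sq_sqrt (by positivity)).symm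
    have hN0 : 0 ≤ N := Real.sqrt_nonneg _
    have hN1 : N ≤ 1 / 2 := by
      have : z.1 ^ 2 + z.2 ^ 2 ≤ (1 / 2) ^ 2 := hzD
      rw [hN2] at this
      exact (pow_le_pow_iff_left₀ hN0 (by norm_num) (by norm_num)).1 this
    obtain ⟨z1, z2⟩ := Dsk_abs (by norm_num) hzD
    obtain ⟨m1, m2⟩ := minimizer_shift hlp hlm hl hu hD (θ0 - l / 2)
    have h1 := hF _ m1 m2 r0 ⟨hp, hr0.2⟩ z N hN0 hN1 hN2
    have e1 : r0 + r0 * b * z.1 = r1 := by rw [ez1]; ring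
    have e2 : l / 2 + b * z.2 + (θ0 - l / 2) = ψ := by rw [ez2]; ring
    rw [e1, e2, add_sub_cancel, abs_sub_comm] at h1
    have hNle : N ≤ |z.1| + |z.2| := by
      apply Real.sqrt_le_iff.2
      refine ⟨by positivity, ?_⟩
      nlinarith [sq_abs z.1, sq_abs z.2, abs_nonneg z.1, abs_nonneg z.2,
        mul_nonneg (abs_nonneg z.1) (abs_nonneg z.2)]
    have f1 : r0 * b * |z.1| = |r0 - r1| := by
      rw [abs_sub_comm, ← ez1, abs_mul, abs_of_pos (by positivity : 0 < r0 * b)]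
    have f2 : b * |z.2| = |ψ - θ0| := by
      rw [← ez2, abs_mul, abs_of_pos hb]
    have hhalf : r0 ≤ 2 * r1 := by
      have g1 : |r0 - r1| ≤ r0 * b * (1 / 2) := by rw [← f1]; gcongr
      have g2 : r0 * b ≤ r0 * (1 / 50) := by gcongr
      linarith [(abs_le.1 g1).2]
    have f3 : r0 * |ψ - θ0| ≤ 2 * (2 * (1 + l) * D) := by
      have : r0 * |ψ - θ0| ≤ 2 * r1 * |ψ - θ0| := by gcongr
      linarith
    have f4 : r0 * N ≤ A * D := by
      rw [hA, div_mul_eq_mul_div, le_div_iff₀ hb]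
      have : r0 * b * N ≤ r0 * b * (|z.1| + |z.2|) := by gcongr
      have e : r0 * b * (|z.1| + |z.2|) = |r0 - r1| + r0 * |ψ - θ0| := by rw [← f1, ← f2]; ring
      rw [e] at this
      linarith
    have f5 : C1 * r0 ^ (α / 4) * N ^ (α / 4) ≤ C1 * A ^ (α / 4) * D ^ (α / 4) := by
      rw [mul_assoc, mul_assoc, ← Real.mul_rpow hp.le hN0, ← Real.mul_rpow hA0.le hD0]
      gcongr
    have f6 : 0 ≤ 2 * C2 * B ^ (α / 4) * D ^ (α / 4) := by positivity
    linarith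
  · have hrB : r0 ≤ B * D := by
      rw [hB, div_mul_eq_mul_div, le_div_iff₀ hb]
      rcases le_or_gt (r0 * b / 4) |r0 - r1| with hc | hc
      · have : 0 ≤ l * D := by positivity
        linarith
      · have f1 : r0 * b * |z.1| = |r0 - r1| := by
          rw [abs_sub_comm, ← ez1, abs_mul, abs_of_pos (by positivity : 0 < r0 * b)]
        have f2 : b * |z.2| = |ψ - θ0| := by
          rw [← ez2, abs_mul, abs_of_pos hb]
        have hz1 : |z.1| ≤ 1 / 4 := by
          by_contra hcon
          push Not at hcon
          have := mul_lt_mul_of_pos_left hcon (by positivity : 0 < r0 * b)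
          linarith
        have hz2 : 1 / 4 ≤ |z.2| := by
          by_contra hcon
          push Not at hcon
          apply hzD
          show z.1 ^ 2 + z.2 ^ 2 ≤ (1 / 2) ^ 2
          nlinarith [sq_abs z.1, sq_abs z.2, abs_nonneg z.1, abs_nonneg z.2]
        have hhalf : r0 ≤ 2 * r1 := by
          have g2 : r0 * b ≤ r0 * (1 / 50) := by gcongr
          linarith [(abs_le.1 hc.le).2]
        have g1 : b * (1 / 4) ≤ |ψ - θ0| := by rw [← f2]; gcongr
        have g3 : r0 * (b * (1 / 4)) ≤ (2 * r1) * |ψ - θ0| := by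
          apply mul_le_mul hhalf g1 (by positivity) (by linarith)
        linarith
    have h1 := hV u hu hD r0 hr0 θ0
    have h2 := hV u hu hD r1 ⟨hr1.1, hr1.2.trans hr0.2⟩ ψ
    have k1 : r0 ^ (α / 4) ≤ B ^ (α / 4) * D ^ (α / 4) := by
      rw [← Real.mul_rpow hB0.le hD0]
      exact Real.rpow_le_rpow hp.le hrB hσ.le
    have k2 : r1 ^ (α / 4) ≤ B ^ (α / 4) * D ^ (α / 4) :=
      (Real.rpow_le_rpow hr1.1 hr1.2 hσ.le).trans k1
    have k3 := mul_le_mul_of_nonneg_left k1 hC2.le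
    have k4 := mul_le_mul_of_nonneg_left k2 hC2.le
    have f6 : 0 ≤ C1 * A ^ (α / 4) * D ^ (α / 4) := by positivity
    rw [abs_le] at *
    constructor <;> linarith [h1.1, h1.2, h2.1, h2.2]

/-- Uniform Hölder regularity: for a cone of length `l`, `α ∈ (0, min(1, 2π/l))` and
`λ₊, λ₋ ≥ 0`, there is `C = C(l, α, λ₊, λ₋) > 0` such that every minimizer of
`J(C_1, λ₊, λ₋)` with Dirichlet energy at most `1` satisfies
`|u(x) − u(y)| ≤ C d(x,y)^{α/4}` on `C_{1/10}`, `d` the cone distance. -/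
theorem initial_holder_regularity (l lp lm α : ℝ) (hl : 0 < l)
    (hlp : 0 ≤ lp) (hlm : 0 ≤ lm)
    (hα : α ∈ Set.Ioo (0:ℝ) (min 1 (2 * Real.pi / l))) :
    ∃ C > (0:ℝ), ∀ u : ℝ → ℝ → ℝ, IsMinimizerJ l lp lm 1 u → Dir l u 1 ≤ 1 →
      ∀ p q : ℝ × ℝ, p.1 ∈ Set.Icc (0:ℝ) (1/10) → q.1 ∈ Set.Icc (0:ℝ) (1/10) →
        |u p.1 p.2 - u q.1 q.2| ≤ C * (coneDist l p q) ^ (α / 4) := by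
  obtain ⟨C, hC, h⟩ := core hl hlp hlm hα
  refine ⟨C, hC, fun u hu hD p q hp hq => ?_⟩
  obtain ⟨h1, k, hk⟩ := coneDist_lower hl p q hp.1 hq.1
  rcases le_total q.1 p.1 with hle | hle
  · rw [min_eq_right hle] at hk
    exact h u hu hD p.1 p.2 q.1 q.2 _ hp ⟨hq.1, hle⟩ h1 ⟨k, hk⟩
  · rw [min_eq_left hle] at hk
    rw [abs_sub_comm]
    refine h u hu hD q.1 q.2 p.1 p.2 _ hq ⟨hp.1, hle⟩ (by rwa [abs_sub_comm]) ⟨-k, ?_⟩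
    have e : q.2 - p.2 + ((-k : ℤ) : ℝ) * l = -(p.2 - q.2 + (k : ℝ) * l) := by push_cast; ring
    rw [e, abs_neg]
    exact hk
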